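/- Let (s,u) be a solution of problem (P) with initial data (s₀,φ) ∈ W̃, and let T_m denote its maximal existence time. If T_m < ∞, then lim_{t↗T_m} u(t,0) = ∞. -/

import Mathlib

open Set MeasureTheory Filter Topology Real
open scoped ENNReal

noncomputable section

/-- `(s₀, φ)` belongs to the class `W`: `s₀ ∈ (0,∞)`, `φ` is Lipschitz on `[0,s₀]`,
not identically zero, nonnegative there, and vanishes at `s₀`. -/
def memW (s₀ : ℝ) (φ : ℝ → ℝ) : Prop :=
  0 < s₀ ∧ (∃ K : NNReal, LipschitzOnWith K φ (Icc 0 s₀)) ∧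
    (∃ x ∈ Icc 0 s₀, φ x ≠ 0) ∧ (∀ x ∈ Icc 0 s₀, 0 ≤ φ x) ∧ φ s₀ = 0

/-- `(s,u)` is a solution of the one-phase Stefan problem (P) on `(0,T]` (finite `T`)
with exponent `p` and initial data `(s₀,φ)`. -/
structure IsSolOn (p s₀ : ℝ) (φ : ℝ → ℝ) (T : ℝ) (s : ℝ → ℝ) (u : ℝ → ℝ → ℝ) : Prop where
  T_pos : 0 < T
  s_cont : ContinuousOn s (Icc 0 T)
  s_diff : ∀ t ∈ Ioc 0 T, DifferentiableAt ℝ s t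
  s_deriv_cont : ContinuousOn (deriv s) (Ioc 0 T)
  s_pos : ∀ t ∈ Icc 0 T, 0 < s t
  ut_diff : ∀ t ∈ Ioc 0 T, ∀ x ∈ Ioo 0 (s t), DifferentiableAt ℝ (fun τ => u τ x) t
  ux_diff : ∀ t ∈ Ioc 0 T, ∀ x ∈ Ioo 0 (s t), DifferentiableAt ℝ (u t) x
  uxx_diff : ∀ t ∈ Ioc 0 T, ∀ x ∈ Ioo 0 (s t), DifferentiableAt ℝ (deriv (u t)) x
  ut_cont : ContinuousOn (fun q : ℝ × ℝ => deriv (fun τ => u τ q.2) q.1)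
      {q : ℝ × ℝ | q.1 ∈ Ioc 0 T ∧ q.2 ∈ Ioo 0 (s q.1)}
  uxx_cont : ContinuousOn (fun q : ℝ × ℝ => deriv (deriv (u q.1)) q.2)
      {q : ℝ × ℝ | q.1 ∈ Ioc 0 T ∧ q.2 ∈ Ioo 0 (s q.1)}
  ux_cont : ContinuousOn (fun q : ℝ × ℝ => deriv (u q.1) q.2)
      {q : ℝ × ℝ | q.1 ∈ Ioc 0 T ∧ q.2 ∈ Icc 0 (s q.1)}
  u_cont : ContinuousOn (fun q : ℝ × ℝ => u q.1 q.2)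
      {q : ℝ × ℝ | q.1 ∈ Icc 0 T ∧ q.2 ∈ Icc 0 (s q.1)}
  u_nonneg : ∀ t ∈ Icc 0 T, ∀ x ∈ Icc 0 (s t), 0 ≤ u t x
  heat : ∀ t ∈ Ioc 0 T, ∀ x ∈ Ioo 0 (s t),
      deriv (fun τ => u τ x) t = deriv (deriv (u t)) x
  bc_zero : ∀ t ∈ Ioc 0 T, -deriv (u t) 0 = u t 0 ^ p
  bc_free : ∀ t ∈ Ioc 0 T, u t (s t) = 0
  stefan : ∀ t ∈ Ioc 0 T, deriv s t = -deriv (u t) (s t)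
  init : ∀ x ∈ Icc 0 s₀, u 0 x = φ x
  init_s : s 0 = s₀

/-- `(s,u)` is a global-in-time solution of problem (P). -/
def IsGlobalSol (p s₀ : ℝ) (φ : ℝ → ℝ) (s : ℝ → ℝ) (u : ℝ → ℝ → ℝ) : Prop :=
  ∀ T : ℝ, 0 < T → IsSolOn p s₀ φ T s u

/-- `Tm ∈ (0,∞]` is the maximal existence time of the solution `(s,u)` of (P) with
initial data `(s₀,φ)`: the solution exists on `(0,T]` for every `T < Tm`, and for
`T > Tm` problem (P) admits no solution on `(0,T]`. -/
def IsMaxSol (p s₀ : ℝ) (φ : ℝ → ℝ) (Tm : ℝ≥0∞) (s : ℝ → ℝ) (u : ℝ → ℝ → ℝ) : Prop :=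
  0 < Tm ∧
    (∀ T : ℝ, 0 < T → ENNReal.ofReal T < Tm → IsSolOn p s₀ φ T s u) ∧
    (∀ T : ℝ, Tm < ENNReal.ofReal T → ¬∃ σ v, IsSolOn p s₀ φ T σ v)

/-- The sup norm `‖u(t)‖_{L^∞(0,s(t))}`. -/
def supNorm (s : ℝ → ℝ) (u : ℝ → ℝ → ℝ) (t : ℝ) : ℝ :=
  sSup (u t '' Ioo 0 (s t))

/-- The `L¹` norm `‖u(t)‖_{L¹(0,s(t))}` of the nonnegative function `u(t,·)`. -/
def L1Norm (s : ℝ → ℝ) (u : ℝ → ℝ → ℝ) (t : ℝ) : ℝ :=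
  ∫ x in (0:ℝ)..(s t), u t x

/-- The energy `E(s(t),u(t))`. -/
def energy (p : ℝ) (s : ℝ → ℝ) (u : ℝ → ℝ → ℝ) (t : ℝ) : ℝ :=
  1 / 2 * (∫ x in (0:ℝ)..(s t), (deriv (u t) x) ^ 2) - u t 0 ^ (p + 1) / (p + 1)

/-- `(a, φ)` belongs to the class `W̃`: `a ∈ (0,∞)` and `φ ∈ W^{1,2}(0,a)` (with weak
derivative `g ∈ L²(0,a)`), not identically zero, nonnegative on `[0,a]`, and `φ(a) = 0`. -/
def memWtilde (a : ℝ) (φ g : ℝ → ℝ) : Prop :=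
  0 < a ∧ MemLp g 2 (volume.restrict (Ioo 0 a)) ∧
    (∀ x ∈ Icc 0 a, φ x = φ 0 + ∫ y in (0:ℝ)..x, g y) ∧
    (∃ x ∈ Icc 0 a, φ x ≠ 0) ∧ (∀ x ∈ Icc 0 a, 0 ≤ φ x) ∧ φ a = 0

/-- The Sobolev norm `‖φ‖_{W^{1,2}(0,a)}` of `φ` with weak derivative `g`. -/
def sobNorm (a : ℝ) (φ g : ℝ → ℝ) : ℝ :=
  Real.sqrt ((∫ x in (0:ℝ)..a, φ x ^ 2) + ∫ x in (0:ℝ)..a, g x ^ 2)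

noncomputable section

/-! ### Maximum principle tools -/

lemma mp_second {f : ℝ → ℝ} {x b : ℝ} (h2 : HasDerivAt (deriv f) b x) (hc : ContinuousAt f x)
    (hb : 0 < b) (hmax : ∀ᶠ y in 𝓝 x, f y ≤ f x) : False := by
  have hloc : IsLocalMax f x := hmax
  have h1 : deriv f x = 0 := hloc.deriv_eq_zero
  have hmin : IsLocalMin f x := isLocalMin_of_deriv_deriv_pos (by rw [h2.deriv]; exact hb) h1 hc
  have heq : f =ᶠ[𝓝 x] fun _ => f x := by
    filter_upwards [hmax, hmin] with y h1 h2 using le_antisymm h1 h2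
  have h3 : deriv (deriv f) x = 0 := by
    rw [heq.deriv.deriv_eq]; simp
  rw [h2.deriv] at h3
  exact hb.ne' h3

lemma mp_right {f : ℝ → ℝ} {x d : ℝ} (h : HasDerivWithinAt f d (Ici x) x) (hd : 0 < d)
    (hmax : ∀ᶠ y in 𝓝[>] x, f y ≤ f x) : False := by
  have h' := (hasDerivWithinAt_iff_tendsto_slope' (by simp)).1 (h.mono Ioi_subset_Ici_self)
  have h2 := h'.eventually (lt_mem_nhds hd)
  obtain ⟨y, hy1, hy2, hy3⟩ := (h2.and (hmax.and self_mem_nhdsWithin)).exists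
  rw [slope_def_field] at hy1
  have : (0:ℝ) < y - x := sub_pos.2 hy3
  have := (div_pos_iff_of_pos_right this).1 hy1
  linarith

lemma mp_left {f : ℝ → ℝ} {x d : ℝ} (h : HasDerivWithinAt f d (Iic x) x) (hd : d < 0)
    (hmax : ∀ᶠ y in 𝓝[<] x, f y ≤ f x) : False := by
  have h' := (hasDerivWithinAt_iff_tendsto_slope' (by simp)).1 (h.mono Iio_subset_Iic_self)
  have h2 := h'.eventually (gt_mem_nhds hd)
  obtain ⟨y, hy1, hy2, hy3⟩ := (h2.and (hmax.and self_mem_nhdsWithin)).exists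
  rw [slope_def_field] at hy1
  have h0 : y - x < 0 := sub_neg.2 hy3
  have : 0 ≤ (f y - f x) / (y - x) := div_nonneg_of_nonpos (by linarith) h0.le
  linarith

/-- no interior maximum (backward in time) of a strict subsolution -/
lemma mp_int {Z : ℝ → ℝ → ℝ} {t x a b : ℝ} (ht : HasDerivAt (fun τ => Z τ x) a t)
    (hc : ContinuousAt (Z t) x) (h2 : HasDerivAt (deriv (Z t)) b x) (hab : a < b)
    (hm1 : ∀ᶠ τ in 𝓝[<] t, Z τ x ≤ Z t x) (hm2 : ∀ᶠ y in 𝓝 x, Z t y ≤ Z t x) : False := by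
  rcases lt_or_ge a 0 with h | h
  · exact mp_left ht.hasDerivWithinAt h hm1
  · exact mp_second h2 hc (h.trans_lt hab) hm2

lemma rpow_diff_le {p K w : ℝ} (hp : 1 < p) (hw : 0 ≤ w) (hwK : w ≤ K) :
    K ^ p - w ^ p ≤ p * K ^ (p - 1) * (K - w) := by
  rcases eq_or_lt_of_le (hw.trans hwK) with h | h
  · have : w = 0 := by linarith
    subst this; rw [← h]; simp
  have h1 := one_add_mul_self_le_rpow_one_add (s := w / K - 1) (p := p)
    (by have := div_nonneg hw h.le; linarith) hp.le
  have h2 : (1 + (w / K - 1)) ^ p = w ^ p / K ^ p := by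
    rw [add_sub_cancel, div_rpow hw h.le]
  rw [h2, le_div_iff₀ (rpow_pos_of_pos h p)] at h1
  have h3 : K ^ p = K ^ (p - 1) * K := by
    rw [← rpow_add_one h.ne']; congr 1; ring
  rw [h3] at h1 ⊢
  have : (1 + p * (w / K - 1)) * (K ^ (p - 1) * K) =
    K ^ (p - 1) * K - p * K ^ (p-1) * (K - w) := by field_simp; ring
  linarith
end

noncomputable section

/-! ### Facts about the given solution on `(0,c)` -/

structure Old (p c : ℝ) (s : ℝ → ℝ) (u : ℝ → ℝ → ℝ) : Prop where
  sd : ∀ t ∈ Ioo 0 c, HasDerivAt s (deriv s t) t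
  vc : ContinuousOn (deriv s) (Ioo 0 c)
  sp : ∀ t ∈ Ioo 0 c, 0 < s t
  uc : ContinuousOn (fun q : ℝ × ℝ => u q.1 q.2) {q : ℝ × ℝ | q.1 ∈ Ioo 0 c ∧ q.2 ∈ Icc 0 (s q.1)}
  ut : ∀ t ∈ Ioo 0 c, ∀ x ∈ Ioo 0 (s t), HasDerivAt (fun τ => u τ x) (deriv (deriv (u t)) x) t
  ux : ∀ t ∈ Ioo 0 c, ∀ x ∈ Ioo 0 (s t), DifferentiableAt ℝ (u t) x
  uxx : ∀ t ∈ Ioo 0 c, ∀ x ∈ Ioo 0 (s t), HasDerivAt (deriv (u t)) (deriv (deriv (u t)) x) x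
  un : ∀ t ∈ Ioo 0 c, ∀ x ∈ Icc 0 (s t), 0 ≤ u t x
  us : ∀ t ∈ Ioo 0 c, u t (s t) = 0
  vn : ∀ t ∈ Ioo 0 c, 0 ≤ deriv s t
  d0 : ∀ t ∈ Ioo 0 c, HasDerivWithinAt (u t) (-(u t 0 ^ p)) (Ici 0) 0
  ds : ∀ t ∈ Ioo 0 c, HasDerivWithinAt (u t) (-deriv s t) (Iic (s t)) (s t)
  uxc : ContinuousOn (fun q : ℝ × ℝ => deriv (u q.1) q.2)
      {q : ℝ × ℝ | q.1 ∈ Ioo 0 c ∧ q.2 ∈ Icc 0 (s q.1)}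

lemma contOn_glue {X : Type*} [TopologicalSpace X] {f : X → ℝ} {c : ℝ} {g : X → ℝ} {P : X → Prop}
    (hg : Continuous g)
    (h : ∀ T, 0 < T → T < c → ContinuousOn f {q | g q ∈ Ioc 0 T ∧ P q}) :
    ContinuousOn f {q | g q ∈ Ioo 0 c ∧ P q} := by
  intro q hq
  have h1 : g q < (g q + c) / 2 := by linarith [hq.1.2]
  have hT := h ((g q + c) / 2) (by linarith [hq.1.1, hq.1.2]) (by linarith [hq.1.2]) q
    ⟨⟨hq.1.1, h1.le⟩, hq.2⟩
  refine hT.mono_of_mem_nhdsWithin ?_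
  have : {q' | g q' < (g q + c) / 2} ∈ 𝓝[{q | g q ∈ Ioo 0 c ∧ P q}] q :=
    mem_nhdsWithin_of_mem_nhds ((isOpen_lt hg continuous_const).mem_nhds h1)
  filter_upwards [this, self_mem_nhdsWithin] with q' h1 h2
  exact ⟨⟨h2.1.1, h1.le⟩, h2.2⟩

lemma Old.of_sol {p s₀ c : ℝ} {φ s : ℝ → ℝ} {u : ℝ → ℝ → ℝ}
    (H : ∀ T, 0 < T → T < c → IsSolOn p s₀ φ T s u) : Old p c s u := by
  have key : ∀ t ∈ Ioo 0 c, IsSolOn p s₀ φ t s u := fun t ht => H t ht.1 ht.2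
  have mm : ∀ t ∈ Ioo 0 c, t ∈ Ioc 0 t := fun t ht => ⟨ht.1, le_rfl⟩
  have mm' : ∀ t ∈ Ioo 0 c, t ∈ Icc 0 t := fun t ht => ⟨ht.1.le, le_rfl⟩
  have uxc : ContinuousOn (fun q : ℝ × ℝ => deriv (u q.1) q.2)
      {q : ℝ × ℝ | q.1 ∈ Ioo 0 c ∧ q.2 ∈ Icc 0 (s q.1)} :=
    contOn_glue (g := fun q : ℝ × ℝ => q.1) (P := fun q : ℝ × ℝ => q.2 ∈ Icc 0 (s q.1))
      continuous_fst fun T h0 hT => (H T h0 hT).ux_cont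
  have uc : ContinuousOn (fun q : ℝ × ℝ => u q.1 q.2)
      {q : ℝ × ℝ | q.1 ∈ Ioo 0 c ∧ q.2 ∈ Icc 0 (s q.1)} :=
    contOn_glue (g := fun q : ℝ × ℝ => q.1) (P := fun q : ℝ × ℝ => q.2 ∈ Icc 0 (s q.1))
      continuous_fst fun T h0 hT => (H T h0 hT).u_cont.mono
        fun q hq => ⟨⟨hq.1.1.le, hq.1.2⟩, hq.2⟩
  have sl : ∀ t : ℝ, Continuous fun x : ℝ => (t, x) := fun t => by fun_prop
  have ucs : ∀ t ∈ Ioo 0 c, ContinuousOn (u t) (Icc 0 (s t)) := fun t ht =>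
    uc.comp (f := fun x : ℝ => (t, x)) (sl t).continuousOn (fun x hx => ⟨ht, hx⟩)
  have uxcs : ∀ t ∈ Ioo 0 c, ContinuousOn (deriv (u t)) (Icc 0 (s t)) := fun t ht =>
    uxc.comp (f := fun x : ℝ => (t, x)) (sl t).continuousOn (fun x hx => ⟨ht, hx⟩)
  have sp : ∀ t ∈ Ioo 0 c, 0 < s t := fun t ht => (key t ht).s_pos t (mm' t ht)
  have dif : ∀ t ∈ Ioo 0 c, DifferentiableOn ℝ (u t) (Ioo 0 (s t)) := fun t ht x hx =>
    ((key t ht).ux_diff t (mm t ht) x hx).differentiableWithinAt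
  have ds : ∀ t ∈ Ioo 0 c, HasDerivWithinAt (u t) (-deriv s t) (Iic (s t)) (s t) := by
    intro t ht
    have h0 := sp t ht
    refine hasDerivWithinAt_Iic_of_tendsto_deriv (dif t ht)
      (((ucs t ht) (s t) ⟨h0.le, le_rfl⟩).mono Ioo_subset_Icc_self)
      (Ioo_mem_nhdsLT h0) ?_
    rw [(key t ht).stefan t (mm t ht), neg_neg]
    refine ((uxcs t ht) (s t) ⟨h0.le, le_rfl⟩).mono_left ?_
    rw [← nhdsWithin_Ioo_eq_nhdsLT h0]
    exact nhdsWithin_mono _ Ioo_subset_Icc_self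
  have us : ∀ t ∈ Ioo 0 c, u t (s t) = 0 := fun t ht => (key t ht).bc_free t (mm t ht)
  have un : ∀ t ∈ Ioo 0 c, ∀ x ∈ Icc 0 (s t), 0 ≤ u t x := fun t ht =>
    (key t ht).u_nonneg t (mm' t ht)
  refine ⟨fun t ht => ((key t ht).s_diff t (mm t ht)).hasDerivAt, ?_, sp, uc, ?_,
    fun t ht x hx => (key t ht).ux_diff t (mm t ht) x hx,
    fun t ht x hx => ((key t ht).uxx_diff t (mm t ht) x hx).hasDerivAt, un, us, ?_, ?_, ds, uxc⟩
  · have := contOn_glue (f := deriv s) (g := fun q : ℝ => q) (P := fun _ => True) (c := c)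
      continuous_id fun T h0 hT => (H T h0 hT).s_deriv_cont.mono fun q hq => hq.1
    exact this.mono fun q hq => ⟨hq, trivial⟩
  · intro t ht x hx
    rw [← (key t ht).heat t (mm t ht) x hx]
    exact ((key t ht).ut_diff t (mm t ht) x hx).hasDerivAt
  · intro t ht
    by_contra hneg
    push Not at hneg
    have h1 := (ds t ht).neg
    refine mp_left h1 (by simpa using hneg) ?_
    filter_upwards [Ioo_mem_nhdsLT (sp t ht)] with y hy
    simp only [Pi.neg_apply, us t ht]
    have := un t ht y ⟨hy.1.le, hy.2.le⟩
    linarith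
  · intro t ht
    have h0 := sp t ht
    refine hasDerivWithinAt_Ici_of_tendsto_deriv (dif t ht)
      (((ucs t ht) 0 ⟨le_rfl, h0.le⟩).mono Ioo_subset_Icc_self)
      (Ioo_mem_nhdsGT h0) ?_
    rw [← (key t ht).bc_zero t (mm t ht), neg_neg]
    refine ((uxcs t ht) 0 ⟨le_rfl, h0.le⟩).mono_left ?_
    rw [← nhdsWithin_Ioo_eq_nhdsGT h0]
    exact nhdsWithin_mono _ Ioo_subset_Icc_self
end

noncomputable section

/-! ### A priori bounds -/

lemma mp_second' {f f' : ℝ → ℝ} {x b : ℝ} (h1 : ∀ᶠ y in 𝓝 x, HasDerivAt f (f' y) y)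
    (h2 : HasDerivAt f' b x)
    (hb : 0 < b) (hmax : ∀ᶠ y in 𝓝 x, f y ≤ f x) : False := by
  have he : deriv f =ᶠ[𝓝 x] f' := by
    filter_upwards [h1] with y hy using hy.deriv
  exact mp_second (h2.congr_of_eventuallyEq he) h1.self_of_nhds.continuousAt hb hmax

lemma mp_int' {Z : ℝ → ℝ → ℝ} {f' : ℝ → ℝ} {t x a b : ℝ} (ht : HasDerivAt (fun τ => Z τ x) a t)
    (h1 : ∀ᶠ y in 𝓝 x, HasDerivAt (Z t) (f' y) y) (h2 : HasDerivAt f' b x) (hab : a < b)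
    (hm1 : ∀ᶠ τ in 𝓝[<] t, Z τ x ≤ Z t x) (hm2 : ∀ᶠ y in 𝓝 x, Z t y ≤ Z t x) : False := by
  rcases lt_or_ge a 0 with h | h
  · exact mp_left ht.hasDerivWithinAt h hm1
  · exact mp_second' h1 h2 (h.trans_lt hab) hm2

lemma compact_region {a b : ℝ} {l m : ℝ → ℝ} (hl : ContinuousOn l (Icc a b))
    (hm : ContinuousOn m (Icc a b)) :
    IsCompact {q : ℝ × ℝ | q.1 ∈ Icc a b ∧ l q.1 ≤ q.2 ∧ q.2 ≤ m q.1} := by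
  obtain ⟨A, hA⟩ := (isCompact_Icc.image_of_continuousOn hl).isBounded.bddBelow
  obtain ⟨B, hB⟩ := (isCompact_Icc.image_of_continuousOn hm).isBounded.bddAbove
  have hbox : IsCompact (Icc a b ×ˢ Icc A B) := isCompact_Icc.prod isCompact_Icc
  have h1 : ContinuousOn (fun q : ℝ × ℝ => (q.2 - l q.1, m q.1 - q.2)) (Icc a b ×ˢ Icc A B) := by
    have h1 : ContinuousOn (fun q : ℝ × ℝ => l q.1) (Icc a b ×ˢ Icc A B) :=
      hl.comp continuousOn_fst fun q hq => hq.1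
    have h2 : ContinuousOn (fun q : ℝ × ℝ => m q.1) (Icc a b ×ˢ Icc A B) :=
      hm.comp continuousOn_fst fun q hq => hq.1
    exact (continuousOn_snd.sub h1).prodMk (h2.sub continuousOn_snd)
  have h2 := h1.preimage_isClosed_of_isClosed hbox.isClosed (isClosed_Ici.prod isClosed_Ici :
    IsClosed (Ici (0:ℝ) ×ˢ Ici (0:ℝ)))
  convert hbox.of_isClosed_subset h2 inter_subset_left using 1
  ext ⟨t, x⟩
  simp only [mem_inter_iff, mem_prod, mem_preimage, mem_Ici, sub_nonneg, mem_ofPred_eq]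
  constructor
  · rintro ⟨h1, h3, h4⟩
    exact ⟨⟨h1, (hA ⟨t, h1, rfl⟩).trans h3, h4.trans (hB ⟨t, h1, rfl⟩)⟩, h3, h4⟩
  · rintro ⟨⟨h1, h2⟩, h3, h4⟩; exact ⟨h1, h3, h4⟩

section
variable {p c : ℝ} {s : ℝ → ℝ} {u : ℝ → ℝ → ℝ}

lemma Old.sc (O : Old p c s u) : ContinuousOn s (Ioo 0 c) := fun t ht =>
  (O.sd t ht).continuousAt.continuousWithinAt

lemma Old.smono (O : Old p c s u) : MonotoneOn s (Ioo 0 c) := by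
  refine monotoneOn_of_deriv_nonneg (convex_Ioo 0 c) O.sc ?_ ?_
  · intro t ht; rw [interior_Ioo] at ht; exact (O.sd t ht).differentiableAt.differentiableWithinAt
  · intro t ht; rw [interior_Ioo] at ht; exact O.vn t ht

lemma Old.nearT (O : Old p c s u) {a b t x : ℝ} (ha : 0 < a) (hb : b < c) (hat : a < t)
    (htb : t ≤ b) (hx : x < s t) : ∀ᶠ τ in 𝓝[<] t, τ ∈ Icc a b ∧ x < s τ := by
  have h1 : ∀ᶠ τ in 𝓝[<] t, τ ∈ Ioo a t := Ioo_mem_nhdsLT hat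
  have h2 : ∀ᶠ τ in 𝓝[<] t, x < s τ :=
    ((O.sd t ⟨ha.trans hat, htb.trans_lt hb⟩).continuousAt.eventually (lt_mem_nhds hx)).filter_mono
      nhdsWithin_le_nhds
  filter_upwards [h1, h2] with τ h1 h2
  exact ⟨⟨h1.1.le, h1.2.le.trans htb⟩, h2⟩

lemma Old.barrier (O : Old p c s u) {a b N : ℝ} (ha : 0 < a) (hb : b < c)
    (h0 : ∀ x ∈ Icc 0 (s a), u a x ≤ N * (s a - x)) (hw : ∀ t ∈ Icc a b, u t 0 ^ p < N)
    (hN : 0 ≤ N) :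
    ∀ t ∈ Icc a b, ∀ x ∈ Icc 0 (s t), u t x ≤ N * (s t - x) := by
  intro t₁ ht₁ x₁ hx₁
  by_contra hcon
  push Not at hcon
  have hsub : ∀ t ∈ Icc a b, t ∈ Ioo 0 c := fun t ht => ⟨ha.trans_le ht.1, ht.2.trans_lt hb⟩
  have hsc : ContinuousOn s (Icc a b) := O.sc.mono hsub
  set ε := (u t₁ x₁ - N * (s t₁ - x₁)) / (t₁ - a + 1) with hε
  have hd : 0 < t₁ - a + 1 := by linarith [ht₁.1]
  have hεp : 0 < ε := div_pos (by linarith) hd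
  let Z : ℝ → ℝ → ℝ := fun t x => u t x - N * (s t - x) - ε * (t - a)
  have hZ1 : 0 < Z t₁ x₁ := by
    have : ε * (t₁ - a + 1) = u t₁ x₁ - N * (s t₁ - x₁) := by rw [hε]; field_simp
    simp only [Z]; nlinarith
  have hcomp := compact_region (a := a) (b := b) (l := fun _ => 0) (m := s) continuousOn_const hsc
  have hZc : ContinuousOn (fun q : ℝ × ℝ => Z q.1 q.2)
      {q : ℝ × ℝ | q.1 ∈ Icc a b ∧ 0 ≤ q.2 ∧ q.2 ≤ s q.1} := by
    have h1 : ContinuousOn (fun q : ℝ × ℝ => u q.1 q.2)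
        {q : ℝ × ℝ | q.1 ∈ Icc a b ∧ 0 ≤ q.2 ∧ q.2 ≤ s q.1} :=
      O.uc.mono fun q hq => ⟨hsub _ hq.1, hq.2⟩
    have h2 : ContinuousOn (fun q : ℝ × ℝ => s q.1)
      {q : ℝ × ℝ | q.1 ∈ Icc a b ∧ 0 ≤ q.2 ∧ q.2 ≤ s q.1} :=
      hsc.comp continuousOn_fst fun q hq => hq.1
    exact (h1.sub (continuousOn_const.mul (h2.sub continuousOn_snd))).sub
      (continuousOn_const.mul (continuousOn_fst.sub continuousOn_const))
  obtain ⟨⟨t, x⟩, ⟨ht, hx0, hxs⟩, hmax⟩ := hcomp.exists_isMaxOn ⟨(t₁, x₁), ht₁, hx₁.1, hx₁.2⟩ hZc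
  simp only at ht hx0 hxs
  have hmax' : ∀ t' x', t' ∈ Icc a b → 0 ≤ x' → x' ≤ s t' → Z t' x' ≤ Z t x :=
    fun t' x' h1 h2 h3 => hmax (show (t', x') ∈ _ from ⟨h1, h2, h3⟩)
  have hpos : 0 < Z t x := hZ1.trans_le (hmax' _ _ ht₁ hx₁.1 hx₁.2)
  have hta : a < t := by
    rcases eq_or_lt_of_le ht.1 with h | h
    · exfalso; subst h; have := h0 x ⟨hx0, hxs⟩; simp only [Z] at hpos; linarith
    · exact h
  have hxs' : x < s t := by
    rcases eq_or_lt_of_le hxs with h | h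
    · exfalso; simp only [Z, h, O.us t (hsub t ht)] at hpos
      nlinarith
    · exact h
  rcases eq_or_lt_of_le hx0 with h | h
  · subst h
    have hd := ((O.d0 t (hsub t ht)).sub (((hasDerivWithinAt_const (0:ℝ) (Ici 0) (s t)).sub
      (hasDerivWithinAt_id (0:ℝ) (Ici 0))).const_mul N)).sub_const (ε * (t - a))
    refine mp_right hd (by have := hw t ht; linarith) ?_
    filter_upwards [Ioo_mem_nhdsGT hxs'] with y hy
    exact hmax' t y ht hy.1.le hy.2.le
  · have hin : x ∈ Ioo 0 (s t) := ⟨h, hxs'⟩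
    have hdt : HasDerivAt (fun τ => Z τ x) (deriv (deriv (u t)) x - N * (deriv s t - 0) - ε * 1) t :=
      ((O.ut t (hsub t ht) x hin).sub (((O.sd t (hsub t ht)).sub
        (hasDerivAt_const t x)).const_mul N)).sub (((hasDerivAt_id t).sub_const a).const_mul ε)
    have hx1 : ∀ᶠ y in 𝓝 x, HasDerivAt (Z t) (deriv (u t) y - N * (0 - 1)) y := by
      filter_upwards [Ioo_mem_nhds h hxs'] with y hy
      exact ((O.ux t (hsub t ht) y hy).hasDerivAt.sub (((hasDerivAt_const y (s t)).sub
        (hasDerivAt_id y)).const_mul N)).sub_const _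
    refine mp_int' hdt hx1 ((O.uxx t (hsub t ht) x hin).sub_const _) ?_ ?_ ?_
    · have := O.vn t (hsub t ht); nlinarith
    · filter_upwards [O.nearT ha hb hta ht.2 hxs'] with τ hτ
      exact hmax' τ x hτ.1 h.le hτ.2.le
    · filter_upwards [Ioo_mem_nhds h hxs'] with y hy
      exact hmax' t y ht hy.1.le hy.2.le

lemma Old.doubling (O : Old p c s u) {a b N : ℝ} (ha : 0 < a) (hb : b < c)
    (h0 : ∀ x ∈ Icc 0 (s a), ∀ y ∈ Icc x (s a), u a x - u a y ≤ N * (y - x))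
    (hw : ∀ t ∈ Icc a b, u t 0 ^ p < N) (hN : 0 ≤ N) (hab : a ≤ b) :
    ∀ t ∈ Icc a b, ∀ x ∈ Icc 0 (s t), ∀ y ∈ Icc x (s t), u t x - u t y ≤ N * (y - x) := by
  intro t₁ ht₁ x₁ hx₁ y₁ hy₁
  by_contra hcon
  push Not at hcon
  have hsub : ∀ t ∈ Icc a b, t ∈ Ioo 0 c := fun t ht => ⟨ha.trans_le ht.1, ht.2.trans_lt hb⟩
  have hsc : ContinuousOn s (Icc a b) := O.sc.mono hsub
  have hbar := O.barrier ha hb (N := N) (fun x hx => by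
    have := h0 x hx (s a) ⟨hx.2, le_rfl⟩
    rw [O.us a (hsub a ⟨le_rfl, hab⟩)] at this; linarith) hw hN
  set ε := (u t₁ x₁ - u t₁ y₁ - N * (y₁ - x₁)) / (t₁ - a + 1) with hε
  have hd : 0 < t₁ - a + 1 := by linarith [ht₁.1]
  have hεp : 0 < ε := div_pos (by linarith) hd
  let Z : ℝ → ℝ → ℝ → ℝ := fun t x y => u t x - u t y - N * (y - x) - ε * (t - a)
  have hZ1 : 0 < Z t₁ x₁ y₁ := by
    have : ε * (t₁ - a + 1) = u t₁ x₁ - u t₁ y₁ - N * (y₁ - x₁) := by rw [hε]; field_simp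
    simp only [Z]; nlinarith
  have hcr := compact_region (a := a) (b := b) (l := fun _ => 0) (m := s) continuousOn_const hsc
  let K : Set ((ℝ × ℝ) × (ℝ × ℝ)) :=
    ({q : ℝ × ℝ | q.1 ∈ Icc a b ∧ 0 ≤ q.2 ∧ q.2 ≤ s q.1} ×ˢ
      {q : ℝ × ℝ | q.1 ∈ Icc a b ∧ 0 ≤ q.2 ∧ q.2 ≤ s q.1}) ∩
      {r | r.1.1 = r.2.1 ∧ r.1.2 ≤ r.2.2}
  have hcomp : IsCompact K := (hcr.prod hcr).inter_right
    ((isClosed_eq (f := fun r : (ℝ × ℝ) × (ℝ × ℝ) => r.1.1) (g := fun r => r.2.1)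
      (by fun_prop) (by fun_prop)).inter (isClosed_le (f := fun r : (ℝ × ℝ) × (ℝ × ℝ) => r.1.2)
      (g := fun r => r.2.2) (by fun_prop) (by fun_prop)))
  have hZc : ContinuousOn (fun r : (ℝ × ℝ) × (ℝ × ℝ) =>
      u r.1.1 r.1.2 - u r.2.1 r.2.2 - N * (r.2.2 - r.1.2) - ε * (r.1.1 - a)) K := by
    have h1 := O.uc.comp (f := fun r : (ℝ × ℝ) × (ℝ × ℝ) => r.1) (s := K) continuousOn_fst
      fun r hr => ⟨hsub _ hr.1.1.1, hr.1.1.2⟩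
    have h2 := O.uc.comp (f := fun r : (ℝ × ℝ) × (ℝ × ℝ) => r.2) (s := K) continuousOn_snd
      fun r hr => ⟨hsub _ hr.1.2.1, hr.1.2.2⟩
    refine ((h1.sub h2).sub ?_).sub ?_ <;> fun_prop
  obtain ⟨⟨⟨t, x⟩, ⟨t', y⟩⟩, ⟨⟨⟨ht, hx0, hxs⟩, -, hy0, hys⟩, htt, hxy⟩, hmax⟩ :=
    hcomp.exists_isMaxOn ⟨((t₁, x₁), (t₁, y₁)), ⟨⟨ht₁, hx₁.1, hx₁.2⟩, ht₁, hx₁.1.trans hy₁.1, hy₁.2⟩,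
      rfl, hy₁.1⟩ hZc
  simp only at ht hx0 hxs hy0 hys htt hxy
  subst htt
  have hmax' : ∀ t' x' y', t' ∈ Icc a b → 0 ≤ x' → x' ≤ y' → y' ≤ s t' → Z t' x' y' ≤ Z t x y :=
    fun t' x' y' h1 h2 h3 h4 => hmax (show ((t', x'), (t', y')) ∈ _ from
      ⟨⟨⟨h1, h2, h3.trans h4⟩, h1, h2.trans h3, h4⟩, rfl, h3⟩)
  have hpos : 0 < Z t x y := hZ1.trans_le (hmax' _ _ _ ht₁ hx₁.1 hy₁.1 hy₁.2)
  have hta : a < t := by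
    rcases eq_or_lt_of_le ht.1 with h | h
    · exfalso; subst h; have := h0 x ⟨hx0, hxs⟩ y ⟨hxy, hys⟩; simp only [Z] at hpos; linarith
    · exact h
  have hεt : 0 ≤ ε * (t - a) := mul_nonneg hεp.le (by linarith)
  have hxy' : x < y := by
    rcases eq_or_lt_of_le hxy with h | h
    · exfalso; simp only [Z, h] at hpos; linarith
    · exact h
  have hys' : y < s t := by
    rcases eq_or_lt_of_le hys with h | h
    · exfalso
      have := hbar t ht x ⟨hx0, hxs⟩
      simp only [Z, h, O.us t (hsub t ht)] at hpos
      linarith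
    · exact h
  rcases eq_or_lt_of_le hx0 with h | h
  · subst h
    have hd := (((O.d0 t (hsub t ht)).sub_const (u t y)).sub (((hasDerivWithinAt_const (0:ℝ)
      (Ici 0) y).sub (hasDerivWithinAt_id (0:ℝ) (Ici 0))).const_mul N)).sub_const (ε * (t - a))
    refine mp_right hd (by have := hw t ht; linarith) ?_
    filter_upwards [Ioo_mem_nhdsGT hxy'] with z hz
    exact hmax' t z y ht hz.1.le hz.2.le hys
  · have hin : x ∈ Ioo 0 (s t) := ⟨h, hxy'.trans hys'⟩
    have hiny : y ∈ Ioo 0 (s t) := ⟨h.trans hxy', hys'⟩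
    set A := deriv (deriv (u t)) x
    set B := deriv (deriv (u t)) y
    have hdt : HasDerivAt (fun τ => Z τ x y) (A - B - ε * 1) t :=
      (((O.ut t (hsub t ht) x hin).sub (O.ut t (hsub t ht) y hiny)).sub_const (N * (y - x))).sub
        (((hasDerivAt_id t).sub_const a).const_mul ε)
    have hge : 0 ≤ A - B - ε * 1 := by
      by_contra hlt
      push Not at hlt
      refine mp_left hdt.hasDerivWithinAt hlt ?_
      filter_upwards [O.nearT ha hb hta ht.2 hys'] with τ hτ
      exact hmax' τ x y hτ.1 h.le hxy hτ.2.le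
    rcases lt_or_ge 0 A with hA | hA
    · have hx1 : ∀ᶠ z in 𝓝 x, HasDerivAt (fun z => Z t z y) (deriv (u t) z - N * (0 - 1)) z := by
        filter_upwards [Ioo_mem_nhds hin.1 hin.2] with z hz
        exact (((O.ux t (hsub t ht) z hz).hasDerivAt.sub_const (u t y)).sub
          (((hasDerivAt_const z y).sub (hasDerivAt_id z)).const_mul N)).sub_const _
      refine mp_second' hx1 ((O.uxx t (hsub t ht) x hin).sub_const _) hA ?_
      filter_upwards [Ioo_mem_nhds h hxy'] with z hz
      exact hmax' t z y ht hz.1.le hz.2.le hys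
    · have hB : 0 < -B := by linarith
      have hx1 : ∀ᶠ z in 𝓝 y, HasDerivAt (fun z => Z t x z) (-deriv (u t) z - N * (1 - 0)) z := by
        filter_upwards [Ioo_mem_nhds hiny.1 hiny.2] with z hz
        exact (((O.ux t (hsub t ht) z hz).hasDerivAt.const_sub (u t x)).sub
          (((hasDerivAt_id z).sub (hasDerivAt_const z x)).const_mul N)).sub_const _
      refine mp_second' hx1 ((O.uxx t (hsub t ht) y hiny).neg.sub_const _) hB ?_
      filter_upwards [Ioo_mem_nhds hxy' hys'] with z hz
      exact hmax' t x z ht hx0 hz.1.le hz.2.le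

lemma Old.persist (O : Old p c s u) (hp : 1 < p) {a b K : ℝ} (ha : 0 < a) (hb : b < c) (hK : 0 < K)
    (hKs : ∀ t ∈ Icc a b, K ≤ K ^ p * s t)
    (h0 : ∀ x ∈ Icc 0 (s a), K - K ^ p * x ≤ u a x) :
    ∀ t ∈ Icc a b, K ≤ u t 0 := by
  intro t₁ ht₁
  by_contra hcon
  push Not at hcon
  have hsub : ∀ t ∈ Icc a b, t ∈ Ioo 0 c := fun t ht => ⟨ha.trans_le ht.1, ht.2.trans_lt hb⟩
  have hsc : ContinuousOn s (Icc a b) := O.sc.mono hsub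
  set μ := p * K ^ (p - 1) + 1 with hμ
  set l := μ ^ 2 + 1 with hl
  let D : ℝ → ℝ → ℝ := fun t x => K - K ^ p * x - u t x
  let Z : ℝ → ℝ → ℝ := fun t x => exp (-l * t + μ * x) * D t x
  have hZ1 : 0 < Z t₁ 0 := by
    simp only [Z, D]; apply mul_pos (exp_pos _); linarith
  have hcomp := compact_region (a := a) (b := b) (l := fun _ => 0) (m := s) continuousOn_const hsc
  have hZc : ContinuousOn (fun q : ℝ × ℝ => Z q.1 q.2)
      {q : ℝ × ℝ | q.1 ∈ Icc a b ∧ 0 ≤ q.2 ∧ q.2 ≤ s q.1} := by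
    have h1 : ContinuousOn (fun q : ℝ × ℝ => u q.1 q.2)
        {q : ℝ × ℝ | q.1 ∈ Icc a b ∧ 0 ≤ q.2 ∧ q.2 ≤ s q.1} :=
      O.uc.mono fun q hq => ⟨hsub _ hq.1, hq.2⟩
    refine ContinuousOn.mul (by fun_prop) (ContinuousOn.sub (by fun_prop) h1)
  obtain ⟨⟨t, x⟩, ⟨ht, hx0, hxs⟩, hmax⟩ := hcomp.exists_isMaxOn
    ⟨(t₁, 0), ht₁, le_rfl, (O.sp _ (hsub _ ht₁)).le⟩ hZc
  simp only at ht hx0 hxs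
  have hmax' : ∀ t' x', t' ∈ Icc a b → 0 ≤ x' → x' ≤ s t' → Z t' x' ≤ Z t x :=
    fun t' x' h1 h2 h3 => hmax (show (t', x') ∈ _ from ⟨h1, h2, h3⟩)
  have hpos : 0 < Z t x := hZ1.trans_le (hmax' _ _ ht₁ le_rfl (O.sp _ (hsub _ ht₁)).le)
  have hDpos : 0 < D t x := (mul_pos_iff_of_pos_left (exp_pos _)).1 hpos
  have hta : a < t := by
    rcases eq_or_lt_of_le ht.1 with h | h
    · exfalso; subst h; have := h0 x ⟨hx0, hxs⟩; simp only [D] at hDpos; linarith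
    · exact h
  have hxs' : x < s t := by
    rcases eq_or_lt_of_le hxs with h | h
    · exfalso; simp only [D, h, O.us t (hsub t ht)] at hDpos
      have := hKs t ht
      linarith
    · exact h
  have hex : ∀ t y : ℝ, HasDerivAt (fun y => exp (-l * t + μ * y)) (exp (-l * t + μ * y) * μ) y := by
    intro t y
    have h1 : HasDerivAt (fun y => -l * t + μ * y) μ y := by
      simpa using ((hasDerivAt_id y).const_mul μ).const_add (-l * t)
    exact h1.exp
  have hll : ∀ z : ℝ, HasDerivAt (fun z => K - K ^ p * z) (-(K ^ p)) z := fun z => by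
    simpa using ((hasDerivAt_id z).const_mul (K ^ p)).const_sub K
  rcases eq_or_lt_of_le hx0 with h | h
  · subst h
    have hd := ((hex t 0).hasDerivWithinAt (s := Ici 0)).mul
      (((hll 0).hasDerivWithinAt (s := Ici 0)).sub (O.d0 t (hsub t ht)))
    refine mp_right hd ?_ ?_
    · have hu0 := O.un t (hsub t ht) 0 ⟨le_rfl, hxs⟩
      have hDp : 0 < K - u t 0 := by simpa [D] using hDpos
      have h3 := rpow_diff_le hp hu0 (by linarith : u t 0 ≤ K)
      have h4 : 0 < μ * (K - u t 0) + (-(K ^ p) - -(u t 0 ^ p)) := by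
        rw [hμ]; nlinarith
      have h5 := mul_pos (exp_pos (-l * t + μ * 0)) h4
      simp only [Pi.sub_apply]
      nlinarith
    · filter_upwards [Ioo_mem_nhdsGT hxs'] with y hy
      exact hmax' t y ht hy.1.le hy.2.le
  · have hin : x ∈ Ioo 0 (s t) := ⟨h, hxs'⟩
    have hDx : ∀ y ∈ Ioo 0 (s t), HasDerivAt (D t) (-(K ^ p) - deriv (u t) y) y := fun y hy =>
      (hll y).sub (O.ux t (hsub t ht) y hy).hasDerivAt
    have hZx : ∀ y ∈ Ioo 0 (s t), HasDerivAt (Z t) (exp (-l * t + μ * y) * μ * D t y +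
        exp (-l * t + μ * y) * (-(K ^ p) - deriv (u t) y)) y := fun y hy => (hex t y).mul (hDx y hy)
    have hloc : ∀ᶠ y in 𝓝 x, Z t y ≤ Z t x := by
      filter_upwards [Ioo_mem_nhds h hxs'] with y hy
      exact hmax' t y ht hy.1.le hy.2.le
    have hz0 := IsLocalMax.hasDerivAt_eq_zero hloc (hZx x hin)
    have hexp := exp_pos (-l * t + μ * x)
    set e := exp (-l * t + μ * x) with he
    have hz0' : -(K ^ p) - deriv (u t) x = -(μ * D t x) := by
      have : e * (μ * D t x + (-(K ^ p) - deriv (u t) x)) = 0 := by rw [← hz0]; ring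
      have := (mul_eq_zero.1 this).resolve_left hexp.ne'
      linarith
    have het : HasDerivAt (fun τ => exp (-l * τ + μ * x)) (e * (-l)) t := by
      have h1 : HasDerivAt (fun y => -l * y + μ * x) (-l) t := by
        simpa using ((hasDerivAt_id t).const_mul (-l)).add_const (μ * x)
      exact h1.exp
    have hdt : HasDerivAt (fun τ => Z τ x) (e * (-l) * D t x + e * (-deriv (deriv (u t)) x)) t :=
      het.mul ((O.ut t (hsub t ht) x hin).const_sub (K - K ^ p * x))
    have hx2 := (((hex t x).mul_const μ).mul (hDx x hin)).add ((hex t x).mul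
      ((O.uxx t (hsub t ht) x hin).const_sub (-(K ^ p))))
    refine mp_int' hdt (by filter_upwards [Ioo_mem_nhds h hxs'] with y hy using hZx y hy) hx2 ?_ ?_ hloc
    · rw [hz0']
      have : 0 < e * D t x := mul_pos hexp hDpos
      rw [hl]
      nlinarith
    · filter_upwards [O.nearT ha hb hta ht.2 hxs'] with τ hτ
      exact hmax' τ x hτ.1 h.le hτ.2.le
end
end

noncomputable section

section
variable {p c : ℝ} {s : ℝ → ℝ} {u : ℝ → ℝ → ℝ}

lemma Old.wc (O : Old p c s u) : ContinuousOn (fun t => u t 0) (Ioo 0 c) :=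
  O.uc.comp (f := fun t : ℝ => (t, (0:ℝ))) (by fun_prop) fun t ht => ⟨ht, le_rfl, (O.sp t ht).le⟩

lemma Old.bounds (O : Old p c s u) (hp : 1 < p) (hc : 0 < c)
    (hnot : ¬Tendsto (fun t => u t 0) (𝓝[<] c) atTop) :
    ∃ a ∈ Ioo 0 c, ∃ K N, ∀ t ∈ Ico a c, u t 0 ≤ K ∧ deriv s t ≤ N := by
  rw [tendsto_atTop] at hnot
  push Not at hnot
  obtain ⟨M, hM⟩ := hnot
  set a := c / 2 with ha
  have ha0 : 0 < a := by positivity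
  have hac : a < c := by linarith
  have haI : a ∈ Ioo 0 c := ⟨ha0, hac⟩
  have hsa := O.sp a haI
  have hcont : ContinuousOn (deriv (u a)) (Icc 0 (s a)) :=
    O.uxc.comp (f := fun x : ℝ => (a, x)) (by fun_prop) fun x hx => ⟨haI, hx⟩
  have huc : ContinuousOn (u a) (Icc 0 (s a)) :=
    O.uc.comp (f := fun x : ℝ => (a, x)) (by fun_prop) fun x hx => ⟨haI, hx⟩
  obtain ⟨L, hL⟩ := isCompact_Icc.exists_bound_of_continuousOn hcont
  have hLip : ∀ x ∈ Icc 0 (s a), ∀ y ∈ Icc x (s a), u a x - u a y ≤ L * (y - x) := by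
    intro x hx y hy
    have := (convex_Icc 0 (s a)).mul_sub_le_image_sub_of_le_deriv (f := u a) (C := -L) huc
      (by rw [interior_Icc]; exact fun x hx => (O.ux a haI x hx).differentiableWithinAt)
      (by rw [interior_Icc]
          intro z hz
          have := hL z (Ioo_subset_Icc_self hz)
          exact (abs_le.1 this).1) x hx y ⟨hx.1.trans hy.1, hy.2⟩ hy.1
    linarith
  have hev1 := (tendsto_rpow_atTop (y := p - 1) (by linarith)).eventually_ge_atTop (1 / s a)
  have hev2 := (tendsto_rpow_atTop (y := p) (by linarith)).eventually_gt_atTop L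
  obtain ⟨K, hK1, hK2, hKM, hK0, hKone⟩ := (hev1.and (hev2.and ((eventually_ge_atTop M).and
    ((eventually_gt_atTop (u a 0)).and (eventually_ge_atTop (1:ℝ)))))).exists
  have hKpos : 0 < K := by linarith
  have hKp : K ^ p = K * K ^ (p - 1) := by
    rw [mul_comm, ← rpow_add_one hKpos.ne']; congr 1; ring
  have hKs : ∀ t ∈ Ico a c, K ≤ K ^ p * s t := by
    intro t ht
    have h1 : s a ≤ s t := O.smono haI ⟨ha0.trans_le ht.1, ht.2⟩ ht.1
    rw [div_le_iff₀ hsa] at hK1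
    rw [hKp]
    have : K ^ (p-1) * s a ≤ K ^ (p-1) * s t := mul_le_mul_of_nonneg_left h1 (rpow_nonneg hKpos.le _)
    nlinarith
  have hwc := O.wc
  have hlt : ∀ t ∈ Ico a c, u t 0 < K := by
    by_contra hcon
    push Not at hcon
    obtain ⟨t0, ht0, hKt0⟩ := hcon
    have hsub0 : Icc a t0 ⊆ Ioo 0 c := fun t ht => ⟨ha0.trans_le ht.1, ht.2.trans_lt ht0.2⟩
    have hwc0 : ContinuousOn (fun t => u t 0) (Icc a t0) := hwc.mono hsub0
    have hcpt : IsCompact (Icc a t0 ∩ (fun t => u t 0) ⁻¹' Ici K) :=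
      isCompact_Icc.of_isClosed_subset (hwc0.preimage_isClosed_of_isClosed isClosed_Icc isClosed_Ici)
        inter_subset_left
    obtain ⟨t1, ⟨ht1, hKt1⟩, hleast⟩ := hcpt.exists_isLeast ⟨t0, ⟨ht0.1, le_rfl⟩, hKt0⟩
    have hKt1' : K ≤ u t1 0 := hKt1
    have hbef : ∀ t ∈ Ico a t1, u t 0 < K := by
      intro t ht
      by_contra h
      push Not at h
      exact absurd (hleast ⟨⟨ht.1, ht.2.le.trans ht1.2⟩, h⟩) (not_le.2 ht.2)
    have hat1 : a < t1 := by
      rcases eq_or_lt_of_le ht1.1 with h | h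
      · rw [← h] at hKt1'; linarith
      · exact h
    have ht1I := hsub0 ht1
    have hle1 : u t1 0 ≤ K := by
      have h1 : Tendsto (fun t => u t 0) (𝓝[<] t1) (𝓝 (u t1 0)) :=
        ((hwc t1 ht1I).continuousAt (isOpen_Ioo.mem_nhds ht1I)).tendsto.mono_left nhdsWithin_le_nhds
      refine le_of_tendsto h1 ?_
      filter_upwards [Ioo_mem_nhdsLT hat1] with t ht
      exact (hbef t ⟨ht.1.le, ht.2⟩).le
    have hall : ∀ t ∈ Icc a t1, u t 0 ^ p ≤ K ^ p := by
      intro t ht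
      refine rpow_le_rpow (O.un t (hsub0 ⟨ht.1, ht.2.trans ht1.2⟩) 0
        ⟨le_rfl, (O.sp t (hsub0 ⟨ht.1, ht.2.trans ht1.2⟩)).le⟩) ?_ (by linarith)
      rcases eq_or_lt_of_le ht.2 with h | h
      · rw [h]; exact hle1
      · exact (hbef t ⟨ht.1, h⟩).le
    have hdb : ∀ x ∈ Icc 0 (s t1), K - K ^ p * x ≤ u t1 x := by
      intro x hx
      by_contra hcon
      push Not at hcon
      have hxpos : 0 < x := by
        rcases eq_or_lt_of_le hx.1 with h | h
        · rw [← h] at hcon; linarith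
        · exact h
      set N := (K - u t1 x) / x with hN
      have hNx : N * x = K - u t1 x := by rw [hN]; field_simp
      have hNK : K ^ p < N := by rw [hN, lt_div_iff₀ hxpos]; linarith
      set N' := (N + K ^ p) / 2 with hN'
      have := O.doubling ha0 ht1I.2 (N := N') (fun x hx y hy => (hLip x hx y hy).trans
        (mul_le_mul_of_nonneg_right (by linarith) (by linarith [hy.1])))
        (fun t ht => (hall t ht).trans_lt (by linarith))
        (by have := rpow_pos_of_pos hKpos p; linarith) hat1.le t1 ⟨hat1.le, le_rfl⟩ 0
        ⟨le_rfl, hx.1.trans hx.2⟩ x hx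
      have : N' * x < N * x := mul_lt_mul_of_pos_right (by linarith) hxpos
      linarith
    have hper : ∀ t ∈ Ico t1 c, K ≤ u t 0 := fun t ht =>
      O.persist hp ht1I.1 ht.2 hKpos (fun τ hτ => hKs τ ⟨hat1.le.trans hτ.1, hτ.2.trans_lt ht.2⟩)
        hdb t ⟨ht.1, le_rfl⟩
    refine hM ?_
    filter_upwards [Ioo_mem_nhdsLT ht1I.2] with t ht
    have := hper t ⟨ht.1.le, ht.2⟩
    linarith
  refine ⟨a, haI, K, K ^ p + 1, fun t ht => ⟨(hlt t ht).le, ?_⟩⟩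
  have htI : t ∈ Ioo 0 c := ⟨ha0.trans_le ht.1, ht.2⟩
  have hbar := O.barrier ha0 ht.2 (N := K ^ p + 1) (fun x hx => by
    have := hLip x hx (s a) ⟨hx.2, le_rfl⟩
    rw [O.us a haI] at this
    have h2 : L * (s a - x) ≤ (K ^ p + 1) * (s a - x) :=
      mul_le_mul_of_nonneg_right (by linarith) (by linarith [hx.2])
    linarith) (fun τ hτ => by
      have hτI : τ ∈ Ioo 0 c := ⟨ha0.trans_le hτ.1, hτ.2.trans_lt ht.2⟩
      have := rpow_le_rpow (O.un τ hτI 0 ⟨le_rfl, (O.sp τ hτI).le⟩)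
        (hlt τ ⟨hτ.1, hτ.2.trans_lt ht.2⟩).le (by linarith : 0 ≤ p)
      linarith) (by have := rpow_pos_of_pos hKpos p; linarith) t ⟨ht.1, le_rfl⟩
  by_contra hcon
  push Not at hcon
  have hd := (O.ds t htI).sub (((hasDerivWithinAt_const (s t) (Iic (s t)) (s t)).sub
      (hasDerivWithinAt_id (s t) (Iic (s t)))).const_mul (K ^ p + 1))
  refine mp_left hd (by linarith) ?_
  filter_upwards [Ioo_mem_nhdsLT (O.sp t htI)] with y hy
  have := hbar y ⟨hy.1.le, hy.2.le⟩
  simp [O.us t htI]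
  linarith
end
end

noncomputable section

/-! ### The heat kernel -/

def Hk (k : ℕ) (y r : ℝ) : ℝ := (r ^ k)⁻¹ * (√r)⁻¹ * exp (-(y ^ 2 / (4 * r)))

lemma Hk_nonpos (k : ℕ) (y : ℝ) {r : ℝ} (hr : r ≤ 0) : Hk k y r = 0 := by
  simp [Hk, sqrt_eq_zero'.2 hr]

lemma Hk_nonneg (k : ℕ) (y r : ℝ) : 0 ≤ Hk k y r := by
  rcases le_or_gt r 0 with h | h
  · rw [Hk_nonpos k y h]
  · unfold Hk; positivity

lemma Hk_neg (k : ℕ) (y r : ℝ) : Hk k (-y) r = Hk k y r := by simp [Hk]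

lemma Hk_meas (k : ℕ) : Measurable fun q : ℝ × ℝ => Hk k q.1 q.2 := by
  unfold Hk; fun_prop

lemma Hk_le (k : ℕ) (y : ℝ) {r : ℝ} (hr : 0 < r) : Hk k y r ≤ (r ^ k)⁻¹ * (√r)⁻¹ := by
  unfold Hk
  have : exp (-(y ^ 2 / (4 * r))) ≤ 1 := exp_le_one_iff.2 (by have : 0 ≤ y ^ 2 / (4 * r) := by positivity
                                                              linarith)
  exact mul_le_of_le_one_right (by positivity) this

/-- `y^(2n) H_k ≤ C r^(n-k-1/2)` -/
lemma Hk_pow (k n : ℕ) (y : ℝ) {r : ℝ} (hr : 0 < r) :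
    y ^ (2 * n) * Hk k y r ≤ (n.factorial * 4 ^ n) * (r ^ n * ((r ^ k)⁻¹ * (√r)⁻¹)) := by
  set z := y ^ 2 / (4 * r) with hz
  have hz0 : 0 ≤ z := by positivity
  have h1 := pow_div_factorial_le_exp z hz0 n
  have hf : (0:ℝ) < n.factorial := by positivity
  rw [div_le_iff₀ hf] at h1
  have h2 : z ^ n * exp (-z) ≤ n.factorial := by
    have : z ^ n * exp (-z) ≤ exp z * n.factorial * exp (-z) :=
      mul_le_mul_of_nonneg_right h1 (exp_pos _).le
    have h3 : exp z * exp (-z) = 1 := by rw [← exp_add]; simp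
    nlinarith
  have h3 : y ^ (2 * n) = z ^ n * (4 ^ n * r ^ n) := by
    rw [pow_mul, ← mul_pow, ← mul_pow, hz]; congr 1; field_simp
  unfold Hk
  rw [← hz, h3]
  have h4 : 0 ≤ 4 ^ n * r ^ n * ((r ^ k)⁻¹ * (√r)⁻¹) := by positivity
  calc _ = (z ^ n * exp (-z)) * (4 ^ n * r ^ n * ((r ^ k)⁻¹ * (√r)⁻¹)) := by ring
    _ ≤ n.factorial * (4 ^ n * r ^ n * ((r ^ k)⁻¹ * (√r)⁻¹)) := mul_le_mul_of_nonneg_right h2 h4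
    _ = _ := by ring

lemma Hk_sqrt (k : ℕ) (y r : ℝ) :
    y ^ (2 * (k + 1)) * Hk k y r ≤ ((k + 1).factorial * 4 ^ (k + 1)) * √r := by
  rcases le_or_gt r 0 with h | h
  · rw [Hk_nonpos k y h, sqrt_eq_zero'.2 h]; simp
  · refine (Hk_pow k (k + 1) y h).trans_eq ?_
    congr 1
    have h1 : √r * √r = r := mul_self_sqrt h.le
    have h2 : 0 < √r := sqrt_pos.2 h
    have h3 : r ^ (k+1) * (r ^ k)⁻¹ = r := by rw [pow_succ]; field_simp
    rw [← mul_assoc, h3]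
    field_simp
    rw [sq, h1]

/-- kernels that are smooth away from the origin -/
structure Ker (K : ℝ → ℝ → ℝ) : Prop where
  meas : Measurable fun q : ℝ × ℝ => K q.1 q.2
  cont : ∀ y r, (y ≠ 0 ∨ r ≠ 0) → ContinuousAt (fun q : ℝ × ℝ => K q.1 q.2) (y, r)
  bdd : ∀ δ > 0, ∀ Y, ∃ C, 0 ≤ C ∧ ∀ y r, |y| ≤ Y → (δ ≤ |y| ∨ δ ≤ r ∨ r ≤ 0) → |K y r| ≤ C

lemma Hk_ker (k : ℕ) : Ker (Hk k) where
  meas := Hk_meas k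
  cont := by
    intro y r h
    rcases lt_trichotomy r 0 with hr | hr | hr
    · have : (fun q : ℝ × ℝ => Hk k q.1 q.2) =ᶠ[𝓝 (y, r)] fun _ => 0 := by
        have : ∀ᶠ q : ℝ × ℝ in 𝓝 (y, r), q.2 < 0 := continuous_snd.continuousAt.eventually
          (gt_mem_nhds hr)
        filter_upwards [this] with q hq using Hk_nonpos k _ hq.le
      exact continuousAt_const.congr this.symm
    · subst hr
      have hy : y ≠ 0 := by simpa using h
      have h0 : Hk k y 0 = 0 := Hk_nonpos k y le_rfl
      have hnz : ∀ᶠ q : ℝ × ℝ in 𝓝 (y, 0), q.1 ≠ 0 := continuous_fst.continuousAt.eventually_ne hy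
      have hlim : Tendsto (fun q : ℝ × ℝ => (((k + 1).factorial * 4 ^ (k + 1)) * √q.2) /
          q.1 ^ (2 * (k+1))) (𝓝 (y, 0)) (𝓝 0) := by
        have : ContinuousAt (fun q : ℝ × ℝ => (((k + 1).factorial * 4 ^ (k + 1)) * √q.2) /
          q.1 ^ (2 * (k+1))) (y, 0) := by
          refine ContinuousAt.div (by fun_prop) (by fun_prop) (pow_ne_zero _ hy)
        have h2 := this.tendsto
        simpa using h2
      show Tendsto _ _ _
      simp only [h0]
      refine squeeze_zero' (Eventually.of_forall fun q => Hk_nonneg k q.1 q.2) ?_ hlim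
      filter_upwards [hnz] with q hq
      have : 0 < q.1 ^ (2 * (k+1)) := by rw [pow_mul]; positivity
      rw [le_div_iff₀ this, mul_comm]
      exact Hk_sqrt k _ _
    · unfold Hk
      have h1 : (r ^ k) ≠ 0 := by positivity
      have h2 : √r ≠ 0 := by positivity
      have h3 : 4 * r ≠ 0 := by positivity
      fun_prop (disch := assumption)
  bdd := by
    intro δ hδ Y
    refine ⟨(δ ^ k)⁻¹ * (√δ)⁻¹ + (((k + 1).factorial * 4 ^ (k + 1)) * √δ) / δ ^ (2 * (k+1)),
      by positivity, ?_⟩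
    intro y r _ h
    rw [abs_of_nonneg (Hk_nonneg _ _ _)]
    have hp1 : 0 ≤ (δ ^ k)⁻¹ * (√δ)⁻¹ := by positivity
    have hp2 : 0 ≤ (((k + 1).factorial * 4 ^ (k + 1)) * √δ) / δ ^ (2 * (k+1)) := by positivity
    have big : δ ≤ r → Hk k y r ≤ (δ ^ k)⁻¹ * (√δ)⁻¹ := by
      intro hr
      refine (Hk_le k y (hδ.trans_le hr)).trans ?_
      have := sqrt_pos.2 hδ
      gcongr
    rcases le_or_gt δ r with hr | hr
    · linarith [big hr]
    rcases h with h | h | h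
    · have h1 : δ ^ (2 * (k+1)) ≤ y ^ (2 * (k+1)) := by
        rw [pow_mul, pow_mul y, ← sq_abs y]
        gcongr
      have h2 := Hk_sqrt k y r
      have h3 : Hk k y r ≤ (((k + 1).factorial * 4 ^ (k + 1)) * √δ) / δ ^ (2 * (k+1)) := by
        rw [le_div_iff₀ (by positivity), mul_comm]
        calc _ ≤ y ^ (2 * (k+1)) * Hk k y r := mul_le_mul_of_nonneg_right h1 (Hk_nonneg _ _ _)
          _ ≤ _ := h2
          _ ≤ _ := by gcongr
      linarith
    · linarith
    · rw [Hk_nonpos k y h]; linarith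

lemma Ker.mul {K : ℝ → ℝ → ℝ} (h : Ker K) {g : ℝ → ℝ} (hg : Continuous g) :
    Ker fun y r => g y * K y r where
  meas := (hg.measurable.comp measurable_fst).mul h.meas
  cont y r hyr := (hg.comp continuous_fst).continuousAt.mul (h.cont y r hyr)
  bdd δ hδ Y := by
    obtain ⟨C, hC0, hC⟩ := h.bdd δ hδ Y
    obtain ⟨B, hB⟩ := isCompact_Icc.exists_bound_of_continuousOn (hg.continuousOn (s := Icc (-Y) Y))
    refine ⟨|B| * C, by positivity, fun y r h1 h2 => ?_⟩
    rw [abs_mul]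
    exact mul_le_mul ((hB y (abs_le.1 h1)).trans (le_abs_self B)) (hC y r h1 h2) (abs_nonneg _)
      (abs_nonneg _)

lemma Ker.add {K L : ℝ → ℝ → ℝ} (h : Ker K) (h' : Ker L) : Ker fun y r => K y r + L y r where
  meas := h.meas.add h'.meas
  cont y r hyr := (h.cont y r hyr).add (h'.cont y r hyr)
  bdd δ hδ Y := by
    obtain ⟨C, hC0, hC⟩ := h.bdd δ hδ Y
    obtain ⟨C', hC0', hC'⟩ := h'.bdd δ hδ Y
    exact ⟨C + C', by positivity, fun y r h1 h2 =>
      (abs_add_le _ _).trans (add_le_add (hC y r h1 h2) (hC' y r h1 h2))⟩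

lemma Hk_dy (k : ℕ) (y r : ℝ) : HasDerivAt (fun y => Hk k y r) (-(y / 2) * Hk (k + 1) y r) y := by
  rcases eq_or_ne r 0 with hr | hr
  · subst hr
    simp only [Hk_nonpos _ _ le_rfl, mul_zero]
    exact hasDerivAt_const _ _
  · have h1 : HasDerivAt (fun y : ℝ => -(y ^ 2 / (4 * r))) (-(2 * y / (4 * r))) y := by
      have := ((hasDerivAt_pow 2 y).div_const (4 * r)).neg
      exact this.congr_deriv (by simp)
    have h2 := h1.exp.const_mul ((r ^ k)⁻¹ * (√r)⁻¹)
    refine h2.congr_deriv ?_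
    unfold Hk
    field_simp
    ring

lemma Hk_dr (k : ℕ) (y r : ℝ) (h : y ≠ 0 ∨ r ≠ 0) : HasDerivAt (fun r => Hk k y r)
    (y ^ 2 / 4 * Hk (k + 2) y r + -(k + 1 / 2) * Hk (k + 1) y r) r := by
  have key : ∀ r ≠ 0, HasDerivAt (fun r => Hk k y r)
    (y ^ 2 / 4 * Hk (k + 2) y r + -(k + 1 / 2) * Hk (k + 1) y r) r := by
    intro r hr
    rcases lt_or_gt_of_ne hr with hr' | hr'
    · have : (fun r => Hk k y r) =ᶠ[𝓝 r] fun _ => 0 := by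
        filter_upwards [gt_mem_nhds hr'] with q hq using Hk_nonpos k _ hq.le
      simp only [Hk_nonpos _ _ hr'.le, mul_zero, add_zero]
      exact (hasDerivAt_const _ _).congr_of_eventuallyEq this
    · have hs : 0 < √r := sqrt_pos.2 hr'
      have hss : √r ^ 2 = r := sq_sqrt hr'.le
      have h1 : HasDerivAt (fun r : ℝ => -(y ^ 2 / (4 * r))) (y ^ 2 / (4 * r ^ 2)) r := by
        have h0 : HasDerivAt (fun r : ℝ => 4 * r) 4 r := by
          simpa using (hasDerivAt_id r).const_mul 4
        have := ((hasDerivAt_const r (y ^ 2)).div h0 (by positivity)).neg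
        refine this.congr_deriv ?_
        field_simp; ring
      have h2 := (((hasDerivAt_pow k r).inv (by positivity)).mul
        ((hasDerivAt_sqrt hr).inv hs.ne')).mul h1.exp
      refine h2.congr_deriv ?_
      unfold Hk
      rcases k with _ | k
      · simp only [Nat.cast_zero, pow_zero, zero_add, Pi.inv_apply, Pi.mul_apply]
        field_simp
        rw [hss]
        field_simp
        ring
      · simp only [Nat.add_sub_cancel, Pi.inv_apply, Pi.mul_apply]
        push_cast
        field_simp
        rw [hss]
        field_simp
        ring
  rcases eq_or_ne r 0 with hr | hr
  · subst hr
    have hy : y ≠ 0 := by simpa using h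
    have hslice : ∀ j, ContinuousAt (fun r => Hk j y r) 0 := fun j =>
      ContinuousAt.comp (g := fun q : ℝ × ℝ => Hk j q.1 q.2) (f := fun r : ℝ => (y, r))
        ((Hk_ker j).cont y 0 h) (by fun_prop)
    exact hasDerivAt_of_hasDerivAt_of_ne' (f := fun r => Hk k y r) (x := 0)
      (g := fun r => y ^ 2 / 4 * Hk (k + 2) y r + -(k + 1 / 2) * Hk (k + 1) y r)
      (fun r hr => key r hr) (hslice k)
      (((hslice _).const_mul _).add ((hslice _).const_mul _)) 0
  · exact key r hr

def c0 : ℝ := (2 * √π)⁻¹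
def G (y r : ℝ) : ℝ := c0 * Hk 0 y r
def G1 (y r : ℝ) : ℝ := -(y / 2) * (c0 * Hk 1 y r)
def G2 (y r : ℝ) : ℝ := c0 * (y ^ 2 / 4 * Hk 2 y r + -(1 / 2) * Hk 1 y r)

lemma c0_pos : 0 < c0 := by unfold c0; positivity

lemma G_ker : Ker G := (Hk_ker 0).mul (g := fun _ => c0) continuous_const
lemma G1_ker : Ker G1 := ((Hk_ker 1).mul (g := fun _ => c0) continuous_const).mul
  (g := fun y => -(y / 2)) (by fun_prop)
lemma G2_ker : Ker G2 := (((Hk_ker 2).mul (g := fun y => y ^ 2 / 4) (by fun_prop)).add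
  ((Hk_ker 1).mul (g := fun _ => -(1 / 2)) continuous_const)).mul (g := fun _ => c0) continuous_const

lemma G_dy (y r : ℝ) : HasDerivAt (fun y => G y r) (G1 y r) y :=
  ((Hk_dy 0 y r).const_mul c0).congr_deriv (by unfold G1; ring)

lemma G1_dy (y r : ℝ) : HasDerivAt (fun y => G1 y r) (G2 y r) y := by
  have h := (((hasDerivAt_id y).div_const 2).neg).mul ((Hk_dy 1 y r).const_mul c0)
  exact h.congr_deriv (by simp only [G2, id, Pi.neg_apply]; ring)

lemma G_dr (y r : ℝ) (h : y ≠ 0 ∨ r ≠ 0) : HasDerivAt (fun r => G y r) (G2 y r) r :=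
  ((Hk_dr 0 y r h).const_mul c0).congr_deriv (by unfold G2; simp)

lemma G_nonpos (y : ℝ) {r : ℝ} (hr : r ≤ 0) : G y r = 0 := by simp [G, Hk_nonpos _ _ hr]
lemma G1_nonpos (y : ℝ) {r : ℝ} (hr : r ≤ 0) : G1 y r = 0 := by simp [G1, Hk_nonpos _ _ hr]
lemma G2_nonpos (y : ℝ) {r : ℝ} (hr : r ≤ 0) : G2 y r = 0 := by simp [G2, Hk_nonpos _ _ hr]
lemma G_nonneg (y r : ℝ) : 0 ≤ G y r := mul_nonneg c0_pos.le (Hk_nonneg _ _ _)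
lemma G_neg (y r : ℝ) : G (-y) r = G y r := by simp [G, Hk_neg]
lemma G1_neg (y r : ℝ) : G1 (-y) r = -G1 y r := by simp [G1, Hk_neg]; ring

lemma G_le (y : ℝ) {r : ℝ} (hr : 0 < r) : |G y r| ≤ c0 * (√r)⁻¹ := by
  rw [abs_of_nonneg (G_nonneg _ _)]
  have := Hk_le 0 y hr
  simp only [pow_zero, inv_one, one_mul] at this
  exact mul_le_mul_of_nonneg_left this c0_pos.le

/-- the second derivative is `O(r^{-3/2})` -/
lemma G2_le (y : ℝ) {r : ℝ} (hr : 0 < r) : |G2 y r| ≤ c0 * 2 * (r⁻¹ * (√r)⁻¹) := by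
  unfold G2
  rw [abs_mul, abs_of_pos c0_pos, mul_assoc]
  refine mul_le_mul_of_nonneg_left ?_ c0_pos.le
  have h1 := Hk_pow 2 1 y hr
  have h2 := Hk_le 1 y hr
  have h3 := Hk_nonneg 2 y r
  have h4 := Hk_nonneg 1 y r
  have h5 : r ^ 1 * ((r ^ 2)⁻¹ * (√r)⁻¹) = r⁻¹ * (√r)⁻¹ := by field_simp
  rw [h5] at h1
  simp only [mul_one, pow_one, Nat.factorial_one, Nat.cast_one, one_mul] at h1 h2
  have h6 : 0 ≤ y ^ 2 * Hk 2 y r := by positivity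
  have h7 : 0 ≤ r⁻¹ * (√r)⁻¹ := by positivity
  rw [abs_le]
  constructor <;> linarith

/-- `G1` on a Lipschitz curve -/
lemma G1_lip {y r R : ℝ} (hr : 0 < r) (hy : |y| ≤ R * r) : |G1 y r| ≤ c0 * R * (√r)⁻¹ := by
  unfold G1
  have h1 : Hk 1 y r ≤ (r ^ 1)⁻¹ * (√r)⁻¹ := Hk_le 1 y hr
  rw [abs_mul, abs_mul, abs_of_pos c0_pos, abs_of_nonneg (Hk_nonneg _ _ _), abs_neg, abs_div]
  have hR : 0 ≤ R := by
    by_contra h; push Not at h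
    have := abs_nonneg y
    nlinarith
  calc |y| / |2| * (c0 * Hk 1 y r) ≤ (R * r) / 2 * (c0 * ((r ^ 1)⁻¹ * (√r)⁻¹)) := by
        have := c0_pos
        have := Hk_nonneg 1 y r
        rw [abs_two]
        gcongr
    _ = c0 * R * (√r)⁻¹ / 2 := by field_simp
    _ ≤ _ := half_le_self (by have := c0_pos; positivity)
end

noncomputable section

/-! ### Potentials away from their support -/

def Pt (K : ℝ → ℝ → ℝ) (f α β : ℝ → ℝ) (t x : ℝ) : ℝ := ∫ θ, f θ * K (x - α θ) (t - β θ)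

structure Dens (f α β : ℝ → ℝ) (A : ℝ) : Prop where
  fi : Integrable f
  am : Measurable α
  bm : Measurable β
  hA : ∀ θ, f θ ≠ 0 → |α θ| ≤ A

def Good (f α β : ℝ → ℝ) (δ t x : ℝ) : Prop :=
  ∀ θ, f θ ≠ 0 → δ ≤ |x - α θ| ∨ δ ≤ t - β θ ∨ t - β θ ≤ -δ

section
variable {K K' : ℝ → ℝ → ℝ} {f α β : ℝ → ℝ} {A δ t₀ x₀ : ℝ}

lemma Good.near (h : Good f α β δ t₀ x₀) {t x : ℝ} (ht : |t - t₀| ≤ δ / 2)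
    (hx : |x - x₀| ≤ δ / 2) : Good f α β (δ / 2) t x := by
  intro θ hθ
  have h1 := abs_le.1 ht
  rcases h θ hθ with h | h | h
  · left
    have : |x₀ - α θ| ≤ |x - α θ| + |x - x₀| := by
      have := abs_sub (x - α θ) (x - x₀)
      simpa using this
    linarith
  · right; left; linarith
  · right; right; linarith

lemma Dens.meas (D : Dens f α β A) (hK : Ker K) (t x : ℝ) :
    AEStronglyMeasurable (fun θ => f θ * K (x - α θ) (t - β θ)) := by
  refine D.fi.aestronglyMeasurable.mul (Measurable.aestronglyMeasurable ?_)
  exact hK.meas.comp (f := fun θ => (x - α θ, t - β θ))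
    ((measurable_const.sub D.am).prodMk (measurable_const.sub D.bm))

lemma Dens.bound (D : Dens f α β A) (hK : Ker K) (hδ : 0 < δ) (h : Good f α β δ t₀ x₀) :
    ∃ C, 0 ≤ C ∧ ∀ t x, |t - t₀| ≤ δ / 2 → |x - x₀| ≤ δ / 2 → ∀ θ,
      ‖f θ * K (x - α θ) (t - β θ)‖ ≤ ‖f θ‖ * C := by
  obtain ⟨C, hC0, hC⟩ := hK.bdd (δ / 2) (by linarith) (|x₀| + δ / 2 + A)
  refine ⟨C, hC0, fun t x ht hx θ => ?_⟩
  rw [norm_mul]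
  by_cases hθ : f θ = 0
  · simp [hθ]
  refine mul_le_mul_of_nonneg_left (hC _ _ ?_ ?_) (norm_nonneg _)
  · have h1 := D.hA θ hθ
    have h2 : |x - α θ| ≤ |x| + |α θ| := abs_sub _ _
    have h3 : |x| ≤ |x - x₀| + |x₀| := by simpa using abs_add_le (x - x₀) x₀
    linarith
  · rcases h.near ht hx θ hθ with h | h | h
    · exact Or.inl h
    · exact Or.inr (Or.inl h)
    · exact Or.inr (Or.inr (by linarith))

lemma Dens.integrable (D : Dens f α β A) (hK : Ker K) (hδ : 0 < δ) (h : Good f α β δ t₀ x₀) :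
    Integrable (fun θ => f θ * K (x₀ - α θ) (t₀ - β θ)) := by
  obtain ⟨C, hC0, hC⟩ := D.bound hK hδ h
  exact (D.fi.norm.mul_const C).mono' (D.meas hK _ _)
    (Eventually.of_forall fun θ => hC t₀ x₀ (by simp; linarith) (by simp; linarith) θ)

lemma Good.off (h : Good f α β δ t₀ x₀) (hδ : 0 < δ) {θ : ℝ} (hθ : f θ ≠ 0) :
    x₀ - α θ ≠ 0 ∨ t₀ - β θ ≠ 0 := by
  rcases h θ hθ with h | h | h
  · left; intro h0; rw [h0] at h; simp at h; linarith
  · right; intro h0; linarith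
  · right; intro h0; linarith

lemma near_nhds (hδ : 0 < δ) : ∀ᶠ t in 𝓝 t₀, |t - t₀| ≤ δ / 2 := by
  filter_upwards [Metric.ball_mem_nhds t₀ (half_pos hδ)] with t ht
  exact (mem_ball_iff_norm.1 ht).le

lemma Dens.cont (D : Dens f α β A) (hK : Ker K) (hδ : 0 < δ) (h : Good f α β δ t₀ x₀) :
    ContinuousAt (fun q : ℝ × ℝ => Pt K f α β q.1 q.2) (t₀, x₀) := by
  obtain ⟨C, hC0, hC⟩ := D.bound hK hδ h
  refine continuousAt_of_dominated (bound := fun θ => ‖f θ‖ * C)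
    (Eventually.of_forall fun q => D.meas hK q.1 q.2) ?_ (D.fi.norm.mul_const C) ?_
  · have h1 : ∀ᶠ q : ℝ × ℝ in 𝓝 (t₀, x₀), |q.1 - t₀| ≤ δ / 2 :=
      continuous_fst.continuousAt.eventually (near_nhds hδ)
    have h2 : ∀ᶠ q : ℝ × ℝ in 𝓝 (t₀, x₀), |q.2 - x₀| ≤ δ / 2 :=
      continuous_snd.continuousAt.eventually (near_nhds hδ)
    filter_upwards [h1, h2] with q h1 h2
    exact Eventually.of_forall fun θ => hC _ _ h1 h2 θ
  · refine Eventually.of_forall fun θ => ?_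
    by_cases hθ : f θ = 0
    · simp only [hθ, zero_mul]; exact continuousAt_const
    · refine continuousAt_const.mul ?_
      exact ContinuousAt.comp (g := fun q : ℝ × ℝ => K q.1 q.2)
        (f := fun q : ℝ × ℝ => (q.2 - α θ, q.1 - β θ)) (hK.cont _ _ (h.off hδ hθ)) (by fun_prop)

lemma Dens.dx (D : Dens f α β A) (hK : Ker K) (hK' : Ker K')
    (hd : ∀ y r, HasDerivAt (fun y => K y r) (K' y r) y)
    (hδ : 0 < δ) (h : Good f α β δ t₀ x₀) :
    HasDerivAt (fun x => Pt K f α β t₀ x) (Pt K' f α β t₀ x₀) x₀ := by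
  obtain ⟨C, hC0, hC⟩ := D.bound hK' hδ h
  refine (hasDerivAt_integral_of_dominated_loc_of_deriv_le (bound := fun θ => ‖f θ‖ * C)
    (F := fun x θ => f θ * K (x - α θ) (t₀ - β θ))
    (F' := fun x θ => f θ * K' (x - α θ) (t₀ - β θ)) (near_nhds hδ)
    (Eventually.of_forall fun x => D.meas hK t₀ x) (D.integrable hK hδ h) (D.meas hK' t₀ x₀)
    (Eventually.of_forall fun θ x hx => hC t₀ x (by simp; linarith) hx θ)
    (D.fi.norm.mul_const C) (Eventually.of_forall fun θ x hx => ?_)).2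
  exact ((hd (x - α θ) (t₀ - β θ)).comp_sub_const x (α θ)).const_mul (f θ)

lemma Dens.dt (D : Dens f α β A) (hK : Ker K) (hK' : Ker K')
    (hd : ∀ y r, (y ≠ 0 ∨ r ≠ 0) → HasDerivAt (fun r => K y r) (K' y r) r)
    (hδ : 0 < δ) (h : Good f α β δ t₀ x₀) :
    HasDerivAt (fun t => Pt K f α β t x₀) (Pt K' f α β t₀ x₀) t₀ := by
  obtain ⟨C, hC0, hC⟩ := D.bound hK' hδ h
  have hxx : |x₀ - x₀| ≤ δ / 2 := by simp; linarith
  refine (hasDerivAt_integral_of_dominated_loc_of_deriv_le (bound := fun θ => ‖f θ‖ * C)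
    (F := fun t θ => f θ * K (x₀ - α θ) (t - β θ))
    (F' := fun t θ => f θ * K' (x₀ - α θ) (t - β θ)) (near_nhds hδ)
    (Eventually.of_forall fun t => D.meas hK t x₀) (D.integrable hK hδ h) (D.meas hK' t₀ x₀)
    (Eventually.of_forall fun θ t ht => hC t x₀ ht hxx θ)
    (D.fi.norm.mul_const C) (Eventually.of_forall fun θ t ht => ?_)).2
  by_cases hθ : f θ = 0
  · simp only [hθ, zero_mul]; exact hasDerivAt_const _ _
  · exact ((hd (x₀ - α θ) (t - β θ) ((h.near ht hxx).off (half_pos hδ) hθ)).comp_sub_const t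
      (β θ)).const_mul (f θ)

end
end

noncomputable section

/-! ### Layer potentials up to the curve -/

lemma sing_int {e B : ℝ} (he : -1 < e) : Integrable (indicator (Ioo 0 B) fun r : ℝ => r ^ e) := by
  rw [integrable_indicator_iff measurableSet_Ioo]
  rcases le_or_gt B 0 with h | h
  · rw [Ioo_eq_empty (by linarith)]; exact integrableOn_empty
  · have := intervalIntegral.intervalIntegrable_rpow' (a := 0) (b := B) he
    rw [intervalIntegrable_iff_integrableOn_Ioo_of_le h.le] at this
    exact this

lemma inv_sqrt_eq {r : ℝ} (hr : 0 < r) : (√r)⁻¹ = r ^ (-(1/2) : ℝ) := by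
  rw [rpow_neg hr.le, sqrt_eq_rpow]

structure Lay (a b M R : ℝ) (f σ : ℝ → ℝ) : Prop where
  fm : Measurable f
  fb : ∀ τ, |f τ| ≤ M
  fa : ∀ τ ≤ a, f τ = 0
  fB : ∀ τ, b ≤ τ → f τ = 0
  fd : ∃ F : Set ℝ, F.Countable ∧ ∀ τ ∉ F, ContinuousAt f τ
  sl : ∀ τ τ', |σ τ - σ τ'| ≤ R * |τ - τ'|

section
variable {a b M R : ℝ} {f σ : ℝ → ℝ}

lemma Lay.R0 (L : Lay a b M R f σ) : 0 ≤ R := by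
  have h1 := L.sl 1 0
  have h2 := abs_nonneg (σ 1 - σ 0)
  simp at h1
  linarith

lemma Lay.M0 (L : Lay a b M R f σ) : 0 ≤ M := (abs_nonneg _).trans (L.fb 0)

lemma Lay.sc (L : Lay a b M R f σ) : Continuous σ := by
  have : LipschitzWith ⟨R, L.R0⟩ σ := LipschitzWith.of_dist_le_mul fun x y => L.sl x y
  exact this.continuous

lemma Lay.supp (L : Lay a b M R f σ) {τ : ℝ} (h : f τ ≠ 0) : τ ∈ Ioo a b := by
  constructor
  · by_contra h'; exact h (L.fa τ (not_lt.1 h'))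
  · by_contra h'; exact h (L.fB τ (not_lt.1 h'))

lemma Lay.neg (L : Lay a b M R f σ) : Lay a b M R f (fun t => -σ t) where
  fm := L.fm
  fb := L.fb
  fa := L.fa
  fB := L.fB
  fd := L.fd
  sl τ τ' := by
    have := L.sl τ τ'
    rwa [← abs_neg, neg_sub, sub_neg_eq_add, neg_add_eq_sub]

lemma Lay.zero (L : Lay a b M R f σ) : Lay a b M R f (fun _ => 0) where
  fm := L.fm
  fb := L.fb
  fa := L.fa
  fB := L.fB
  fd := L.fd
  sl τ τ' := by simpa using mul_nonneg L.R0 (abs_nonneg (τ - τ'))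

lemma Lay.fi (L : Lay a b M R f σ) : Integrable f := by
  have h1 : f = indicator (Ioo a b) f := by
    rw [eq_comm, indicator_eq_self]
    exact fun τ hτ => L.supp hτ
  rw [h1, integrable_indicator_iff measurableSet_Ioo]
  exact Measure.integrableOn_of_bounded (M := M) (by simp) L.fm.aestronglyMeasurable
    (Eventually.of_forall L.fb)

lemma Lay.dens (L : Lay a b M R f σ) : ∃ A, Dens f σ (fun τ => τ) A := by
  obtain ⟨A, hA⟩ := isCompact_Icc.exists_bound_of_continuousOn (L.sc.continuousOn (s := Icc a b))
  exact ⟨A, L.fi, L.sc.measurable, measurable_id, fun θ h => hA θ (Ioo_subset_Icc_self (L.supp h))⟩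

lemma Lay.good (L : Lay a b M R f σ) {t x : ℝ} (h : x ≠ σ t) :
    ∃ δ > 0, Good f σ (fun τ => τ) δ t x := by
  have h0 : 0 < |x - σ t| := abs_pos.2 (sub_ne_zero.2 h)
  have h1 : ∀ᶠ τ in 𝓝 t, |x - σ t| / 2 < |x - σ τ| := by
    have : ContinuousAt (fun τ => |x - σ τ|) t := by have := L.sc; fun_prop
    exact this.eventually (lt_mem_nhds (by simp only; linarith))
  obtain ⟨ε, hε, hball⟩ := Metric.eventually_nhds_iff.1 h1
  refine ⟨min ε (|x - σ t| / 2), by positivity, fun τ _ => ?_⟩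
  by_cases hτ : dist τ t < ε
  · exact Or.inl ((min_le_right _ _).trans (hball hτ).le)
  · rw [dist_eq, not_lt] at hτ
    have hm := min_le_left ε (|x - σ t| / 2)
    rcases le_abs.1 hτ with h | h
    · right; right; simp only; linarith
    · right; left; simp only; linarith

/-- the density is continuous at almost all shifted points -/
lemma Lay.ae (L : Lay a b M R f σ) (t : ℝ) : ∀ᵐ r : ℝ, ContinuousAt f (t - r) := by
  obtain ⟨F, hF, h⟩ := L.fd
  have : ((fun r => t - r) ⁻¹' F).Countable := hF.preimage_of_injOn (fun x _ y _ hxy => by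
    simpa using hxy)
  filter_upwards [this.ae_notMem volume] with r hr
  exact h _ hr

lemma Lay.dct (L : Lay a b M R f σ) {Φ : ℝ × ℝ → ℝ → ℝ} {q₀ : ℝ × ℝ} {C : ℝ}
    (hc : ∀ r, ContinuousAt (fun q => Φ q r) q₀) (hm : ∀ q, Measurable (Φ q))
    (hb : ∀ q r, 0 < r → |Φ q r| ≤ C * (√r)⁻¹) (h0 : ∀ q r, r ≤ 0 → Φ q r = 0) :
    ContinuousAt (fun q : ℝ × ℝ => ∫ r, f (q.1 - r) * Φ q r) q₀ := by
  refine continuousAt_of_dominated (bound := fun r => M * C *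
    indicator (Ioo 0 (q₀.1 - a + 1)) (fun r : ℝ => r ^ (-(1/2) : ℝ)) r) ?_ ?_
    ((sing_int (by norm_num)).const_mul _) ?_
  · exact Eventually.of_forall fun q =>
      ((L.fm.comp (measurable_const.sub measurable_id)).mul (hm q)).aestronglyMeasurable
  · have h1 : ∀ᶠ q : ℝ × ℝ in 𝓝 q₀, q.1 < q₀.1 + 1 :=
      continuous_fst.continuousAt.eventually (gt_mem_nhds (by linarith))
    filter_upwards [h1] with q hq
    refine Eventually.of_forall fun r => ?_
    by_cases hr : r ∈ Ioo 0 (q₀.1 - a + 1)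
    · rw [indicator_of_mem hr, norm_mul, ← inv_sqrt_eq hr.1, mul_assoc]
      exact mul_le_mul (L.fb _) (hb q r hr.1) (norm_nonneg _) L.M0
    · rw [indicator_of_notMem hr, mul_zero]
      rcases le_or_gt r 0 with h | h
      · rw [h0 q r h]; simp
      · have : q₀.1 - a + 1 ≤ r := by by_contra h'; exact hr ⟨h, not_le.1 h'⟩
        rw [L.fa _ (by linarith)]; simp
  · filter_upwards [L.ae q₀.1] with r hr
    refine ContinuousAt.mul ?_ (hc r)
    exact ContinuousAt.comp (g := f) (f := fun q : ℝ × ℝ => q.1 - r) hr (by fun_prop)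

lemma layer_shift (K : ℝ → ℝ → ℝ) (f σ : ℝ → ℝ) (t x : ℝ) :
    Pt K f σ (fun τ => τ) t x = ∫ r, f (t - r) * K (x - σ (t - r)) r := by
  unfold Pt
  rw [← integral_sub_left_eq_self (fun τ => f τ * K (x - σ τ) (t - τ)) volume t]
  simp

lemma Lay.cont (L : Lay a b M R f σ) :
    Continuous (fun q : ℝ × ℝ => Pt G f σ (fun τ => τ) q.1 q.2) := by
  simp only [layer_shift]
  rw [continuous_iff_continuousAt]
  intro q₀
  have hs := L.sc
  refine L.dct (Φ := fun q r => G (q.2 - σ (q.1 - r)) r) (C := c0) ?_ ?_ ?_ ?_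
  · intro r
    exact ContinuousAt.comp (g := fun y => G y r) (f := fun q : ℝ × ℝ => q.2 - σ (q.1 - r))
      (G_dy _ r).continuousAt (by fun_prop)
  · intro q
    exact G_ker.meas.comp (f := fun r => (q.2 - σ (q.1 - r), r)) (by fun_prop)
  · exact fun q r hr => G_le _ hr
  · exact fun q r hr => G_nonpos _ hr

lemma Lay.om (L : Lay a b M R f σ) (t : ℝ) {r : ℝ} (hr : 0 < r) : |σ t - σ (t - r)| ≤ R * r := by
  have := L.sl t (t - r)
  simpa [abs_of_pos hr] using this

/-- the part of the derivative that is continuous across the curve -/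
def LA (f σ : ℝ → ℝ) (q : ℝ × ℝ) : ℝ :=
  ∫ r, f (q.1 - r) * (-((σ q.1 - σ (q.1 - r)) / 2) * (c0 * Hk 1 (q.2 - σ (q.1 - r)) r))

def LB (f σ : ℝ → ℝ) (q : ℝ × ℝ) : ℝ :=
  ∫ r, f (q.1 - r) * (-((q.2 - σ q.1) / 2) * (c0 * Hk 1 (q.2 - σ (q.1 - r)) r))

lemma Lay.LA_bd (L : Lay a b M R f σ) (q : ℝ × ℝ) {r : ℝ} (hr : 0 < r) :
    |-((σ q.1 - σ (q.1 - r)) / 2) * (c0 * Hk 1 (q.2 - σ (q.1 - r)) r)| ≤ (c0 * R) * (√r)⁻¹ := by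
  have h1 := L.om q.1 hr
  have h2 := Hk_le 1 (q.2 - σ (q.1 - r)) hr
  have h3 := Hk_nonneg 1 (q.2 - σ (q.1 - r)) r
  have h4 := c0_pos
  have hR := L.R0
  rw [abs_mul, abs_neg, abs_div, abs_two, abs_mul, abs_of_pos h4, abs_of_nonneg h3]
  calc _ ≤ R * r / 2 * (c0 * ((r ^ 1)⁻¹ * (√r)⁻¹)) := by gcongr
    _ = (c0 * R) * (√r)⁻¹ / 2 := by field_simp
    _ ≤ _ := half_le_self (by positivity)

lemma Lay.LA_cont (L : Lay a b M R f σ) : Continuous (LA f σ) := by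
  rw [continuous_iff_continuousAt]
  intro q₀
  have hs := L.sc
  refine L.dct (Φ := fun q r => -((σ q.1 - σ (q.1 - r)) / 2) * (c0 * Hk 1 (q.2 - σ (q.1 - r)) r))
    (C := c0 * R) ?_ ?_ ?_ ?_
  · intro r
    refine ContinuousAt.mul (by fun_prop) (continuousAt_const.mul ?_)
    exact ContinuousAt.comp (g := fun y => Hk 1 y r) (f := fun q : ℝ × ℝ => q.2 - σ (q.1 - r))
      (Hk_dy 1 _ r).continuousAt (by fun_prop)
  · intro q
    refine Measurable.mul (by fun_prop) (measurable_const.mul ?_)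
    exact (Hk_meas 1).comp (f := fun r => (q.2 - σ (q.1 - r), r)) (by fun_prop)
  · exact fun q r hr => L.LA_bd q hr
  · exact fun q r hr => by simp [Hk_nonpos _ _ hr]

lemma LA_curve (f σ : ℝ → ℝ) (t : ℝ) : Pt G1 f σ (fun τ => τ) t (σ t) = LA f σ (t, σ t) := by
  rw [layer_shift]; rfl

lemma Lay.LA_int (L : Lay a b M R f σ) (q : ℝ × ℝ) : Integrable (fun r => f (q.1 - r) *
    (-((σ q.1 - σ (q.1 - r)) / 2) * (c0 * Hk 1 (q.2 - σ (q.1 - r)) r))) := by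
  have hs := L.sc
  refine ((sing_int (e := -(1/2)) (B := q.1 - a) (by norm_num)).const_mul (M * (c0 * R))).mono' ?_ ?_
  · refine Measurable.aestronglyMeasurable ((L.fm.comp (measurable_const.sub measurable_id)).mul ?_)
    refine Measurable.mul (by fun_prop) (measurable_const.mul ?_)
    exact (Hk_meas 1).comp (f := fun r => (q.2 - σ (q.1 - r), r)) (by fun_prop)
  · refine Eventually.of_forall fun r => ?_
    by_cases hr : r ∈ Ioo 0 (q.1 - a)
    · rw [indicator_of_mem hr, norm_mul, ← inv_sqrt_eq hr.1, mul_assoc]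
      exact mul_le_mul (L.fb _) (L.LA_bd q hr.1) (norm_nonneg _) L.M0
    · rw [indicator_of_notMem hr, mul_zero]
      rcases le_or_gt r 0 with h | h
      · simp [Hk_nonpos _ _ h]
      · have : q.1 - a ≤ r := by by_contra h'; exact hr ⟨h, not_le.1 h'⟩
        rw [L.fa _ (by linarith)]; simp

lemma Lay.split (L : Lay a b M R f σ) {q : ℝ × ℝ} (hq : q.2 ≠ σ q.1) :
    Pt G1 f σ (fun τ => τ) q.1 q.2 = LA f σ q + LB f σ q := by
  obtain ⟨A, D⟩ := L.dens
  obtain ⟨δ, hδ, hG⟩ := L.good hq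
  have h1 := (D.integrable G1_ker hδ hG).comp_sub_left q.1
  simp only [sub_sub_cancel] at h1
  have h2 := L.LA_int q
  have h3 := integral_add h2 (h1.sub h2)
  rw [layer_shift, LA, LB]
  simp only [Pi.sub_apply] at h3
  convert h3 using 1
  · congr 1; ext r; ring
  · congr 2; ext r; unfold G1; ring

def LJ (f σ : ℝ → ℝ) (q : ℝ × ℝ) (z : ℝ) : ℝ :=
  f (q.1 - (q.2 - σ q.1) ^ 2 / 4 * (z ^ 2)⁻¹) *
    exp (-(z ^ 2 * (1 + (σ q.1 - σ (q.1 - (q.2 - σ q.1) ^ 2 / 4 * (z ^ 2)⁻¹)) / (q.2 - σ q.1)) ^ 2))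

lemma LB_eq (f σ : ℝ → ℝ) {q : ℝ × ℝ} (hq : q.2 ≠ σ q.1) :
    LB f σ q = -((q.2 - σ q.1) / |q.2 - σ q.1|) * (2 * c0) * ∫ z in Ioi 0, LJ f σ q z := by
  set y := q.2 - σ q.1 with hy
  have hy0 : y ≠ 0 := sub_ne_zero.2 hq
  have hk : 0 < y ^ 2 / 4 := by positivity
  set h : ℝ → ℝ := fun r => f (q.1 - r) * (-(y / 2) * (c0 * Hk 1 (q.2 - σ (q.1 - r)) r)) with hh
  have h1 : LB f σ q = ∫ r in Ioi 0, h r := by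
    rw [LB, ← hy]
    refine (setIntegral_eq_integral_of_forall_compl_eq_zero fun r hr => ?_).symm
    rw [Hk_nonpos _ _ (not_lt.1 hr)]; simp
  have h2 := integral_comp_mul_left_Ioi h 0 hk
  rw [mul_zero, smul_eq_mul] at h2
  have h3 := integral_comp_rpow_Ioi (fun r => h (y ^ 2 / 4 * r)) (p := -2) (by norm_num)
  rw [h1, ← integral_const_mul]
  have h4 : ∫ r in Ioi 0, h r = y ^ 2 / 4 * ∫ x in Ioi 0, h (y ^ 2 / 4 * x) := by
    rw [h2]; field_simp
  rw [h4, ← h3, ← integral_const_mul]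
  refine setIntegral_congr_fun measurableSet_Ioi fun z hz => ?_
  have hz' : (0:ℝ) < z := hz
  simp only [hh, LJ, ← hy, smul_eq_mul]
  have e1 : z ^ (-2 : ℝ) = (z ^ 2)⁻¹ := by rw [rpow_neg hz'.le]; norm_num
  have e2 : z ^ (-2 - 1 : ℝ) = (z ^ 3)⁻¹ := by
    rw [show (-2 - 1 : ℝ) = -3 by norm_num, rpow_neg hz'.le]; norm_num
  rw [e1, e2]
  set r := y ^ 2 / 4 * (z ^ 2)⁻¹ with hr
  have e3 : √r = |y| / (2 * z) := by
    rw [hr, show y ^ 2 / 4 * (z ^ 2)⁻¹ = (|y| / (2 * z)) ^ 2 by rw [div_pow, sq_abs]; field_simp; ring]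
    exact sqrt_sq (by positivity)
  have e4 : q.2 - σ (q.1 - r) = y + (σ q.1 - σ (q.1 - r)) := by rw [hy]; ring
  set om := σ q.1 - σ (q.1 - r)
  unfold Hk
  rw [e3, e4]
  have e5 : (y + om) ^ 2 / (4 * r) = z ^ 2 * (1 + om / y) ^ 2 := by
    rw [hr]; field_simp
  rw [e5]
  set E := exp (-(z ^ 2 * (1 + om / y) ^ 2))
  have hay : |y| ≠ 0 := by positivity
  rw [hr]
  simp only [pow_one, abs_neg, abs_two]
  field_simp

lemma Lay.LJ_lim (L : Lay a b M R f σ) {t : ℝ} (hf : ContinuousAt f t) :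
    Tendsto (fun q => ∫ z in Ioi 0, LJ f σ q z) (𝓝[{q | q.2 ≠ σ q.1}] (t, σ t))
      (𝓝 (f t * (√π / 2))) := by
  have hs := L.sc
  have hlim : ∫ z in Ioi (0:ℝ), f t * exp (-1 * z ^ 2) = f t * (√π / 2) := by
    rw [integral_const_mul, integral_gaussian_Ioi]; simp
  rw [← hlim]
  have hyt : Tendsto (fun q : ℝ × ℝ => q.2 - σ q.1) (𝓝[{q | q.2 ≠ σ q.1}] (t, σ t)) (𝓝 0) := by
    have : ContinuousAt (fun q : ℝ × ℝ => q.2 - σ q.1) (t, σ t) := by fun_prop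
    have := this.tendsto
    simp only [sub_self] at this
    exact this.mono_left nhdsWithin_le_nhds
  have ht1 : Tendsto (fun q : ℝ × ℝ => q.1) (𝓝[{q | q.2 ≠ σ q.1}] (t, σ t)) (𝓝 t) :=
    (continuous_fst.tendsto (t, σ t)).mono_left nhdsWithin_le_nhds
  refine tendsto_integral_filter_of_dominated_convergence
    (fun z => M * exp (R / 2) * exp (-1 * z ^ 2)) ?_ ?_ ?_ ?_
  · refine Eventually.of_forall fun q => Measurable.aestronglyMeasurable ?_
    unfold LJ
    have := L.fm
    fun_prop
  · have hsmall : ∀ᶠ q : ℝ × ℝ in 𝓝[{q | q.2 ≠ σ q.1}] (t, σ t), |q.2 - σ q.1| ≤ 1 := by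
      have := hyt.abs
      simp only [abs_zero] at this
      filter_upwards [this.eventually (gt_mem_nhds zero_lt_one)] with q hq using hq.le
    filter_upwards [hsmall, self_mem_nhdsWithin] with q hq hne
    refine (ae_restrict_mem measurableSet_Ioi).mono fun z hz => ?_
    have hz' : (0:ℝ) < z := hz
    have hy0 : q.2 - σ q.1 ≠ 0 := sub_ne_zero.2 hne
    unfold LJ
    set y := q.2 - σ q.1 with hy
    set r := y ^ 2 / 4 * (z ^ 2)⁻¹ with hr
    have hrp : 0 < r := by positivity
    have hom := L.om q.1 hrp
    set om := σ q.1 - σ (q.1 - r)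
    rw [norm_mul, mul_assoc]
    refine mul_le_mul (L.fb _) ?_ (norm_nonneg _) L.M0
    rw [norm_eq_abs, abs_of_pos (exp_pos _), ← exp_add, exp_le_exp]
    have hR := L.R0
    have h1 : |om / y| ≤ R * |y| / (4 * z ^ 2) := by
      rw [abs_div, div_le_iff₀ (by positivity)]
      refine hom.trans_eq ?_
      rw [hr, ← sq_abs y]; field_simp
    have h2 : R * |y| / (4 * z ^ 2) ≤ R / (4 * z ^ 2) := by
      gcongr; nlinarith
    have h3 : -(R / (4 * z ^ 2)) ≤ om / y := by
      have := (abs_le.1 (h1.trans h2)).1; linarith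
    have h4 : z ^ 2 * (R / (4 * z ^ 2)) = R / 4 := by field_simp
    have h5 : 0 ≤ z ^ 2 * (om / y) ^ 2 := by positivity
    have h6 : z ^ 2 * -(R / (4 * z ^ 2)) ≤ z ^ 2 * (om / y) :=
      mul_le_mul_of_nonneg_left h3 (by positivity)
    nlinarith
  · exact ((integrable_exp_neg_mul_sq zero_lt_one).const_mul _).integrableOn
  · refine (ae_restrict_mem measurableSet_Ioi).mono fun z hz => ?_
    have hz' : (0:ℝ) < z := hz
    unfold LJ
    have hr0 : Tendsto (fun q : ℝ × ℝ => (q.2 - σ q.1) ^ 2 / 4 * (z ^ 2)⁻¹)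
        (𝓝[{q | q.2 ≠ σ q.1}] (t, σ t)) (𝓝 0) := by
      have := ((hyt.pow 2).div_const 4).mul_const (z ^ 2)⁻¹
      simpa using this
    refine Tendsto.mul ?_ ?_
    · have := ht1.sub hr0
      rw [sub_zero] at this
      exact hf.tendsto.comp this
    · have hω : Tendsto (fun q : ℝ × ℝ => (σ q.1 - σ (q.1 - (q.2 - σ q.1) ^ 2 / 4 * (z ^ 2)⁻¹)) /
          (q.2 - σ q.1)) (𝓝[{q | q.2 ≠ σ q.1}] (t, σ t)) (𝓝 0) := by
        have hb : Tendsto (fun q : ℝ × ℝ => R * |q.2 - σ q.1| / (4 * z ^ 2))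
          (𝓝[{q | q.2 ≠ σ q.1}] (t, σ t)) (𝓝 0) := by
          have := (hyt.abs.const_mul R).div_const (4 * z ^ 2)
          simpa using this
        refine squeeze_zero_norm' ?_ hb
        filter_upwards [self_mem_nhdsWithin] with q hne
        have hy0 : q.2 - σ q.1 ≠ 0 := sub_ne_zero.2 hne
        have hom := L.om q.1 (r := (q.2 - σ q.1) ^ 2 / 4 * (z ^ 2)⁻¹) (by positivity)
        rw [norm_div, norm_eq_abs, norm_eq_abs, div_le_iff₀ (by positivity)]
        refine hom.trans_eq ?_
        rw [← sq_abs (q.2 - σ q.1)]; field_simp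
      have := (((hω.const_add 1).pow 2).const_mul (z ^ 2)).neg
      have h2 := (continuous_exp.tendsto _).comp this
      simpa [Function.comp_def] using h2

lemma Lay.jumpL (L : Lay a b M R f σ) {t : ℝ} (hf : ContinuousAt f t) :
    Tendsto (fun q : ℝ × ℝ => Pt G1 f σ (fun τ => τ) q.1 q.2) (𝓝[{q | q.2 < σ q.1}] (t, σ t))
      (𝓝 (Pt G1 f σ (fun τ => τ) t (σ t) + f t / 2)) := by
  have h1 : Tendsto (LA f σ) (𝓝[{q | q.2 < σ q.1}] (t, σ t)) (𝓝 (LA f σ (t, σ t))) :=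
    (L.LA_cont.tendsto _).mono_left nhdsWithin_le_nhds
  have h2 := ((L.LJ_lim hf).mono_left (nhdsWithin_mono _ (s := {q : ℝ × ℝ | q.2 < σ q.1})
    fun q (hq : q.2 < σ q.1) => ne_of_lt hq)).const_mul (2 * c0)
  have e : 2 * c0 * (f t * (√π / 2)) = f t / 2 := by
    unfold c0; have : √π ≠ 0 := by positivity
    field_simp
  rw [e] at h2
  rw [LA_curve]
  refine (h1.add h2).congr' ?_
  filter_upwards [self_mem_nhdsWithin] with q hq
  have hq' : q.2 - σ q.1 < 0 := sub_neg.2 hq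
  rw [L.split (ne_of_lt hq), LB_eq f σ (ne_of_lt hq), abs_of_neg hq', div_neg,
    div_self hq'.ne]
  simp

lemma Lay.jumpR (L : Lay a b M R f σ) {t : ℝ} (hf : ContinuousAt f t) :
    Tendsto (fun q : ℝ × ℝ => Pt G1 f σ (fun τ => τ) q.1 q.2) (𝓝[{q | σ q.1 < q.2}] (t, σ t))
      (𝓝 (Pt G1 f σ (fun τ => τ) t (σ t) - f t / 2)) := by
  have h1 : Tendsto (LA f σ) (𝓝[{q | σ q.1 < q.2}] (t, σ t)) (𝓝 (LA f σ (t, σ t))) :=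
    (L.LA_cont.tendsto _).mono_left nhdsWithin_le_nhds
  have h2 := ((L.LJ_lim hf).mono_left (nhdsWithin_mono _ (s := {q : ℝ × ℝ | σ q.1 < q.2})
    fun q (hq : σ q.1 < q.2) => ne_of_gt hq)).const_mul (2 * c0)
  have e : 2 * c0 * (f t * (√π / 2)) = f t / 2 := by
    unfold c0; have : √π ≠ 0 := by positivity
    field_simp
  rw [e] at h2
  rw [LA_curve]
  refine (h1.sub h2).congr' ?_
  filter_upwards [self_mem_nhdsWithin] with q hq
  have hq' : 0 < q.2 - σ q.1 := sub_pos.2 hq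
  rw [L.split (ne_of_gt hq), LB_eq f σ (ne_of_gt hq), abs_of_pos hq', div_self hq'.ne']
  ring
end
end

noncomputable section

/-! ### The representation formula -/

def Ib (a : ℝ) (φ : ℝ → ℝ) (t x : ℝ) : ℝ :=
  (√π)⁻¹ * ∫ z, φ (x - 2 * √(t - a) * z) * exp (-1 * z ^ 2)

structure Ini (A : ℝ) (φ : ℝ → ℝ) : Prop where
  pc : Continuous φ
  pe : ∀ x, φ (-x) = φ x
  ps : ∀ x, A < |x| → φ x = 0

section
variable {a A : ℝ} {φ : ℝ → ℝ}

lemma Ini.bd (I : Ini A φ) : ∃ C, 0 ≤ C ∧ ∀ x, |φ x| ≤ C := by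
  obtain ⟨C, hC⟩ := isCompact_Icc.exists_bound_of_continuousOn (I.pc.continuousOn (s := Icc (-A) A))
  refine ⟨|C|, abs_nonneg _, fun x => ?_⟩
  by_cases h : |x| ≤ A
  · exact (hC x (abs_le.1 h)).trans (le_abs_self _)
  · rw [I.ps x (not_le.1 h)]; simp

lemma Ini.fi (I : Ini A φ) : Integrable φ := by
  refine I.pc.integrable_of_hasCompactSupport ?_
  refine HasCompactSupport.intro (isCompact_Icc (a := -A) (b := A)) fun x hx => I.ps x ?_
  by_contra h
  exact hx (abs_le.1 (not_lt.1 h))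

lemma Ini.cont (I : Ini A φ) : Continuous (fun q : ℝ × ℝ => Ib a φ q.1 q.2) := by
  obtain ⟨C, hC0, hC⟩ := I.bd
  refine continuous_const.mul ?_
  refine continuous_of_dominated (bound := fun z => C * exp (-1 * z ^ 2)) ?_ ?_
    ((integrable_exp_neg_mul_sq zero_lt_one).const_mul _) ?_
  · intro q
    have := I.pc
    exact Continuous.aestronglyMeasurable (by fun_prop)
  · intro q
    refine Eventually.of_forall fun z => ?_
    rw [norm_mul, norm_eq_abs (exp _), abs_of_pos (exp_pos _)]
    exact mul_le_mul_of_nonneg_right (hC _) (exp_pos _).le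
  · refine Eventually.of_forall fun z => ?_
    have := I.pc
    fun_prop

lemma Ib_le (φ : ℝ → ℝ) {t : ℝ} (ht : t ≤ a) (x : ℝ) : Ib a φ t x = φ x := by
  unfold Ib
  have h := integral_gaussian 1
  rw [sqrt_eq_zero'.2 (by linarith : t - a ≤ 0)]
  simp only [mul_zero, zero_mul, sub_zero]
  rw [integral_const_mul, h, div_one]
  field_simp

lemma Ini.Ib_bd (I : Ini A φ) : ∃ C, 0 ≤ C ∧ ∀ t x, |Ib a φ t x| ≤ C := by
  obtain ⟨C, hC0, hC⟩ := I.bd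
  refine ⟨C, hC0, fun t x => ?_⟩
  unfold Ib
  rw [abs_mul, abs_of_nonneg (by positivity)]
  have h1 : |∫ z, φ (x - 2 * √(t - a) * z) * exp (-1 * z ^ 2)| ≤ ∫ z, C * exp (-1 * z ^ 2) := by
    rw [← norm_eq_abs]
    refine norm_integral_le_of_norm_le ((integrable_exp_neg_mul_sq zero_lt_one).const_mul _) ?_
    refine Eventually.of_forall fun z => ?_
    rw [norm_mul, norm_eq_abs (exp _), abs_of_pos (exp_pos _)]
    exact mul_le_mul_of_nonneg_right (hC _) (exp_pos _).le
  rw [integral_const_mul, integral_gaussian, div_one] at h1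
  have hp : 0 < √π := by positivity
  rw [inv_mul_le_iff₀ hp]
  linarith

lemma Ib_gt (φ : ℝ → ℝ) {t : ℝ} (ht : a < t) (x : ℝ) :
    Ib a φ t x = Pt G φ (fun ξ => ξ) (fun _ => a) t x := by
  unfold Ib Pt
  have hr : 0 < t - a := by linarith
  set r := t - a
  have hs : 0 < √r := sqrt_pos.2 hr
  have hss : √r ^ 2 = r := sq_sqrt hr.le
  rw [← integral_sub_left_eq_self (fun ξ => φ ξ * G (x - ξ) r) volume x]
  have h := Measure.integral_comp_mul_left (fun ξ => φ (x - ξ) * G (x - (x - ξ)) r) (2 * √r)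
  rw [abs_of_pos (by positivity), smul_eq_mul] at h
  have h2 : ∫ ξ, φ (x - ξ) * G (x - (x - ξ)) r =
      (2 * √r) * ∫ z, φ (x - 2 * √r * z) * G (x - (x - 2 * √r * z)) r := by
    rw [h]; field_simp
  rw [h2, ← integral_const_mul, ← integral_const_mul]
  congr 1
  ext z
  unfold G Hk c0
  have e : (x - (x - 2 * √r * z)) ^ 2 / (4 * r) = 1 * z ^ 2 := by
    rw [sub_sub_cancel, mul_pow, mul_pow, hss]; field_simp; ring
  rw [e]
  have : √π ≠ 0 := by positivity
  simp only [pow_zero]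
  rw [← neg_mul]
  field_simp

lemma Ini.dens (I : Ini A φ) : Dens φ (fun ξ => ξ) (fun _ => a) A :=
  ⟨I.fi, measurable_id, measurable_const, fun θ h => by
    by_contra h'; exact h (I.ps θ (not_le.1 h'))⟩

lemma Ini.good {t : ℝ} (ht : a < t) (x : ℝ) : Good φ (fun ξ => ξ) (fun _ => a) (t - a) t x :=
  fun _ _ => Or.inr (Or.inl le_rfl)

end

structure Dat (a b M R A : ℝ) (φ f v σ : ℝ → ℝ) : Prop where
  I : Ini A φ
  F : Lay a b M R f σ
  V : Lay a b M R v σ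

/-- derivative of the layer potential with kernel `K` -/
def UK (K : ℝ → ℝ → ℝ) (a : ℝ) (φ f v σ : ℝ → ℝ) (t x : ℝ) : ℝ :=
  Pt K φ (fun ξ => ξ) (fun _ => a) t x + 2 * Pt K f (fun _ => 0) (fun τ => τ) t x
    - Pt K v σ (fun τ => τ) t x - Pt K v (fun τ => -σ τ) (fun τ => τ) t x

def U (a : ℝ) (φ f v σ : ℝ → ℝ) (t x : ℝ) : ℝ :=
  Ib a φ t x + 2 * Pt G f (fun _ => 0) (fun τ => τ) t x
    - Pt G v σ (fun τ => τ) t x - Pt G v (fun τ => -σ τ) (fun τ => τ) t x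

lemma U_gt {a : ℝ} (φ f v σ : ℝ → ℝ) {t : ℝ} (ht : a < t) (x : ℝ) :
    U a φ f v σ t x = UK G a φ f v σ t x := by
  unfold U UK; rw [Ib_gt φ ht]

section
variable {a b M R A : ℝ} {φ f v σ : ℝ → ℝ}

lemma Dat.cont (D : Dat a b M R A φ f v σ) : Continuous fun q : ℝ × ℝ => U a φ f v σ q.1 q.2 :=
  ((D.I.cont.add (continuous_const.mul D.F.zero.cont)).sub D.V.cont).sub D.V.neg.cont

lemma Lay.Pt_bd (L : Lay a b M R f σ) (T : ℝ) :
    ∃ C, 0 ≤ C ∧ ∀ t x, t ≤ T → |Pt G f σ (fun τ => τ) t x| ≤ C := by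
  set g := indicator (Ioo 0 (T - a)) fun r : ℝ => r ^ (-(1/2) : ℝ) with hg
  have gi : Integrable g := sing_int (by norm_num)
  refine ⟨|∫ r, M * c0 * g r|, abs_nonneg _, fun t x ht => ?_⟩
  rw [layer_shift]
  rw [← norm_eq_abs]
  refine (norm_integral_le_of_norm_le (gi.const_mul (M * c0)) ?_).trans (le_abs_self _)
  refine Eventually.of_forall fun r => ?_
  by_cases hr : r ∈ Ioo 0 (T - a)
  · rw [hg, indicator_of_mem hr, norm_mul, ← inv_sqrt_eq hr.1, mul_assoc]
    exact mul_le_mul (L.fb _) (G_le _ hr.1) (norm_nonneg _) L.M0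
  · rw [hg, indicator_of_notMem hr, mul_zero]
    rcases le_or_gt r 0 with h | h
    · simp [G_nonpos _ h]
    · have : T - a ≤ r := by by_contra h'; exact hr ⟨h, not_le.1 h'⟩
      rw [L.fa _ (by linarith)]; simp

lemma Dat.bd (D : Dat a b M R A φ f v σ) (T : ℝ) :
    ∃ C, ∀ t x, t ≤ T → |U a φ f v σ t x| ≤ C := by
  obtain ⟨C1, _, h1⟩ := D.I.Ib_bd (a := a)
  obtain ⟨C2, _, h2⟩ := D.F.zero.Pt_bd T
  obtain ⟨C3, _, h3⟩ := D.V.Pt_bd T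
  obtain ⟨C4, _, h4⟩ := D.V.neg.Pt_bd T
  refine ⟨C1 + 2 * C2 + C3 + C4, fun t x ht => ?_⟩
  have k1 := abs_le.1 (h1 t x)
  have k2 := abs_le.1 (h2 t x ht)
  have k3 := abs_le.1 (h3 t x ht)
  have k4 := abs_le.1 (h4 t x ht)
  unfold U
  rw [abs_le]; constructor <;> linarith

lemma U_init (D : Dat a b M R A φ f v σ) {t : ℝ} (ht : t ≤ a) (x : ℝ) :
    U a φ f v σ t x = φ x := by
  have h0 : ∀ g s, (∀ τ ≤ a, g τ = 0) → Pt G g s (fun τ => τ) t x = 0 := by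
    intro g s hg
    unfold Pt
    rw [integral_eq_zero_of_ae]
    refine Eventually.of_forall fun τ => ?_
    rcases le_or_gt τ a with h | h
    · simp [hg τ h]
    · simp [G_nonpos _ (by linarith : t - τ ≤ 0)]
  unfold U
  rw [Ib_le φ ht, h0 f _ D.F.fa, h0 v _ D.V.fa, h0 v _ D.V.fa]
  ring

/-- points where the representation is smooth -/
def Off (a : ℝ) (σ : ℝ → ℝ) (t x : ℝ) : Prop := a < t ∧ x ≠ 0 ∧ x ≠ σ t ∧ x ≠ -σ t

lemma Dat.dx (D : Dat a b M R A φ f v σ) {K K' : ℝ → ℝ → ℝ} (hK : Ker K) (hK' : Ker K')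
    (hd : ∀ y r, HasDerivAt (fun y => K y r) (K' y r) y) {t x : ℝ} (h : Off a σ t x) :
    HasDerivAt (UK K a φ f v σ t) (UK K' a φ f v σ t x) x := by
  obtain ⟨h1, h2, h3, h4⟩ := h
  obtain ⟨A1, D1⟩ := D.F.zero.dens
  obtain ⟨A2, D2⟩ := D.V.dens
  obtain ⟨A3, D3⟩ := D.V.neg.dens
  obtain ⟨δ1, e1, g1⟩ := D.F.zero.good h2
  obtain ⟨δ2, e2, g2⟩ := D.V.good h3
  obtain ⟨δ3, e3, g3⟩ := D.V.neg.good h4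
  exact (((D.I.dens.dx hK hK' hd (by linarith) (Ini.good h1 x)).add
    ((D1.dx hK hK' hd e1 g1).const_mul 2)).sub (D2.dx hK hK' hd e2 g2)).sub (D3.dx hK hK' hd e3 g3)

lemma Dat.dt' (D : Dat a b M R A φ f v σ) {t x : ℝ} (h : Off a σ t x) :
    HasDerivAt (fun t => UK G a φ f v σ t x) (UK G2 a φ f v σ t x) t := by
  obtain ⟨h1, h2, h3, h4⟩ := h
  obtain ⟨A1, D1⟩ := D.F.zero.dens
  obtain ⟨A2, D2⟩ := D.V.dens
  obtain ⟨A3, D3⟩ := D.V.neg.dens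
  obtain ⟨δ1, e1, g1⟩ := D.F.zero.good h2
  obtain ⟨δ2, e2, g2⟩ := D.V.good h3
  obtain ⟨δ3, e3, g3⟩ := D.V.neg.good h4
  exact (((D.I.dens.dt G_ker G2_ker G_dr (by linarith) (Ini.good h1 x)).add
    ((D1.dt G_ker G2_ker G_dr e1 g1).const_mul 2)).sub (D2.dt G_ker G2_ker G_dr e2 g2)).sub
    (D3.dt G_ker G2_ker G_dr e3 g3)

lemma Dat.contK (D : Dat a b M R A φ f v σ) {K : ℝ → ℝ → ℝ} (hK : Ker K) {t x : ℝ}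
    (h : Off a σ t x) : ContinuousAt (fun q : ℝ × ℝ => UK K a φ f v σ q.1 q.2) (t, x) := by
  obtain ⟨h1, h2, h3, h4⟩ := h
  obtain ⟨A1, D1⟩ := D.F.zero.dens
  obtain ⟨A2, D2⟩ := D.V.dens
  obtain ⟨A3, D3⟩ := D.V.neg.dens
  obtain ⟨δ1, e1, g1⟩ := D.F.zero.good h2
  obtain ⟨δ2, e2, g2⟩ := D.V.good h3
  obtain ⟨δ3, e3, g3⟩ := D.V.neg.good h4
  exact (((D.I.dens.cont hK (by linarith) (Ini.good h1 x)).add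
    ((D1.cont hK e1 g1).const_mul 2)).sub (D2.cont hK e2 g2)).sub (D3.cont hK e3 g3)

lemma Dat.Ux (D : Dat a b M R A φ f v σ) {t x : ℝ} (h : Off a σ t x) :
    HasDerivAt (U a φ f v σ t) (UK G1 a φ f v σ t x) x := by
  have : U a φ f v σ t = UK G a φ f v σ t := by ext y; exact U_gt φ f v σ h.1 y
  rw [this]
  exact D.dx G_ker G1_ker G_dy h

lemma Dat.Uxx (D : Dat a b M R A φ f v σ) {t x : ℝ} (h : Off a σ t x) :
    HasDerivAt (UK G1 a φ f v σ t) (UK G2 a φ f v σ t x) x :=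
  D.dx G1_ker G2_ker G1_dy h

lemma Dat.Ut (D : Dat a b M R A φ f v σ) {t x : ℝ} (h : Off a σ t x) :
    HasDerivAt (fun t => U a φ f v σ t x) (UK G2 a φ f v σ t x) t := by
  refine (D.dt' h).congr_of_eventuallyEq ?_
  filter_upwards [lt_mem_nhds h.1] with τ hτ using U_gt φ f v σ hτ x

lemma Lay.contOff (L : Lay a b M R f σ) {K : ℝ → ℝ → ℝ} (hK : Ker K) {t x : ℝ} (h : x ≠ σ t) :
    ContinuousAt (fun q : ℝ × ℝ => Pt K f σ (fun τ => τ) q.1 q.2) (t, x) := by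
  obtain ⟨A, D⟩ := L.dens
  obtain ⟨δ, e, g⟩ := L.good h
  exact D.cont hK e g

/-- limit of `U_x` at the free boundary from inside -/
lemma Dat.limL (D : Dat a b M R A φ f v σ) {t : ℝ} (ht : a < t) (hs : 0 < σ t)
    (hv : ContinuousAt v t) :
    Tendsto (fun q : ℝ × ℝ => UK G1 a φ f v σ q.1 q.2) (𝓝[{q | q.2 < σ q.1}] (t, σ t))
      (𝓝 (UK G1 a φ f v σ t (σ t) - v t / 2)) := by
  have h1 := (D.I.dens.cont G1_ker (by linarith) (Ini.good ht (σ t))).tendsto.mono_left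
    (nhdsWithin_le_nhds (s := {q : ℝ × ℝ | q.2 < σ q.1}))
  have h2 := (D.F.zero.contOff G1_ker (t := t) (x := σ t) hs.ne').tendsto.mono_left
    (nhdsWithin_le_nhds (s := {q : ℝ × ℝ | q.2 < σ q.1}))
  have h3 := D.V.jumpL hv
  have h4 := (D.V.neg.contOff G1_ker (t := t) (x := σ t) (by linarith)).tendsto.mono_left
    (nhdsWithin_le_nhds (s := {q : ℝ × ℝ | q.2 < σ q.1}))
  have := ((h1.add (h2.const_mul 2)).sub h3).sub h4
  unfold UK
  convert this using 2
  ring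

lemma Dat.limR (D : Dat a b M R A φ f v σ) {t : ℝ} (ht : a < t) (hs : 0 < σ t)
    (hv : ContinuousAt v t) :
    Tendsto (fun q : ℝ × ℝ => UK G1 a φ f v σ q.1 q.2) (𝓝[{q | σ q.1 < q.2}] (t, σ t))
      (𝓝 (UK G1 a φ f v σ t (σ t) + v t / 2)) := by
  have h1 := (D.I.dens.cont G1_ker (by linarith) (Ini.good ht (σ t))).tendsto.mono_left
    (nhdsWithin_le_nhds (s := {q : ℝ × ℝ | σ q.1 < q.2}))
  have h2 := (D.F.zero.contOff G1_ker (t := t) (x := σ t) hs.ne').tendsto.mono_left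
    (nhdsWithin_le_nhds (s := {q : ℝ × ℝ | σ q.1 < q.2}))
  have h3 := D.V.jumpR hv
  have h4 := (D.V.neg.contOff G1_ker (t := t) (x := σ t) (by linarith)).tendsto.mono_left
    (nhdsWithin_le_nhds (s := {q : ℝ × ℝ | σ q.1 < q.2}))
  have := ((h1.add (h2.const_mul 2)).sub h3).sub h4
  unfold UK
  convert this using 2
  ring

lemma U1_zero (D : Dat a b M R A φ f v σ) (t : ℝ) :
    Pt G1 φ (fun ξ => ξ) (fun _ => a) t 0 = 0 ∧ Pt G1 f (fun _ => 0) (fun τ => τ) t 0 = 0 ∧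
    Pt G1 v σ (fun τ => τ) t 0 + Pt G1 v (fun τ => -σ τ) (fun τ => τ) t 0 = 0 := by
  refine ⟨?_, ?_, ?_⟩
  · unfold Pt
    have h := integral_neg_eq_self (fun ξ => φ ξ * G1 (0 - ξ) (t - a)) volume
    have h2 : ∫ ξ, φ (-ξ) * G1 (0 - -ξ) (t - a) = -∫ ξ, φ ξ * G1 (0 - ξ) (t - a) := by
      rw [← integral_neg]; congr 1; ext ξ
      rw [D.I.pe, zero_sub, zero_sub, G1_neg (-ξ)]; ring
    linarith
  · unfold Pt; simp [G1]
  · unfold Pt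
    rw [← sub_neg_eq_add, ← integral_neg, sub_eq_zero]
    congr 1; ext τ
    rw [zero_sub, zero_sub, G1_neg (-σ τ)]; ring

/-- limit of `U_x` at the fixed boundary -/
lemma Dat.lim0 (D : Dat a b M R A φ f v σ) {t : ℝ} (ht : a < t) (hs : 0 < σ t)
    (hf : ContinuousAt f t) :
    Tendsto (fun q : ℝ × ℝ => UK G1 a φ f v σ q.1 q.2) (𝓝[{q | 0 < q.2}] (t, 0))
      (𝓝 (- f t)) := by
  obtain ⟨z1, z2, z3⟩ := U1_zero D t
  have h1 := (D.I.dens.cont G1_ker (by linarith) (Ini.good ht 0)).tendsto.mono_left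
    (nhdsWithin_le_nhds (s := {q : ℝ × ℝ | 0 < q.2}))
  have h2 := D.F.zero.jumpR hf
  have h3 := (D.V.contOff G1_ker (t := t) (x := 0) hs.ne).tendsto.mono_left
    (nhdsWithin_le_nhds (s := {q : ℝ × ℝ | 0 < q.2}))
  have h4 := (D.V.neg.contOff G1_ker (t := t) (x := 0) (by linarith)).tendsto.mono_left
    (nhdsWithin_le_nhds (s := {q : ℝ × ℝ | 0 < q.2}))
  have := ((h1.add (h2.const_mul 2)).sub h3).sub h4
  unfold UK
  convert this using 2
  rw [z1, z2]
  linarith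

/-- continuity of `U_x` along the curve -/
lemma Dat.curve (D : Dat a b M R A φ f v σ) {t : ℝ} (ht : a < t) (hs : 0 < σ t) :
    ContinuousAt (fun t => UK G1 a φ f v σ t (σ t)) t := by
  have hsc := D.V.sc
  have hcm : ContinuousAt (fun t => (t, σ t)) t := by fun_prop
  have h1 : ContinuousAt (fun t => Pt G1 φ (fun ξ => ξ) (fun _ => a) t (σ t)) t :=
    (D.I.dens.cont G1_ker (by linarith) (Ini.good ht (σ t))).comp (f := fun t => (t, σ t)) hcm
  have h2 : ContinuousAt (fun t => Pt G1 f (fun _ => 0) (fun τ => τ) t (σ t)) t :=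
    (D.F.zero.contOff G1_ker hs.ne').comp (f := fun t => (t, σ t)) hcm
  have h3 : ContinuousAt (fun t => Pt G1 v σ (fun τ => τ) t (σ t)) t := by
    simp only [LA_curve]
    exact (D.V.LA_cont.comp (by fun_prop : Continuous fun t => (t, σ t))).continuousAt
  have h4 : ContinuousAt (fun t => Pt G1 v (fun τ => -σ τ) (fun τ => τ) t (σ t)) t :=
    (D.V.neg.contOff G1_ker (t := t) (x := σ t) (by linarith)).comp (f := fun t => (t, σ t)) hcm
  exact ((h1.add (continuousAt_const.mul h2)).sub h3).sub h4

end
end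

noncomputable section

/-- maximum principle on an unbounded region with a kink curve -/
lemma mp_main {a T A R : ℝ} {ℓ s v : ℝ → ℝ} {E : ℝ → ℝ → ℝ} (hℓ : ContinuousOn ℓ (Icc a T))
    (hs : ∀ t ∈ Ioc a T, HasDerivAt s (v t) t ∧ |v t| ≤ R) (hsc : ContinuousOn s (Icc a T))
    (hr : ∀ t ∈ Icc a T, 0 ≤ ℓ t ∧ ℓ t ≤ s t ∧ s t ≤ A - 1)
    (hE : ContinuousOn (fun q : ℝ × ℝ => E q.1 q.2) {q | q.1 ∈ Icc a T ∧ ℓ q.1 ≤ q.2})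
    (hb : ∃ C, ∀ t ∈ Icc a T, ∀ x ≥ ℓ t, E t x ≤ C) (h0 : ∀ x ≥ ℓ a, E a x ≤ 0)
    (heat : ∀ t ∈ Ioc a T, ∀ x > ℓ t, x ≠ s t → ∃ (f' : ℝ → ℝ) (b : ℝ),
      HasDerivAt (fun τ => E τ x) b t ∧ (∀ᶠ y in 𝓝 x, HasDerivAt (E t) (f' y) y) ∧ HasDerivAt f' b x)
    (hk : ∀ t ∈ Ioc a T, ℓ t < s t → ∃ d, HasDerivAt (E t) d (s t))
    (hl : ∀ t ∈ Ioc a T, HasDerivWithinAt (E t) 0 (Ici (ℓ t)) (ℓ t)) :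
    ∀ t ∈ Icc a T, ∀ x ≥ ℓ t, E t x ≤ 0 := by
  intro t₁ ht₁ x₁ hx₁
  by_contra hcon
  push Not at hcon
  obtain ⟨C, hC⟩ := hb
  have hA : 1 ≤ A := by have := hr t₁ ht₁; linarith
  obtain ⟨P, hP⟩ : ∃ P : ℝ → ℝ → ℝ, ∀ t x, P t x = |x - s t| + 2 * A * x - x ^ 2 - (R + 3) * (t - a) :=
    ⟨_, fun _ _ => rfl⟩
  have hR : a < t₁ → 0 ≤ R := fun h => (abs_nonneg _).trans (hs t₁ ⟨h, ht₁.2⟩).2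
  have hat : a < t₁ := by
    refine lt_of_le_of_ne ht₁.1 fun h => ?_
    subst h
    linarith [h0 x₁ hx₁]
  have hR := hR hat
  have hPub : ∀ t ∈ Icc a T, ∀ x ≥ ℓ t, P t x ≤ A + (2 * A + 1) * x - x ^ 2 := by
    intro t ht x hx
    have h1 := hr t ht
    have h2 : |x - s t| ≤ x + A := by rw [abs_le]; constructor <;> linarith
    have h3 : 0 ≤ (R + 3) * (t - a) := mul_nonneg (by linarith) (by linarith [ht.1])
    rw [hP]; linarith
  set B := A + (2 * A + 1) ^ 2 with hB
  have hPB : ∀ t ∈ Icc a T, ∀ x ≥ ℓ t, P t x ≤ B := by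
    intro t ht x hx
    have := hPub t ht x hx
    nlinarith [sq_nonneg (x - (2 * A + 1)), sq_nonneg (2*A+1), sq_nonneg x]
  obtain ⟨ε, hε, hε1⟩ : ∃ ε > 0, ε * (B - P t₁ x₁) < E t₁ x₁ := by
    have h1 : 0 ≤ B - P t₁ x₁ := by linarith [hPB t₁ ht₁ x₁ hx₁]
    refine ⟨E t₁ x₁ / (B - P t₁ x₁ + 1), by positivity, ?_⟩
    rw [div_mul_eq_mul_div, div_lt_iff₀ (by positivity)]
    nlinarith
  set N := (|C| + 1) / ε - P t₁ x₁ with hN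
  set X := max (max (2 * A + 2) x₁) (A + N) + 1 with hX
  have hX1 : 2 * A + 2 < X := by rw [hX]; linarith [le_max_left (2 * A + 2) x₁, le_max_left (max (2 * A + 2) x₁) (A + N)]
  have hX2 : x₁ < X := by rw [hX]; linarith [le_max_right (2 * A + 2) x₁, le_max_left (max (2 * A + 2) x₁) (A + N)]
  have hX3 : A + N < X := by rw [hX]; linarith [le_max_right (max (2 * A + 2) x₁) (A + N)]
  set K := {q : ℝ × ℝ | q.1 ∈ Icc a T ∧ ℓ q.1 ≤ q.2 ∧ q.2 ≤ X} with hK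
  have hKc : IsCompact K := compact_region hℓ continuousOn_const
  have hZc : ContinuousOn (fun q : ℝ × ℝ => E q.1 q.2 + ε * P q.1 q.2) K := by
    have h1 : ContinuousOn (fun q : ℝ × ℝ => s q.1) K :=
      hsc.comp continuousOn_fst fun q hq => hq.1
    have h2 := hE.mono (fun q (hq : q ∈ K) => ⟨hq.1, hq.2.1⟩)
    simp only [hP]
    have h3 : Continuous fun q : ℝ × ℝ => 2 * A * q.2 - q.2 ^ 2 - (R + 3) * (q.1 - a) := by fun_prop
    refine (h2.add ((continuousOn_const (c := ε)).mul (((continuousOn_snd.sub h1).abs).add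
      h3.continuousOn))).congr fun q _ => ?_
    simp only [Pi.add_apply, Pi.mul_apply, Pi.sub_apply]; ring
  obtain ⟨⟨t, x⟩, ⟨ht, hxl, hxX⟩, hmax⟩ := hKc.exists_isMaxOn ⟨(t₁, x₁), ht₁, hx₁, hX2.le⟩ hZc
  have hmax' : ∀ τ y, τ ∈ Icc a T → ℓ τ ≤ y → y ≤ X → E τ y + ε * P τ y ≤ E t x + ε * P t x :=
    fun τ y h1 h2 h3 => hmax (show (τ, y) ∈ K from ⟨h1, h2, h3⟩)
  simp only at ht hxl hxX
  have hZ1 := hmax' t₁ x₁ ht₁ hx₁ hX2.le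
  have hta : a < t := by
    refine lt_of_le_of_ne ht.1 fun h => ?_
    subst h
    have h1 := h0 x hxl
    have h2 := mul_le_mul_of_nonneg_left (hPB a ht x hxl) hε.le
    linarith
  have ht' : t ∈ Ioc a T := ⟨hta, ht.2⟩
  have hxX' : x < X := by
    refine lt_of_le_of_ne hxX fun h => ?_
    have h1 := hPub t ht x hxl
    have h2 : P t x ≤ -N := by
      rw [h] at h1 ⊢
      nlinarith
    have h3 := mul_le_mul_of_nonneg_left h2 hε.le
    have h4 : ε * -N = -(|C| + 1) + ε * P t₁ x₁ := by rw [hN]; field_simp; ring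
    have h5 := hC t ht x hxl
    have := le_abs_self C
    linarith
  obtain ⟨r1, r2, r3⟩ := hr t ht
  have hmR : ∀ᶠ y in 𝓝[>] x, E t y + ε * P t y ≤ E t x + ε * P t x := by
    filter_upwards [Ioo_mem_nhdsGT hxX'] with y hy
    exact hmax' t y ht (hxl.trans hy.1.le) hy.2.le
  have hpoly : ∀ y, HasDerivAt (fun y => 2 * A * y - y ^ 2 - (R + 3) * (t - a)) (2 * A - 2 * y) y := by
    intro y
    have h := (((hasDerivAt_id y).const_mul (2 * A)).sub ((hasDerivAt_id y).pow 2)).sub_const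
      ((R + 3) * (t - a))
    exact h.congr_deriv (by simp)
  rcases eq_or_lt_of_le hxl with hxe | hxl
  · -- left boundary
    subst hxe
    rcases eq_or_lt_of_le r2 with he | hlt
    · have h1 : HasDerivWithinAt (fun y => E t y + ε * P t y) (0 + ε * (1 + (2 * A - 2 * ℓ t)))
          (Ici (ℓ t)) (ℓ t) := by
        refine (hl t ht').add (HasDerivWithinAt.const_mul ε ?_)
        have := ((hasDerivAt_id (ℓ t)).sub_const (s t)).add (hpoly (ℓ t))
        refine this.hasDerivWithinAt.congr (fun y hy => ?_) ?_
        · rw [hP, abs_of_nonneg (by rw [← he]; exact sub_nonneg.2 hy)]; simp; ring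
        · rw [hP, abs_of_nonneg (by rw [← he, sub_self])]; simp; ring
      exact mp_right h1 (by nlinarith) hmR
    · have h1 : HasDerivWithinAt (fun y => E t y + ε * P t y) (0 + ε * (-1 + (2 * A - 2 * ℓ t)))
          (Ici (ℓ t)) (ℓ t) := by
        refine (hl t ht').add (HasDerivWithinAt.const_mul ε ?_)
        have := ((hasDerivAt_id (ℓ t)).sub_const (s t)).neg.add (hpoly (ℓ t))
        refine (this.congr_of_eventuallyEq ?_).hasDerivWithinAt
        filter_upwards [gt_mem_nhds hlt] with y hy
        rw [hP, abs_of_nonpos (by linarith)]; simp; ring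
      exact mp_right h1 (by nlinarith) hmR
  · have hmL : ∀ᶠ y in 𝓝[<] x, E t y + ε * P t y ≤ E t x + ε * P t x := by
      filter_upwards [Ioo_mem_nhdsLT hxl] with y hy
      exact hmax' t y ht hy.1.le (hy.2.le.trans hxX)
    by_cases hxs : x = s t
    · subst hxs
      obtain ⟨d, hd⟩ := hk t ht' hxl
      have h1 : HasDerivWithinAt (fun y => E t y + ε * P t y) (d + ε * (1 + (2 * A - 2 * s t)))
          (Ici (s t)) (s t) := by
        refine hd.hasDerivWithinAt.add (HasDerivWithinAt.const_mul ε ?_)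
        have := ((hasDerivAt_id (s t)).sub_const (s t)).add (hpoly (s t))
        refine this.hasDerivWithinAt.congr (fun y hy => ?_) ?_
        · rw [hP, abs_of_nonneg (sub_nonneg.2 hy)]; simp; ring
        · rw [hP]; simp; try ring
      have h2 : HasDerivWithinAt (fun y => E t y + ε * P t y) (d + ε * (-1 + (2 * A - 2 * s t)))
          (Iic (s t)) (s t) := by
        refine hd.hasDerivWithinAt.add (HasDerivWithinAt.const_mul ε ?_)
        have := ((hasDerivAt_id (s t)).sub_const (s t)).neg.add (hpoly (s t))
        refine this.hasDerivWithinAt.congr (fun y hy => ?_) ?_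
        · rw [hP, abs_of_nonpos (sub_nonpos.2 hy)]; simp; ring
        · rw [hP]; simp; try ring
      rcases lt_or_ge 0 (d + ε * (1 + (2 * A - 2 * s t))) with h | h
      · exact mp_right h1 h hmR
      · exact mp_left h2 (by nlinarith) hmL
    · obtain ⟨f', b, e1, e2, e3⟩ := heat t ht' x hxl hxs
      obtain ⟨hsd, hvR⟩ := hs t ht'
      have hvR := abs_le.1 hvR
      obtain ⟨σ, hσ, hσ1⟩ : ∃ σ : ℝ, (σ = 1 ∨ σ = -1) ∧ 0 < σ * (x - s t) := by
        rcases lt_or_gt_of_ne hxs with h | h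
        · exact ⟨-1, Or.inr rfl, by linarith⟩
        · exact ⟨1, Or.inl rfl, by linarith⟩
      have habs : ∀ z : ℝ, 0 < σ * z → |z| = σ * z := by
        intro z hz
        rcases hσ with h | h <;> subst h
        · rw [abs_of_pos (by linarith)]; ring
        · rw [abs_of_neg (by linarith)]; ring
      have hy : ∀ᶠ y in 𝓝 x, 0 < σ * (y - s t) := by
        have : ContinuousAt (fun y => σ * (y - s t)) x := by fun_prop
        exact this.eventually (lt_mem_nhds hσ1)
      have hτ : ∀ᶠ τ in 𝓝 t, 0 < σ * (x - s τ) := by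
        have h := hsd.continuousAt
        have : ContinuousAt (fun τ => σ * (x - s τ)) t := by fun_prop
        exact this.eventually (lt_mem_nhds hσ1)
      have d1 : HasDerivAt (fun τ => E τ x + ε * P τ x) (b + ε * (-(σ * v t) - (R + 3))) t := by
        refine e1.add (HasDerivAt.const_mul ε ?_)
        have h1 := (hsd.const_sub x).const_mul σ
        have h2 := (((hasDerivAt_id t).sub_const a).const_mul (R + 3)).const_sub (2 * A * x - x ^ 2)
        refine ((h1.add h2).congr_deriv (by ring)).congr_of_eventuallyEq ?_
        filter_upwards [hτ] with τ h
        rw [hP, habs _ h]; simp; ring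
      have d2 : ∀ᶠ y in 𝓝 x, HasDerivAt (fun y => E t y + ε * P t y)
          (f' y + ε * (σ + (2 * A - 2 * y))) y := by
        filter_upwards [e2, hy.eventually_nhds] with y h1 h2
        refine h1.add (HasDerivAt.const_mul ε ?_)
        have h3 := (((hasDerivAt_id y).sub_const (s t)).const_mul σ).add (hpoly y)
        refine (h3.congr_deriv (by ring)).congr_of_eventuallyEq ?_
        filter_upwards [h2] with z h
        rw [hP, habs _ h]; simp; ring
      have d3 : HasDerivAt (fun y => f' y + ε * (σ + (2 * A - 2 * y))) (b + ε * (-2)) x := by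
        refine e3.add (HasDerivAt.const_mul ε ?_)
        have h3 := (((hasDerivAt_id x).const_mul 2).const_sub (2 * A)).const_add σ
        exact h3.congr_deriv (by simp)
      have hσv : -R ≤ σ * v t := by
        rcases hσ with h | h <;> rw [h] <;> linarith
      refine mp_int' (Z := fun τ y => E τ y + ε * P τ y) d1 d2 d3 (by nlinarith) ?_ ?_
      · have k1 : ∀ᶠ τ in 𝓝[<] t, τ ∈ Ioo a t := Ioo_mem_nhdsLT hta
        have k2 : ∀ᶠ τ in 𝓝[Icc a T] t, ℓ τ < x := (hℓ t ht).eventually (gt_mem_nhds hxl)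
        have k3 : 𝓝[Ioo a t] t ≤ 𝓝[Icc a T] t :=
          nhdsWithin_mono _ fun τ hτ => ⟨hτ.1.le, hτ.2.le.trans ht.2⟩
        have k4 : 𝓝[<] t = 𝓝[Ioo a t] t := (nhdsWithin_Ioo_eq_nhdsLT hta).symm
        rw [k4] at k1 ⊢
        filter_upwards [k1, k2.filter_mono k3] with τ h1 h2
        exact hmax' τ x ⟨h1.1.le, h1.2.le.trans ht.2⟩ h2.le hxX
      · filter_upwards [Ioo_mem_nhds hxl hxX'] with y hy
        exact hmax' t y ht hy.1.le hy.2.le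
end

noncomputable section

section
variable {a b M R A : ℝ} {φ f v σ : ℝ → ℝ}

lemma Dat.Uc (D : Dat a b M R A φ f v σ) (t : ℝ) : Continuous (U a φ f v σ t) :=
  D.cont.comp (by fun_prop : Continuous fun x : ℝ => (t, x))

lemma Dat.derL (D : Dat a b M R A φ f v σ) {t : ℝ} (ht : a < t) (hs : 0 < σ t)
    (hv : ContinuousAt v t) :
    HasDerivWithinAt (U a φ f v σ t) (UK G1 a φ f v σ t (σ t) - v t / 2) (Iic (σ t)) (σ t) := by
  have hoff : ∀ y ∈ Ioo 0 (σ t), Off a σ t y := fun y hy =>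
    ⟨ht, hy.1.ne', hy.2.ne, by linarith [hy.1] |> fun h : -σ t < y => h.ne'⟩
  refine hasDerivWithinAt_Iic_of_tendsto_deriv (s := Ioo 0 (σ t)) ?_ (D.Uc t).continuousWithinAt
    (Ioo_mem_nhdsLT hs) ?_
  · exact fun y hy => (D.Ux (hoff y hy)).differentiableAt.differentiableWithinAt
  · have h1 : Tendsto (fun y : ℝ => (t, y)) (𝓝[<] (σ t)) (𝓝[{q | q.2 < σ q.1}] (t, σ t)) := by
      refine tendsto_nhdsWithin_of_tendsto_nhds_of_eventually_within _ ?_ ?_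
      · exact ((Continuous.tendsto (by fun_prop) _).mono_left nhdsWithin_le_nhds)
      · filter_upwards [self_mem_nhdsWithin] with y hy using hy
    refine ((D.limL ht hs hv).comp h1).congr' ?_
    filter_upwards [Ioo_mem_nhdsLT hs] with y hy
    exact (D.Ux (hoff y hy)).deriv.symm

lemma Dat.derR (D : Dat a b M R A φ f v σ) {t : ℝ} (ht : a < t) (hs : 0 < σ t)
    (hv : ContinuousAt v t) :
    HasDerivWithinAt (U a φ f v σ t) (UK G1 a φ f v σ t (σ t) + v t / 2) (Ici (σ t)) (σ t) := by
  have hoff : ∀ y ∈ Ioi (σ t), Off a σ t y := fun y (hy : σ t < y) =>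
    ⟨ht, by linarith [hy] |> fun h : 0 < y => h.ne', hy.ne', by linarith [hy] |> fun h : -σ t < y => h.ne'⟩
  refine hasDerivWithinAt_Ici_of_tendsto_deriv (s := Ioi (σ t)) ?_ (D.Uc t).continuousWithinAt
    self_mem_nhdsWithin ?_
  · exact fun y hy => (D.Ux (hoff y hy)).differentiableAt.differentiableWithinAt
  · have h1 : Tendsto (fun y : ℝ => (t, y)) (𝓝[>] (σ t)) (𝓝[{q | σ q.1 < q.2}] (t, σ t)) := by
      refine tendsto_nhdsWithin_of_tendsto_nhds_of_eventually_within _ ?_ ?_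
      · exact ((Continuous.tendsto (by fun_prop) _).mono_left nhdsWithin_le_nhds)
      · filter_upwards [self_mem_nhdsWithin] with y hy using hy
    refine ((D.limR ht hs hv).comp h1).congr' ?_
    filter_upwards [self_mem_nhdsWithin] with y hy
    exact (D.Ux (hoff y hy)).deriv.symm

lemma Dat.der0 (D : Dat a b M R A φ f v σ) {t : ℝ} (ht : a < t) (hs : 0 < σ t)
    (hf : ContinuousAt f t) :
    HasDerivWithinAt (U a φ f v σ t) (- f t) (Ici 0) 0 := by
  have hoff : ∀ y ∈ Ioo 0 (σ t), Off a σ t y := fun y hy =>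
    ⟨ht, hy.1.ne', hy.2.ne, by linarith [hy.1] |> fun h : -σ t < y => h.ne'⟩
  refine hasDerivWithinAt_Ici_of_tendsto_deriv (s := Ioo 0 (σ t)) ?_ (D.Uc t).continuousWithinAt
    (Ioo_mem_nhdsGT hs) ?_
  · exact fun y hy => (D.Ux (hoff y hy)).differentiableAt.differentiableWithinAt
  · have h1 : Tendsto (fun y : ℝ => (t, y)) (𝓝[>] 0) (𝓝[{q | 0 < q.2}] (t, 0)) := by
      refine tendsto_nhdsWithin_of_tendsto_nhds_of_eventually_within _ ?_ ?_
      · exact ((Continuous.tendsto (by fun_prop) _).mono_left nhdsWithin_le_nhds)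
      · filter_upwards [self_mem_nhdsWithin] with y hy using hy
    refine ((D.lim0 ht hs hf).comp h1).congr' ?_
    filter_upwards [Ioo_mem_nhdsGT hs] with y hy
    exact (D.Ux (hoff y hy)).deriv.symm

lemma Off.ev {t x : ℝ} (h : Off a σ t x) : ∀ᶠ y in 𝓝 x, Off a σ t y := by
  filter_upwards [isOpen_ne.mem_nhds h.2.1, isOpen_ne.mem_nhds h.2.2.1, isOpen_ne.mem_nhds h.2.2.2]
    with y h1 h2 h3 using ⟨h.1, h1, h2, h3⟩

/-- the potential vanishes outside -/
lemma Dat.exterior (D : Dat a b M R A φ f v σ) {T : ℝ} (hsp : ∀ t ∈ Icc a T, 0 < σ t)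
    (hv : ∀ t ∈ Ioc a T, ContinuousAt v t)
    (heq : ∀ t ∈ Ioc a T, v t = -2 * UK G1 a φ f v σ t (σ t))
    (hσ : ∀ t ∈ Ioc a T, HasDerivAt σ (v t) t) (h0 : ∀ x ≥ σ a, φ x = 0) :
    ∀ t ∈ Icc a T, ∀ x ≥ σ t, U a φ f v σ t x = 0 := by
  obtain ⟨C, hC⟩ := D.bd T
  obtain ⟨B, hB⟩ := (isCompact_Icc.image_of_continuousOn
    (D.V.sc.continuousOn (s := Icc a T))).isBounded.bddAbove
  have key : ∀ κ : ℝ, κ ^ 2 = 1 → ∀ t ∈ Icc a T, ∀ x ≥ σ t, κ * U a φ f v σ t x ≤ 0 := by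
    intro κ hκ
    have hκ1 : |κ| = 1 := by rw [← sq_eq_sq₀ (abs_nonneg _) zero_le_one, sq_abs, hκ]; norm_num
    refine mp_main (E := fun t x => κ * U a φ f v σ t x) (s := σ) (v := v) (R := M) (A := B + 1)
      D.V.sc.continuousOn
      (fun t ht => ⟨hσ t ht, D.V.fb t⟩) D.V.sc.continuousOn ?_ ?_ ?_ ?_ ?_ ?_ ?_
    · exact fun t ht => ⟨(hsp t ht).le, le_rfl, by linarith [hB (mem_image_of_mem _ ht)]⟩
    · exact (continuous_const.mul D.cont).continuousOn
    · refine ⟨C, fun t ht x _ => (le_abs_self _).trans ?_⟩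
      rw [abs_mul, hκ1, one_mul]
      exact hC t x ht.2
    · intro x hx
      rw [U_init D le_rfl, h0 x hx, mul_zero]
    · intro t ht x hx hxs
      have := hsp t ⟨ht.1.le, ht.2⟩
      have ho : Off a σ t x := ⟨ht.1, by linarith |> fun h : 0 < x => h.ne', hxs,
        by linarith |> fun h : -σ t < x => h.ne'⟩
      refine ⟨fun y => κ * UK G1 a φ f v σ t y, κ * UK G2 a φ f v σ t x, (D.Ut ho).const_mul κ, ?_,
        (D.Uxx ho).const_mul κ⟩
      filter_upwards [ho.ev] with y hy using (D.Ux hy).const_mul κ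
    · intro t _ h; exact absurd h (lt_irrefl _)
    · intro t ht
      have := (D.derR ht.1 (hsp t ⟨ht.1.le, ht.2⟩) (hv t ht)).const_mul κ
      refine this.congr_deriv ?_
      rw [heq t ht]; ring
  intro t ht x hx
  have h1 := key 1 (by norm_num) t ht x hx
  have h2 := key (-1) (by norm_num) t ht x hx
  linarith

/-- nonnegativity inside -/
lemma Dat.nonneg (D : Dat a b M R A φ f v σ) {T : ℝ} (hsp : ∀ t ∈ Icc a T, 0 < σ t)
    (hf : ∀ t ∈ Ioc a T, ContinuousAt f t ∧ 0 ≤ f t) (hφ : ∀ x, 0 ≤ φ x)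
    (hb : ∀ t ∈ Icc a T, U a φ f v σ t (σ t) = 0) :
    ∀ t ∈ Icc a T, ∀ x ∈ Icc 0 (σ t), 0 ≤ U a φ f v σ t x := by
  intro t₁ ht₁ x₁ hx₁
  by_contra hcon
  push Not at hcon
  have hTa : a ≤ T := ht₁.1.trans ht₁.2
  set ε := -U a φ f v σ t₁ x₁ / (2 + (T - a)) with hε
  have hTa' : 0 < 2 + (T - a) := by linarith
  have hε0 : 0 < ε := div_pos (by linarith) hTa'
  have hε1 : ε * (2 + (T - a)) = -U a φ f v σ t₁ x₁ := by rw [hε]; field_simp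
  set K := {q : ℝ × ℝ | q.1 ∈ Icc a T ∧ 0 ≤ q.2 ∧ q.2 ≤ σ q.1} with hK
  have hKc : IsCompact K := compact_region continuousOn_const D.V.sc.continuousOn
  have hZc : ContinuousOn (fun q : ℝ × ℝ => -U a φ f v σ q.1 q.2 - ε * (exp (-q.2) + (q.1 - a))) K := by
    have := D.cont
    exact Continuous.continuousOn (by fun_prop)
  obtain ⟨⟨t, x⟩, ⟨ht, hx0, hxs⟩, hmax⟩ := hKc.exists_isMaxOn ⟨(t₁, x₁), ht₁, hx₁.1, hx₁.2⟩ hZc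
  have hmax' : ∀ τ y, τ ∈ Icc a T → 0 ≤ y → y ≤ σ τ → -U a φ f v σ τ y - ε * (exp (-y) + (τ - a)) ≤
      -U a φ f v σ t x - ε * (exp (-x) + (t - a)) :=
    fun τ y h1 h2 h3 => hmax (show (τ, y) ∈ K from ⟨h1, h2, h3⟩)
  simp only at ht hx0 hxs
  have hpos : 0 < -U a φ f v σ t x - ε * (exp (-x) + (t - a)) := by
    refine lt_of_lt_of_le ?_ (hmax' t₁ x₁ ht₁ hx₁.1 hx₁.2)
    have : exp (-x₁) ≤ 1 := exp_le_one_iff.2 (by linarith [hx₁.1])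
    have h2 : ε * (exp (-x₁) + (t₁ - a)) ≤ ε * (1 + (T - a)) :=
      mul_le_mul_of_nonneg_left (by linarith [ht₁.2]) hε0.le
    nlinarith
  have hpen : 0 ≤ ε * (exp (-x) + (t - a)) :=
    mul_nonneg hε0.le (by linarith [exp_pos (-x), ht.1])
  have hU : U a φ f v σ t x < 0 := by linarith
  have hta : a < t := by
    refine lt_of_le_of_ne ht.1 fun h => ?_
    subst h
    rw [U_init D le_rfl] at hU
    linarith [hφ x]
  have hxs' : x < σ t := by
    refine lt_of_le_of_ne hxs fun h => ?_
    rw [h, hb t ht] at hU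
    exact lt_irrefl _ hU
  have dexp : ∀ y : ℝ, HasDerivAt (fun y => exp (-y) + (t - a)) (-exp (-y)) y := by
    intro y
    exact (((hasDerivAt_id y).neg.exp).add_const _).congr_deriv (by simp)
  rcases eq_or_lt_of_le hx0 with h0 | h0
  · subst h0
    have h1 := (D.der0 hta (hsp t ht) (hf t ⟨hta, ht.2⟩).1).neg.sub
      ((dexp 0).hasDerivWithinAt.const_mul ε)
    refine mp_right h1 ?_ ?_
    · have := (hf t ⟨hta, ht.2⟩).2
      simp; linarith
    · filter_upwards [Ioo_mem_nhdsGT hxs'] with y hy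
      exact hmax' t y ht hy.1.le hy.2.le
  · have ho : Off a σ t x := ⟨hta, h0.ne', hxs'.ne, by linarith [hsp t ht] |> fun h : -σ t < x => h.ne'⟩
    refine mp_int' (t := t) (x := x) (Z := fun τ y => -U a φ f v σ τ y - ε * (exp (-y) + (τ - a)))
      (f' := fun y => -UK G1 a φ f v σ t y - ε * (-exp (-y)))
      (a := -UK G2 a φ f v σ t x - ε * 1) (b := -UK G2 a φ f v σ t x - ε * exp (-x)) ?_ ?_ ?_ ?_ ?_ ?_
    · exact (D.Ut ho).neg.sub ((((hasDerivAt_id t).sub_const a).const_add (exp (-x))).const_mul ε)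
    · filter_upwards [ho.ev] with y hy
      exact (D.Ux hy).neg.sub ((dexp y).const_mul ε)
    · have h : HasDerivAt (fun y : ℝ => -exp (-y)) (exp (-x)) x :=
        (((hasDerivAt_id x).neg.exp).neg).congr_deriv (by simp)
      exact (D.Uxx ho).neg.sub (h.const_mul ε)
    · have : exp (-x) < 1 := exp_lt_one_iff.2 (by linarith)
      nlinarith
    · have k2 : ∀ᶠ τ in 𝓝[<] t, x < σ τ :=
        (D.V.sc.continuousAt.eventually (lt_mem_nhds hxs')).filter_mono nhdsWithin_le_nhds
      filter_upwards [Ioo_mem_nhdsLT hta, k2] with τ h1 h2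
      exact hmax' τ x ⟨h1.1.le, h1.2.le.trans ht.2⟩ hx0 h2.le
    · filter_upwards [Ioo_mem_nhds h0 hxs'] with y hy
      exact hmax' t y ht hy.1.le hy.2.le

end
end

noncomputable section

/-- the old solution extended by zero -/
def ub (s : ℝ → ℝ) (u : ℝ → ℝ → ℝ) (t x : ℝ) : ℝ := u t (min x (s t))

section
variable {p c a b M R A : ℝ} {s : ℝ → ℝ} {u : ℝ → ℝ → ℝ} {φ f v σ : ℝ → ℝ}

lemma Old.ub_cont (O : Old p c s u) :
    ContinuousOn (fun q : ℝ × ℝ => ub s u q.1 q.2) {q | q.1 ∈ Ioo 0 c ∧ 0 ≤ q.2} := by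
  have h1 : ContinuousOn (fun q : ℝ × ℝ => s q.1) {q : ℝ × ℝ | q.1 ∈ Ioo 0 c ∧ 0 ≤ q.2} :=
    O.sc.comp continuousOn_fst fun q hq => hq.1
  refine O.uc.comp (f := fun q : ℝ × ℝ => (q.1, min q.2 (s q.1)))
    (continuousOn_fst.prodMk (ContinuousOn.inf continuousOn_snd h1)) fun q hq => ?_
  exact ⟨hq.1, le_min hq.2 (O.sp _ hq.1).le, min_le_right _ _⟩

lemma Old.ub_zero (O : Old p c s u) {t x : ℝ} (ht : t ∈ Ioo 0 c) (hx : s t ≤ x) : ub s u t x = 0 := by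
  unfold ub; rw [min_eq_right hx, O.us t ht]

lemma ub_in {t x : ℝ} (hx : x ≤ s t) : ub s u t x = u t x := by
  unfold ub; rw [min_eq_left hx]

lemma Old.ini (O : Old p c s u) (ha : a ∈ Ioo 0 c) : Ini (s a) (fun x => ub s u a |x|) where
  pc := by
    rw [← continuousOn_univ]
    exact O.ub_cont.comp (f := fun x : ℝ => (a, |x|)) (by fun_prop) fun x _ => ⟨ha, abs_nonneg x⟩
  pe := fun x => by simp
  ps := fun x hx => O.ub_zero ha hx.le

lemma Old.rep (O : Old p c s u) (ha : a ∈ Ioo 0 c)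
    (D : Dat a b M R (s a) (fun x => ub s u a |x|) f v σ) (hσ : ∀ t ∈ Ico a c, σ t = s t)
    (hf : ∀ t ∈ Ioo a c, f t = u t 0 ^ p) (hfc : ∀ t ∈ Ioo a c, ContinuousAt f t)
    (hv : ∀ t ∈ Ioo a c, v t = deriv s t) (hvc : ∀ t ∈ Ioo a c, ContinuousAt v t) :
    ∀ t ∈ Ico a c, ∀ x, 0 ≤ x → U a (fun x => ub s u a |x|) f v σ t x = ub s u t x := by
  set φ := fun x => ub s u a |x| with hφ
  intro T hT
  have hsub : ∀ t ∈ Icc a T, t ∈ Ioo 0 c := fun t ht => ⟨ha.1.trans_le ht.1, ht.2.trans_lt hT.2⟩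
  obtain ⟨C, hC⟩ := D.bd T
  have hcomp : IsCompact {q : ℝ × ℝ | q.1 ∈ Icc a T ∧ 0 ≤ q.2 ∧ q.2 ≤ s q.1} :=
    compact_region continuousOn_const (O.sc.mono fun t ht => hsub t ht)
  obtain ⟨C', hC'⟩ := hcomp.exists_bound_of_continuousOn
    (O.uc.mono fun q hq => ⟨hsub _ hq.1, hq.2⟩)
  have key : ∀ κ : ℝ, κ ^ 2 = 1 → ∀ t ∈ Icc a T, ∀ x ≥ (0:ℝ),
      κ * (U a φ f v σ t x - ub s u t x) ≤ 0 := by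
    intro κ hκ
    have hκ1 : |κ| = 1 := by rw [← sq_eq_sq₀ (abs_nonneg _) zero_le_one, sq_abs, hκ]; norm_num
    refine mp_main (E := fun t x => κ * (U a φ f v σ t x - ub s u t x)) (ℓ := fun _ => 0)
      (s := s) (v := deriv s) (R := M) (A := s T + 1) continuousOn_const
      (fun t ht => ⟨O.sd t (hsub t ⟨ht.1.le, ht.2⟩), ?_⟩) (O.sc.mono fun t ht => hsub t ht) ?_ ?_ ?_ ?_ ?_ ?_ ?_
    · rw [← hv t ⟨ht.1, ht.2.trans_lt hT.2⟩]; exact D.V.fb t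
    · exact fun t ht => ⟨le_rfl, (O.sp t (hsub t ht)).le, by
        linarith [O.smono (hsub t ht) (hsub T ⟨hT.1, le_rfl⟩) ht.2]⟩
    · refine continuousOn_const.mul (D.cont.continuousOn.sub (O.ub_cont.mono fun q hq => ?_))
      exact ⟨hsub _ hq.1, hq.2⟩
    · refine ⟨C + C', fun t ht x hx => (le_abs_self _).trans ?_⟩
      rw [abs_mul, hκ1, one_mul]
      refine (abs_sub _ _).trans (add_le_add (hC t x ht.2) ?_)
      exact hC' (t, min x (s t)) ⟨ht, le_min hx (O.sp _ (hsub t ht)).le, min_le_right _ _⟩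
    · intro x hx
      rw [U_init D le_rfl, hφ]
      simp [abs_of_nonneg hx]
    · intro t ht x hx hxs
      have htc := hsub t ⟨ht.1.le, ht.2⟩
      have hst := O.sp t htc
      have hσt := hσ t ⟨ht.1.le, ht.2.trans_lt hT.2⟩
      have ho : Off a σ t x := ⟨ht.1, hx.ne', by rwa [hσt], by
        have h : -s t < x := by linarith
        rw [hσt]; exact h.ne'⟩
      rcases lt_or_gt_of_ne hxs with h | h
      · refine ⟨fun y => κ * (UK G1 a φ f v σ t y - deriv (u t) y),
          κ * (UK G2 a φ f v σ t x - deriv (deriv (u t)) x), ?_, ?_, ?_⟩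
        · refine ((D.Ut ho).sub ((O.ut t htc x ⟨hx, h⟩).congr_of_eventuallyEq ?_)).const_mul κ
          filter_upwards [(O.sd t htc).continuousAt.eventually (lt_mem_nhds h)] with τ hτ
          exact ub_in hτ.le
        · filter_upwards [ho.ev, Ioo_mem_nhds hx h] with y hy hy2
          refine ((D.Ux hy).sub ((O.ux t htc y hy2).hasDerivAt.congr_of_eventuallyEq ?_)).const_mul κ
          filter_upwards [gt_mem_nhds hy2.2] with z hz
          exact ub_in (le_of_lt hz)
        · exact ((D.Uxx ho).sub (O.uxx t htc x ⟨hx, h⟩)).const_mul κ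
      · refine ⟨fun y => κ * (UK G1 a φ f v σ t y - 0),
          κ * (UK G2 a φ f v σ t x - 0), ?_, ?_, ?_⟩
        · refine ((D.Ut ho).sub ((hasDerivAt_const t (0:ℝ)).congr_of_eventuallyEq ?_)).const_mul κ
          filter_upwards [(O.sd t htc).continuousAt.eventually (gt_mem_nhds h),
            isOpen_Ioo.mem_nhds htc] with τ hτ h2
          exact O.ub_zero h2 hτ.le
        · filter_upwards [ho.ev, lt_mem_nhds h] with y hy hy2
          refine ((D.Ux hy).sub ((hasDerivAt_const y (0:ℝ)).congr_of_eventuallyEq ?_)).const_mul κ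
          filter_upwards [lt_mem_nhds hy2] with z hz
          exact O.ub_zero htc (le_of_lt hz)
        · exact ((D.Uxx ho).sub (hasDerivAt_const x (0:ℝ))).const_mul κ
    · intro t ht hst
      have htc := hsub t ⟨ht.1.le, ht.2⟩
      have hto : t ∈ Ioo a c := ⟨ht.1, htc.2⟩
      have hσt := hσ t ⟨ht.1.le, ht.2.trans_lt hT.2⟩
      have hL := D.derL ht.1 (by rw [hσt]; exact hst) (hvc t hto)
      have hR := D.derR ht.1 (by rw [hσt]; exact hst) (hvc t hto)
      rw [hσt, hv t hto] at hL hR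
      have uL : HasDerivWithinAt (ub s u t) (-deriv s t) (Iic (s t)) (s t) :=
        (O.ds t htc).congr (fun y hy => ub_in hy) (ub_in le_rfl)
      have uR : HasDerivWithinAt (ub s u t) 0 (Ici (s t)) (s t) :=
        (hasDerivWithinAt_const _ _ (0:ℝ)).congr (fun y hy => O.ub_zero htc hy) (O.ub_zero htc le_rfl)
      have eL := (hL.sub uL).const_mul κ
      have eR := (hR.sub uR).const_mul κ
      refine ⟨κ * (UK G1 a φ f v σ t (s t) + deriv s t / 2 - 0), ?_⟩
      have := (eL.congr_deriv (by ring : _ = κ * (UK G1 a φ f v σ t (s t) + deriv s t / 2 - 0))).union eR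
      rw [Iic_union_Ici, hasDerivWithinAt_univ] at this
      exact this
    · intro t ht
      have htc := hsub t ⟨ht.1.le, ht.2⟩
      have hto : t ∈ Ioo a c := ⟨ht.1, htc.2⟩
      have hst := O.sp t htc
      have hσt := hσ t ⟨ht.1.le, ht.2.trans_lt hT.2⟩
      have h1 := D.der0 ht.1 (by rw [hσt]; exact hst) (hfc t hto)
      have h2 : HasDerivWithinAt (ub s u t) (-(u t 0 ^ p)) (Ici 0) 0 := by
        refine (O.d0 t htc).congr_of_eventuallyEq ?_ (ub_in hst.le)
        filter_upwards [mem_nhdsWithin_of_mem_nhds (gt_mem_nhds hst)] with y hy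
        exact ub_in (le_of_lt hy)
      refine ((h1.sub h2).const_mul κ).congr_deriv ?_
      rw [hf t hto]; ring
  intro x hx
  have h1 := key 1 (by norm_num) T ⟨hT.1, le_rfl⟩ x hx
  have h2 := key (-1) (by norm_num) T ⟨hT.1, le_rfl⟩ x hx
  linarith

/-- the integral equations on `(a,c)` -/
lemma Old.eqs (O : Old p c s u) (ha : a ∈ Ioo 0 c)
    (D : Dat a b M R (s a) (fun x => ub s u a |x|) f v σ) (hσ : ∀ t ∈ Ico a c, σ t = s t)
    (hf : ∀ t ∈ Ioo a c, f t = u t 0 ^ p) (hfc : ∀ t ∈ Ioo a c, ContinuousAt f t)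
    (hv : ∀ t ∈ Ioo a c, v t = deriv s t) (hvc : ∀ t ∈ Ioo a c, ContinuousAt v t) :
    ∀ t ∈ Ioo a c, u t 0 = U a (fun x => ub s u a |x|) f v σ t 0 ∧
      v t = -2 * UK G1 a (fun x => ub s u a |x|) f v σ t (σ t) := by
  intro t ht
  have hr := O.rep ha D hσ hf hfc hv hvc t ⟨ht.1.le, ht.2⟩
  have htc : t ∈ Ioo 0 c := ⟨ha.1.trans ht.1, ht.2⟩
  have hst := O.sp t htc
  have hσt := hσ t ⟨ht.1.le, ht.2⟩
  refine ⟨?_, ?_⟩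
  · rw [hr 0 le_rfl, ub_in hst.le]
  · have hR := D.derR ht.1 (by rw [hσt]; exact hst) (hvc t ht)
    rw [hσt] at hR ⊢
    have uR : HasDerivWithinAt (U a (fun x => ub s u a |x|) f v σ t) 0 (Ici (s t)) (s t) :=
      (hasDerivWithinAt_const _ _ (0:ℝ)).congr
        (fun y (hy : s t ≤ y) => by rw [hr y (hst.le.trans hy)]; exact O.ub_zero htc hy)
        (by rw [hr _ hst.le]; exact O.ub_zero htc le_rfl)
    have := (uniqueDiffWithinAt_Ici (s t)).eq_deriv _ hR uR
    linarith
end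
end

noncomputable section

/-! ### Admissible densities -/

structure Adm (a b M : ℝ) (f : ℝ → ℝ) : Prop where
  fm : Measurable f
  fb : ∀ τ, |f τ| ≤ M
  fa : ∀ τ ≤ a, f τ = 0
  fB : ∀ τ, b ≤ τ → f τ = 0
  fd : ∃ F : Set ℝ, F.Countable ∧ ∀ τ ∉ F, ContinuousAt f τ

def psi (p x : ℝ) : ℝ := (max x 0) ^ p

lemma psi_cont {p : ℝ} (hp : 1 < p) : Continuous (psi p) := by
  unfold psi
  exact (continuous_id.max continuous_const).rpow_const fun x => Or.inr (by linarith)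

lemma psi_nonneg (p x : ℝ) : 0 ≤ psi p x := rpow_nonneg (le_max_right _ _) _

lemma psi_zero {p : ℝ} (hp : 1 < p) : psi p 0 = 0 := by
  unfold psi; rw [max_self, zero_rpow (by linarith)]

lemma psi_pos (p : ℝ) {x : ℝ} (hx : 0 ≤ x) : psi p x = x ^ p := by unfold psi; rw [max_eq_left hx]

lemma psi_le {p M x : ℝ} (hp : 1 < p) (hM : |x| ≤ M) : |psi p x| ≤ M ^ p := by
  rw [abs_of_nonneg (psi_nonneg _ _)]
  exact rpow_le_rpow (le_max_right _ _)
    (max_le ((le_abs_self _).trans hM) ((abs_nonneg _).trans hM)) (by linarith)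

lemma psi_lip {p M x y : ℝ} (hp : 1 < p) (hx : |x| ≤ M) (hy : |y| ≤ M) :
    |psi p x - psi p y| ≤ p * M ^ (p - 1) * |x - y| := by
  have key : ∀ z w : ℝ, 0 ≤ w → w ≤ z → z ≤ M → |z ^ p - w ^ p| ≤ p * M ^ (p - 1) * (z - w) := by
    intro z w hw hwz hzM
    rw [abs_of_nonneg (sub_nonneg.2 (rpow_le_rpow hw hwz (by linarith)))]
    refine (rpow_diff_le hp hw hwz).trans ?_
    have : z ^ (p - 1) ≤ M ^ (p - 1) := rpow_le_rpow (hw.trans hwz) hzM (by linarith)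
    exact mul_le_mul_of_nonneg_right (mul_le_mul_of_nonneg_left this (by linarith)) (by linarith)
  have hM : 0 ≤ M := (abs_nonneg x).trans hx
  have hmm : |max x 0 - max y 0| ≤ |x - y| := abs_max_sub_max_le_abs x y 0
  have hpM : 0 ≤ p * M ^ (p - 1) := mul_nonneg (by linarith) (rpow_nonneg hM _)
  have hxm : max x 0 ≤ M := max_le ((le_abs_self _).trans hx) hM
  have hym : max y 0 ≤ M := max_le ((le_abs_self _).trans hy) hM
  refine le_trans ?_ (mul_le_mul_of_nonneg_left hmm hpM)
  unfold psi
  rcases le_total (max y 0) (max x 0) with h | h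
  · rw [abs_of_nonneg (sub_nonneg.2 h)]
    exact key _ _ (le_max_right _ _) h hxm
  · rw [abs_sub_comm, abs_sub_comm (max x 0), abs_of_nonneg (sub_nonneg.2 h)]
    exact key _ _ (le_max_right _ _) h hym

def cur (a s0 : ℝ) (v : ℝ → ℝ) (t : ℝ) : ℝ := s0 + ∫ τ in a..t, v τ

def OW (p a s0 : ℝ) (φ w v : ℝ → ℝ) (t : ℝ) : ℝ :=
  U a φ (fun τ => psi p (w τ)) v (cur a s0 v) t 0

def OV (p a s0 : ℝ) (φ w v : ℝ → ℝ) (t : ℝ) : ℝ :=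
  -2 * UK G1 a φ (fun τ => psi p (w τ)) v (cur a s0 v) t (cur a s0 v t)

section
variable {p a b c M s0 A δ : ℝ} {φ w v w' v' : ℝ → ℝ}

lemma Adm.mono (L : Adm a b M w) {M' : ℝ} (h : M ≤ M') : Adm a b M' w :=
  ⟨L.fm, fun τ => (L.fb τ).trans h, L.fa, L.fB, L.fd⟩

lemma Adm.M0 (L : Adm a b M w) : 0 ≤ M := (abs_nonneg _).trans (L.fb 0)

lemma Adm.ii (L : Adm a b M w) (x y : ℝ) : IntervalIntegrable w volume x y := by
  rw [intervalIntegrable_iff]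
  exact Measure.integrableOn_of_bounded (M := M) (by simp) L.fm.aestronglyMeasurable
    (Eventually.of_forall L.fb)

lemma Adm.cur_sub (L : Adm a b M v) (x y : ℝ) : cur a s0 v y - cur a s0 v x = ∫ τ in x..y, v τ := by
  unfold cur
  rw [add_sub_add_left_eq_sub, intervalIntegral.integral_interval_sub_left (L.ii _ _) (L.ii _ _)]

lemma Adm.cur_lip (L : Adm a b M v) (x y : ℝ) : |cur a s0 v x - cur a s0 v y| ≤ M * |x - y| := by
  rw [L.cur_sub]
  exact le_of_eq_of_le (norm_eq_abs _).symm
    (intervalIntegral.norm_integral_le_of_norm_le_const fun τ _ => L.fb τ)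

lemma Adm.psi (hp : 1 < p) (L : Adm a b M w) : Adm a b (M ^ p) (fun τ => psi p (w τ)) where
  fm := (psi_cont hp).measurable.comp L.fm
  fb := fun τ => psi_le hp (L.fb τ)
  fa := fun τ h => by rw [L.fa τ h, psi_zero hp]
  fB := fun τ h => by rw [L.fB τ h, psi_zero hp]
  fd := by
    obtain ⟨F, hF, h⟩ := L.fd
    exact ⟨F, hF, fun τ hτ => (psi_cont hp).continuousAt.comp (h τ hτ)⟩

lemma Adm.lay (L : Adm a b M w) {R : ℝ} {σ : ℝ → ℝ} (sl : ∀ τ τ', |σ τ - σ τ'| ≤ R * |τ - τ'|) :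
    Lay a b M R w σ := ⟨L.fm, L.fb, L.fa, L.fB, L.fd, sl⟩

lemma Adm.dat (hp : 1 < p) (I : Ini A φ) (W : Adm a b M w) (V : Adm a b M v) :
    Dat a b (M + M ^ p) M A φ (fun τ => _root_.psi p (w τ)) v (cur a s0 v) where
  I := I
  F := ((W.psi hp).mono (by linarith [W.M0])).lay V.cur_lip
  V := (V.mono (by linarith [rpow_nonneg W.M0 p])).lay V.cur_lip

lemma Adm.cur_diff (V : Adm a b M v) (V' : Adm a b M v') (hac : a < c) {D h : ℝ} (hD : 0 ≤ D)
    (hh : 0 ≤ h) (h1 : ∀ τ < c, v τ = v' τ) (h2 : ∀ τ, |v τ - v' τ| ≤ D) {τ : ℝ}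
    (hτ : a ≤ τ) (hτ2 : τ ≤ c + h) : |cur a s0 v τ - cur a s0 v' τ| ≤ D * h := by
  unfold cur
  rw [add_sub_add_left_eq_sub, ← intervalIntegral.integral_sub (V.ii _ _) (V'.ii _ _)]
  have hz : ∀ y, a ≤ y → y ≤ c → |∫ x in a..y, v x - v' x| ≤ 0 := by
    intro y hy hyc
    have := intervalIntegral.norm_integral_le_of_norm_le_const_ae (a := a) (b := y) (C := 0)
      (f := fun x => v x - v' x) ?_
    · simpa using this
    · filter_upwards [(countable_singleton c).ae_notMem volume] with x hx hx2
      rw [uIoc_of_le hy] at hx2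
      rw [h1 x (lt_of_le_of_ne (hx2.2.trans hyc) hx), sub_self, norm_zero]
  rcases le_total τ c with h | h
  · exact (hz τ hτ h).trans (by positivity)
  · rw [← intervalIntegral.integral_add_adjacent_intervals (b := c)
      ((V.ii _ _).sub (V'.ii _ _)) ((V.ii _ _).sub (V'.ii _ _))]
    have e1 := hz c hac.le le_rfl
    have e2 : |∫ x in c..τ, v x - v' x| ≤ D * |τ - c| :=
      le_of_eq_of_le (norm_eq_abs _).symm
        (intervalIntegral.norm_integral_le_of_norm_le_const fun x _ => h2 x)
    rw [abs_of_nonneg (by linarith : 0 ≤ τ - c)] at e2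
    refine (abs_add_le _ _).trans ?_
    nlinarith

lemma Adm.om_diff (V : Adm a b M v) (V' : Adm a b M v') {D : ℝ}
    (h2 : ∀ τ, |v τ - v' τ| ≤ D) (t r : ℝ) (hr : 0 < r) :
    |(cur a s0 v t - cur a s0 v (t - r)) - (cur a s0 v' t - cur a s0 v' (t - r))| ≤ D * r := by
  rw [V.cur_sub, V'.cur_sub, ← intervalIntegral.integral_sub (V.ii _ _) (V'.ii _ _)]
  have e2 : |∫ x in (t - r)..t, v x - v' x| ≤ D * |t - (t - r)| :=
    le_of_eq_of_le (norm_eq_abs _).symm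
      (intervalIntegral.norm_integral_le_of_norm_le_const fun x _ => h2 x)
  rwa [sub_sub_cancel, abs_of_pos hr] at e2

lemma Adm.cur_bd (V : Adm a b M v) {H τ : ℝ} (h1 : a ≤ τ) (h2 : τ ≤ a + H) :
    |cur a s0 v τ| ≤ |s0| + M * H := by
  have h := V.cur_lip (s0 := s0) τ a
  have e : cur a s0 v a = s0 := by simp [cur]
  rw [e, abs_of_nonneg (by linarith : 0 ≤ τ - a)] at h
  have := abs_sub_abs_le_abs_sub (cur a s0 v τ) s0
  nlinarith [V.M0]

end

def JJ (H : ℝ) : ℝ := ∫ r, indicator (Ioo 0 H) (fun r : ℝ => r ^ (-(3/4) : ℝ)) r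

lemma JJ_nonneg (H : ℝ) : 0 ≤ JJ H :=
  integral_nonneg fun r => indicator_nonneg (fun r hr => rpow_nonneg hr.1.le _) r

lemma half_le {r h : ℝ} (hr : 0 < r) (h1 : r ≤ h) :
    r ^ (-(1/2) : ℝ) ≤ h ^ (1/4 : ℝ) * r ^ (-(3/4) : ℝ) := by
  have : r ^ (-(1/2) : ℝ) = r ^ (1/4 : ℝ) * r ^ (-(3/4) : ℝ) := by
    rw [← rpow_add hr]; norm_num
  rw [this]
  exact mul_le_mul_of_nonneg_right (rpow_le_rpow hr.le h1 (by norm_num)) (rpow_nonneg hr.le _)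

lemma one_le_rp {r H e : ℝ} (hr : 0 < r) (h1 : r ≤ H) (hH : 1 ≤ H) (he : 0 ≤ e) (he1 : e ≤ 1) :
    1 ≤ H * r ^ (-e) := by
  rw [rpow_neg hr.le, ← div_eq_mul_inv, le_div_iff₀ (rpow_pos_of_pos hr _), one_mul]
  calc r ^ e ≤ H ^ e := rpow_le_rpow hr.le h1 he
    _ ≤ H ^ (1:ℝ) := rpow_le_rpow_of_exponent_le hH he1
    _ = H := rpow_one H

lemma layer_diff {H H' h D M κ1 κ2 κ3 : ℝ} {K : ℝ → ℝ → ℝ} {q q' y y' : ℝ → ℝ} (hHH : H' ≤ H)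
    (hD : 0 ≤ D) (hh : 0 ≤ h) (hM : 0 ≤ M) (k1 : 0 ≤ κ1) (k2 : 0 ≤ κ2) (k3 : 0 ≤ κ3)
    (hm : Measurable fun r => q r * K (y r) r) (hm' : Measurable fun r => q' r * K (y' r) r)
    (hout : ∀ r ∉ Ioo 0 H', q r * K (y r) r = 0 ∧ q' r * K (y' r) r = 0)
    (hq : ∀ r, |q r| ≤ M) (hq' : ∀ r, |q' r| ≤ M) (hd : ∀ r, |q r - q' r| ≤ κ1 * D)
    (hdh : ∀ r, h < r → q r = q' r)
    (hK : ∀ r ∈ Ioo 0 H', |K (y r) r| ≤ κ2 * r ^ (-(1/2) : ℝ))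
    (hK' : ∀ r ∈ Ioo 0 H', |K (y' r) r| ≤ κ2 * r ^ (-(1/2) : ℝ))
    (hKd : ∀ r ∈ Ioo 0 H', |K (y r) r - K (y' r) r| ≤ κ3 * D * (h ^ (1/4 : ℝ) * r ^ (-(3/4) : ℝ))) :
    |(∫ r, q r * K (y r) r) - ∫ r, q' r * K (y' r) r| ≤
      (κ1 * κ2 + M * κ3) * JJ H * (D * h ^ (1/4 : ℝ)) := by
  have hint : ∀ g z : ℝ → ℝ, (Measurable fun r => g r * K (z r) r) →
      (∀ r ∉ Ioo 0 H', g r * K (z r) r = 0) → (∀ r, |g r| ≤ M) →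
      (∀ r ∈ Ioo 0 H', |K (z r) r| ≤ κ2 * r ^ (-(1/2) : ℝ)) → Integrable fun r => g r * K (z r) r := by
    intro g z e1 e2 e3 e4
    refine ((sing_int (e := -(1/2)) (B := H') (by norm_num)).const_mul (M * κ2)).mono'
      e1.aestronglyMeasurable (Eventually.of_forall fun r => ?_)
    by_cases hr : r ∈ Ioo 0 H'
    · rw [indicator_of_mem hr, norm_mul, mul_assoc]
      exact mul_le_mul (e3 r) (e4 r hr) (norm_nonneg _) hM
    · rw [indicator_of_notMem hr, e2 r hr]; simp
  rw [← integral_sub (hint q y hm (fun r hr => (hout r hr).1) hq hK)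
    (hint q' y' hm' (fun r hr => (hout r hr).2) hq' hK'), ← norm_eq_abs]
  have hfin : ∫ r, (κ1 * κ2 + M * κ3) * (D * h ^ (1/4 : ℝ)) *
      indicator (Ioo 0 H) (fun r : ℝ => r ^ (-(3/4) : ℝ)) r =
      (κ1 * κ2 + M * κ3) * JJ H * (D * h ^ (1/4 : ℝ)) := by
    rw [integral_const_mul]; unfold JJ; ring
  rw [← hfin]
  refine norm_integral_le_of_norm_le ((sing_int (by norm_num)).const_mul _) ?_
  refine Eventually.of_forall fun r => ?_
  have hh4 : 0 ≤ h ^ (1/4 : ℝ) := rpow_nonneg hh _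
  by_cases hr : r ∈ Ioo 0 H'
  · have hr' : r ∈ Ioo 0 H := ⟨hr.1, hr.2.trans_le hHH⟩
    rw [indicator_of_mem hr', norm_eq_abs]
    have e : q r * K (y r) r - q' r * K (y' r) r =
      (q r - q' r) * K (y r) r + q' r * (K (y r) r - K (y' r) r) := by ring
    rw [e]
    have hr4 : 0 ≤ r ^ (-(3/4) : ℝ) := rpow_nonneg hr.1.le _
    have t1 : |(q r - q' r) * K (y r) r| ≤ κ1 * D * (κ2 * (h ^ (1/4 : ℝ) * r ^ (-(3/4) : ℝ))) := by
      rcases le_or_gt r h with h1 | h1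
      · rw [abs_mul]
        refine mul_le_mul (hd r) ((hK r hr).trans ?_) (abs_nonneg _) (by positivity)
        exact mul_le_mul_of_nonneg_left (half_le hr.1 h1) k2
      · rw [hdh r h1, sub_self, zero_mul, abs_zero]; positivity
    have t2 : |q' r * (K (y r) r - K (y' r) r)| ≤
        M * (κ3 * D * (h ^ (1/4 : ℝ) * r ^ (-(3/4) : ℝ))) := by
      rw [abs_mul]
      exact mul_le_mul (hq' r) (hKd r hr) (abs_nonneg _) hM
    refine (abs_add_le _ _).trans ((add_le_add t1 t2).trans (le_of_eq (by ring)))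
  · rw [(hout r hr).1, (hout r hr).2, sub_zero, norm_zero]
    refine mul_nonneg (by positivity) (indicator_nonneg (fun r hr => rpow_nonneg hr.1.le _) r)

/-- mean value estimate for kernels away from the origin -/
lemma Ker_far {K K' : ℝ → ℝ → ℝ} {δ Y : ℝ} (hδ : 0 < δ) (hK : Ker K) (hK' : Ker K')
    (hd : ∀ y r, HasDerivAt (fun y => K y r) (K' y r) y) :
    ∃ C, 0 ≤ C ∧ ∀ r, (∀ y, δ ≤ y → y ≤ Y → |K y r| ≤ C) ∧
      ∀ y y', δ ≤ y → y ≤ Y → δ ≤ y' → y' ≤ Y → |K y r - K y' r| ≤ C * |y - y'| := by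
  obtain ⟨C1, h1, hC1⟩ := hK.bdd δ hδ Y
  obtain ⟨C2, h2, hC2⟩ := hK'.bdd δ hδ Y
  refine ⟨C1 + C2, by linarith, fun r => ⟨fun y hy hY => ?_, fun y y' hy hY hy' hY' => ?_⟩⟩
  · have := hC1 y r (by rw [abs_of_nonneg (by linarith)]; exact hY)
      (Or.inl (hy.trans (le_abs_self _)))
    linarith
  · have := (convex_Icc δ Y).norm_image_sub_le_of_norm_hasDerivWithin_le (f := fun y => K y r)
      (f' := fun y => K' y r) (C := C1 + C2) (x := y') (y := y)
      (fun z _ => (hd z r).hasDerivWithinAt) (fun z hz => ?_) ⟨hy', hY'⟩ ⟨hy, hY⟩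
    · exact this
    · have := hC2 z r (by rw [abs_of_nonneg (by linarith [hz.1])]; exact hz.2)
        (Or.inl (hz.1.trans (le_abs_self _)))
      rw [norm_eq_abs]; linarith
end

noncomputable section

section
variable {p a c M s0 A δ h D t : ℝ} {φ w v w' v' : ℝ → ℝ}

/-- comparison of two layer integrals whose densities agree before `c` -/
lemma lay_term {K : ℝ → ℝ → ℝ} {f f' y y' : ℝ → ℝ} {κ1 κ2 κ3 : ℝ} (hK : Ker K)
    (hK0 : ∀ y r, r ≤ 0 → K y r = 0) (L : Adm a (c + 1) M f) (L' : Adm a (c + 1) M f')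
    (hh : 0 < h) (hh1 : h ≤ 1) (hD : 0 ≤ D) (ht : t ∈ Icc c (c + h))
    (k1 : 0 ≤ κ1) (k2 : 0 ≤ κ2) (k3 : 0 ≤ κ3)
    (hf : ∀ τ < c, f τ = f' τ) (hd : ∀ τ, |f τ - f' τ| ≤ κ1 * D)
    (hy : Measurable y) (hy' : Measurable y')
    (e1 : ∀ r ∈ Ioo 0 (t - a), |K (y r) r| ≤ κ2 * r ^ (-(1/2) : ℝ))
    (e2 : ∀ r ∈ Ioo 0 (t - a), |K (y' r) r| ≤ κ2 * r ^ (-(1/2) : ℝ))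
    (e3 : ∀ r ∈ Ioo 0 (t - a),
      |K (y r) r - K (y' r) r| ≤ κ3 * D * (h ^ (1/4 : ℝ) * r ^ (-(3/4) : ℝ))) :
    |(∫ r, f (t - r) * K (y r) r) - ∫ r, f' (t - r) * K (y' r) r| ≤
      (κ1 * κ2 + M * κ3) * JJ (c + 1 - a) * (D * h ^ (1/4 : ℝ)) := by
  have hmk : ∀ z : ℝ → ℝ, Measurable z → Measurable fun r => K (z r) r := fun z hz =>
    hK.meas.comp (hz.prodMk measurable_id)
  have hts : Measurable fun r : ℝ => t - r := measurable_const.sub measurable_id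
  refine layer_diff (H' := t - a) (by linarith [ht.2]) hD hh.le L.M0 k1 k2 k3
    ((L.fm.comp hts).mul (hmk y hy)) ((L'.fm.comp hts).mul (hmk y' hy')) ?_ (fun r => L.fb _)
    (fun r => L'.fb _) (fun r => hd _) (fun r hr => hf _ (by linarith [ht.2])) e1 e2 e3
  intro r hr
  rcases le_or_gt r 0 with h0 | h0
  · rw [hK0 _ _ h0, hK0 _ _ h0]; simp
  · have : t - r ≤ a := by
      by_contra hc
      exact hr ⟨h0, by linarith⟩
    rw [L.fa _ this, L'.fa _ this]; simp

lemma h_quarter (hh : 0 < h) (hh1 : h ≤ 1) : h ≤ h ^ (1/4 : ℝ) := by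
  calc h = h ^ (1 : ℝ) := (rpow_one h).symm
    _ ≤ _ := rpow_le_rpow_of_exponent_ge hh hh1 (by norm_num)

lemma far_term {K K' : ℝ → ℝ → ℝ} {Y : ℝ} (hδ : 0 < δ) (hK : Ker K) (hK' : Ker K')
    (hdK : ∀ y r, HasDerivAt (fun y => K y r) (K' y r) y)
    (hK0 : ∀ y r, r ≤ 0 → K y r = 0) (hac : a < c) (hM : 0 ≤ M) (κ1 : ℝ) (k1 : 0 ≤ κ1) :
    ∃ κ, 0 ≤ κ ∧ ∀ (h D t : ℝ) (f f' y y' : ℝ → ℝ), 0 < h → h ≤ 1 → 0 ≤ D → t ∈ Icc c (c + h) →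
      Adm a (c + 1) M f → Adm a (c + 1) M f' → (∀ τ < c, f τ = f' τ) →
      (∀ τ, |f τ - f' τ| ≤ κ1 * D) → Measurable y → Measurable y' →
      (∀ r ∈ Ioo 0 (t - a), y r ∈ Icc δ Y ∧ y' r ∈ Icc δ Y ∧ |y r - y' r| ≤ 2 * (D * h)) →
      |(∫ r, f (t - r) * K (y r) r) - ∫ r, f' (t - r) * K (y' r) r| ≤ κ * (D * h ^ (1/4 : ℝ)) := by
  obtain ⟨C, hC, H⟩ := Ker_far (Y := Y) hδ hK hK' hdK
  have hH : 1 ≤ c + 1 - a := by linarith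
  set E := c + 1 - a with hE
  refine ⟨(κ1 * (C * E) + M * (C * (2 * E))) * JJ E,
    mul_nonneg (by positivity) (JJ_nonneg _), ?_⟩
  intro h D t f f' y y' hh hh1 hD ht L L' hf hd hy hy' hr
  have hle : ∀ r ∈ Ioo 0 (t - a), r ≤ E := fun r hr => by linarith [hr.2, ht.2]
  have b1 : ∀ r ∈ Ioo 0 (t - a), C ≤ C * E * r ^ (-(1/2) : ℝ) := fun r hr => by
    have := one_le_rp (e := 1/2) hr.1 (hle r hr) hH (by norm_num) (by norm_num)
    calc C = C * 1 := (mul_one C).symm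
      _ ≤ C * (E * r ^ (-(1/2) : ℝ)) := mul_le_mul_of_nonneg_left this hC
      _ = _ := by ring
  refine lay_term hK hK0 L L' hh hh1 hD ht k1 (by positivity) (by positivity) hf hd hy hy'
    (fun r h' => ((H r).1 _ (hr r h').1.1 (hr r h').1.2).trans (b1 r h'))
    (fun r h' => ((H r).1 _ (hr r h').2.1.1 (hr r h').2.1.2).trans (b1 r h')) fun r h' => ?_
  obtain ⟨⟨g1, g2⟩, ⟨g3, g4⟩, g5⟩ := hr r h'
  refine ((H r).2 _ _ g1 g2 g3 g4).trans ?_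
  have b2 := one_le_rp (e := 3/4) h'.1 (hle r h') hH (by norm_num) (by norm_num)
  have b3 := h_quarter hh hh1
  calc C * |y r - y' r| ≤ C * (2 * (D * h ^ (1/4 : ℝ))) :=
        mul_le_mul_of_nonneg_left (g5.trans (by gcongr)) hC
    _ = C * (2 * (D * h ^ (1/4 : ℝ))) * 1 := (mul_one _).symm
    _ ≤ C * (2 * (D * h ^ (1/4 : ℝ))) * (E * r ^ (-(3/4) : ℝ)) :=
        mul_le_mul_of_nonneg_left b2 (by positivity)
    _ = _ := by ring

lemma G1_close {r y y' : ℝ} (hh : 0 < h) (hr : 0 < r) (hD : 0 ≤ D)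
    (h1 : |y - y'| ≤ D * r) (h2 : |y - y'| ≤ 2 * (D * h)) :
    |G1 y r - G1 y' r| ≤ (4 * c0) * D * (h ^ (1/4 : ℝ) * r ^ (-(3/4) : ℝ)) := by
  have mv := (convex_univ (𝕜 := ℝ)).norm_image_sub_le_of_norm_hasDerivWithin_le
    (f := fun y => G1 y r) (f' := fun y => G2 y r) (C := c0 * 2 * (r⁻¹ * (√r)⁻¹)) (x := y') (y := y)
    (fun z _ => (G1_dy z r).hasDerivWithinAt) (fun z _ => G2_le z hr) (mem_univ _) (mem_univ _)
  have c0p := c0_pos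
  refine (le_trans mv ?_)
  rw [norm_eq_abs, inv_sqrt_eq hr]
  have hr4 : 0 ≤ r ^ (-(3/4) : ℝ) := rpow_nonneg hr.le _
  have hh4 : 0 ≤ h ^ (1/4 : ℝ) := rpow_nonneg hh.le _
  have hr2 : 0 ≤ r ^ (-(1/2) : ℝ) := rpow_nonneg hr.le _
  rcases le_or_gt r h with hrh | hrh
  · calc c0 * 2 * (r⁻¹ * r ^ (-(1/2) : ℝ)) * |y - y'| ≤ c0 * 2 * (r⁻¹ * r ^ (-(1/2) : ℝ)) * (D * r) :=
          mul_le_mul_of_nonneg_left h1 (by positivity)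
      _ = c0 * 2 * D * r ^ (-(1/2) : ℝ) := by field_simp
      _ ≤ c0 * 2 * D * (h ^ (1/4 : ℝ) * r ^ (-(3/4) : ℝ)) :=
          mul_le_mul_of_nonneg_left (half_le hr hrh) (by positivity)
      _ ≤ _ := by
          have : 0 ≤ c0 * 2 * D * (h ^ (1/4 : ℝ) * r ^ (-(3/4) : ℝ)) := by positivity
          linarith
  · have q1 : r⁻¹ * r ^ (-(1/2) : ℝ) = r ^ (-(3/4) : ℝ) * r ^ (-(3/4) : ℝ) := by
      rw [← rpow_neg_one, ← rpow_add hr, ← rpow_add hr]; norm_num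
    have q2 : h = h ^ (1/4 : ℝ) * h ^ (3/4 : ℝ) := by
      rw [← rpow_add hh]; norm_num
    have q3 : h ^ (3/4 : ℝ) * r ^ (-(3/4) : ℝ) ≤ 1 := by
      calc h ^ (3/4 : ℝ) * r ^ (-(3/4) : ℝ) ≤ r ^ (3/4 : ℝ) * r ^ (-(3/4) : ℝ) :=
            mul_le_mul_of_nonneg_right (rpow_le_rpow hh.le hrh.le (by norm_num)) hr4
        _ = 1 := by rw [← rpow_add hr]; norm_num
    calc c0 * 2 * (r⁻¹ * r ^ (-(1/2) : ℝ)) * |y - y'| ≤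
          c0 * 2 * (r⁻¹ * r ^ (-(1/2) : ℝ)) * (2 * (D * h)) :=
          mul_le_mul_of_nonneg_left h2 (by positivity)
      _ = c0 * 2 * (r⁻¹ * r ^ (-(1/2) : ℝ)) * (2 * (D * (h ^ (1/4 : ℝ) * h ^ (3/4 : ℝ)))) := by
          rw [← q2]
      _ = (4 * c0) * D * (h ^ (1/4 : ℝ) * r ^ (-(3/4) : ℝ)) * (h ^ (3/4 : ℝ) * r ^ (-(3/4) : ℝ)) := by
          rw [q1]; ring
      _ ≤ (4 * c0) * D * (h ^ (1/4 : ℝ) * r ^ (-(3/4) : ℝ)) * 1 :=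
          mul_le_mul_of_nonneg_left q3 (by positivity)
      _ = _ := mul_one _

lemma ini_term (I : Ini A φ) (hac : a < c) (Y : ℝ) :
    ∃ κ, 0 ≤ κ ∧ ∀ t x x', c ≤ t → |x| ≤ Y → |x'| ≤ Y →
      |Pt G1 φ (fun ξ => ξ) (fun _ => a) t x - Pt G1 φ (fun ξ => ξ) (fun _ => a) t x'| ≤ κ * |x - x'| := by
  obtain ⟨C, hC, H⟩ := G2_ker.bdd (c - a) (by linarith) (Y + |A|)
  refine ⟨C * ∫ ξ, |φ ξ|, mul_nonneg hC (integral_nonneg fun _ => abs_nonneg _), ?_⟩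
  intro t x x' ht hx hx'
  have i1 : ∀ x, Integrable fun ξ => φ ξ * G1 (x - ξ) (t - a) := fun x =>
    I.dens.integrable G1_ker (by linarith : 0 < t - a) (Ini.good (by linarith) x)
  unfold Pt
  rw [← integral_sub (i1 x) (i1 x'), ← norm_eq_abs]
  have e : C * (∫ ξ, |φ ξ|) * |x - x'| = ∫ ξ, |φ ξ| * (C * |x - x'|) := by
    rw [integral_mul_const]; ring
  rw [e]
  refine norm_integral_le_of_norm_le (I.fi.abs.mul_const _) (Eventually.of_forall fun ξ => ?_)
  rw [← mul_sub, norm_mul, norm_eq_abs, norm_eq_abs]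
  by_cases hξ : φ ξ = 0
  · rw [hξ]; simp
  have hξA : |ξ| ≤ |A| := by
    by_contra h'
    exact hξ (I.ps ξ ((le_abs_self A).trans_lt (not_le.1 h')))
  refine mul_le_mul_of_nonneg_left ?_ (abs_nonneg _)
  have mem : ∀ z, |z| ≤ Y → z - ξ ∈ Icc (-(Y + |A|)) (Y + |A|) := fun z hz =>
    abs_le.1 ((abs_sub _ _).trans (add_le_add hz hξA))
  have mv := (convex_Icc (-(Y + |A|)) (Y + |A|)).norm_image_sub_le_of_norm_hasDerivWithin_le
    (f := fun y => G1 y (t - a)) (f' := fun y => G2 y (t - a)) (C := C)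
    (fun z _ => (G1_dy z (t - a)).hasDerivWithinAt)
    (fun z hz => H z _ (abs_le.2 hz) (Or.inr (Or.inl (by linarith)))) (mem x' hx') (mem x hx)
  rwa [sub_sub_sub_cancel_right] at mv

/-- the contraction estimate -/
lemma contr (hp : 1 < p) (hac : a < c) (I : Ini A φ) (hM : 0 ≤ M) (hδ : 0 < δ) (s0 : ℝ) :
    ∃ κ, 0 ≤ κ ∧ ∀ (h D : ℝ) (w v w' v' : ℝ → ℝ), 0 < h → h ≤ 1 → 0 ≤ D →
      Adm a (c + 1) M w → Adm a (c + 1) M v → Adm a (c + 1) M w' → Adm a (c + 1) M v' →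
      (∀ τ < c, w τ = w' τ) → (∀ τ < c, v τ = v' τ) → (∀ τ, |w τ - w' τ| ≤ D) →
      (∀ τ, |v τ - v' τ| ≤ D) → (∀ τ ∈ Icc a (c + h), δ ≤ cur a s0 v τ ∧ δ ≤ cur a s0 v' τ) →
      ∀ t ∈ Icc c (c + h), |OW p a s0 φ w v t - OW p a s0 φ w' v' t| ≤ κ * (D * h ^ (1/4 : ℝ)) ∧
        |OV p a s0 φ w v t - OV p a s0 φ w' v' t| ≤ κ * (D * h ^ (1/4 : ℝ)) := by
  have hMp : 0 ≤ M ^ p := rpow_nonneg hM p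
  have hpM : 0 ≤ p * M ^ (p - 1) := mul_nonneg (by linarith) (rpow_nonneg hM _)
  set E := c + 1 - a with hE
  set Y := 2 * (|s0| + M * E) with hY
  have hY0 : 0 ≤ |s0| + M * E := add_nonneg (abs_nonneg _) (mul_nonneg hM (by linarith))
  have c0p := c0_pos.le
  obtain ⟨C1, hC1, H1⟩ := far_term (M := M) (Y := Y) hδ G_ker G1_ker G_dy
    (fun y r hr => G_nonpos y hr) hac hM 1 zero_le_one
  obtain ⟨C2, hC2, H2⟩ := far_term (M := M ^ p) (Y := Y) hδ G1_ker G2_ker G1_dy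
    (fun y r hr => G1_nonpos y hr) hac hMp (p * M ^ (p - 1)) hpM
  obtain ⟨C3, hC3, H3⟩ := far_term (M := M) (Y := Y) hδ G1_ker G2_ker G1_dy
    (fun y r hr => G1_nonpos y hr) hac hM 1 zero_le_one
  obtain ⟨C4, hC4, H4⟩ := ini_term I hac Y
  set C5 := (p * M ^ (p - 1) * c0 + M ^ p * 0) * JJ E with hC5d
  set C6 := (1 * (c0 * M) + M * (4 * c0)) * JJ E with hC6d
  have hC5 : 0 ≤ C5 := mul_nonneg (by positivity) (JJ_nonneg _)
  have hC6 : 0 ≤ C6 := mul_nonneg (by positivity) (JJ_nonneg _)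
  refine ⟨2 * C5 + 2 * C1 + 2 * (C4 + 2 * C2 + C6 + C3), by positivity, ?_⟩
  intro h D w v w' v' hh hh1 hD W V W' V' hw hv hwd hvd hcur t ht
  set σ := cur a s0 v with hσ
  set σ' := cur a s0 v' with hσ'
  have hat : a < t := hac.trans_le ht.1
  have hvd1 : ∀ τ, |v τ - v' τ| ≤ 1 * D := fun τ => by rw [one_mul]; exact hvd τ
  have hfd : ∀ τ, |psi p (w τ) - psi p (w' τ)| ≤ p * M ^ (p - 1) * D := fun τ =>
    (psi_lip hp (W.fb τ) (W'.fb τ)).trans (mul_le_mul_of_nonneg_left (hwd τ) hpM)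
  have hfe : ∀ τ < c, psi p (w τ) = psi p (w' τ) := fun τ hτ => by rw [hw τ hτ]
  have hsub : ∀ {r}, r ∈ Ioo 0 (t - a) → t - r ∈ Icc a (c + h) := fun hr =>
    ⟨by linarith [hr.2], by linarith [hr.1, ht.2]⟩
  have htm : t ∈ Icc a (c + h) := ⟨hat.le, ht.2⟩
  have hdif : ∀ τ ∈ Icc a (c + h), |σ τ - σ' τ| ≤ D * h := fun τ hτ =>
    V.cur_diff V' hac hD hh.le hv hvd hτ.1 hτ.2
  have hup : ∀ τ ∈ Icc a (c + h), |σ τ| ≤ |s0| + M * E ∧ |σ' τ| ≤ |s0| + M * E := fun τ hτ =>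
    ⟨V.cur_bd hτ.1 (by linarith [hτ.2]), V'.cur_bd hτ.1 (by linarith [hτ.2])⟩
  have hDh : 0 ≤ D * h := by positivity
  have hcm : ∀ {z : ℝ → ℝ}, Adm a (c + 1) M z → Measurable fun r => cur a s0 z (t - r) := fun L =>
    (L.lay L.cur_lip).sc.measurable.comp (measurable_const.sub measurable_id)
  have hq := h_quarter hh hh1
  set X := D * h ^ (1/4 : ℝ) with hX
  have hDX : D * h ≤ X := mul_le_mul_of_nonneg_left hq hD
  have mem1 : ∀ τ ∈ Icc a (c + h), σ τ ∈ Icc δ Y ∧ σ' τ ∈ Icc δ Y ∧ |σ τ - σ' τ| ≤ 2 * (D * h) := by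
    intro τ hτ
    have e1 := hup τ hτ
    have e2 := le_abs_self (σ τ)
    have e3 := le_abs_self (σ' τ)
    exact ⟨⟨(hcur τ hτ).1, by linarith⟩, ⟨(hcur τ hτ).2, by linarith⟩, by linarith [hdif τ hτ]⟩
  constructor
  · have T1 : |(∫ r, psi p (w (t - r)) * G 0 r) - ∫ r, psi p (w' (t - r)) * G 0 r| ≤ C5 * X :=
      lay_term (y := fun _ => 0) (y' := fun _ => 0) G_ker (fun y r hr => G_nonpos y hr)
        (W.psi hp) (W'.psi hp) hh hh1 hD ht hpM c0p le_rfl hfe hfd measurable_const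
        measurable_const (fun r hr => inv_sqrt_eq hr.1 ▸ G_le 0 hr.1)
        (fun r hr => inv_sqrt_eq hr.1 ▸ G_le 0 hr.1) (fun r hr => by simp)
    have T2 : |(∫ r, v (t - r) * G (σ (t - r)) r) - ∫ r, v' (t - r) * G (σ' (t - r)) r| ≤ C1 * X :=
      H1 h D t v v' _ _ hh hh1 hD ht V V' hv hvd1 (hcm V) (hcm V') fun r hr => mem1 _ (hsub hr)
    unfold OW U
    simp only [layer_shift, zero_sub, neg_neg, G_neg, neg_zero]
    have hX0 : 0 ≤ X := hDh.trans hDX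
    have p1 : 0 ≤ C2 * X := by positivity
    have p2 : 0 ≤ C3 * X := by positivity
    have p3 : 0 ≤ C4 * X := by positivity
    have p4 : 0 ≤ C6 * X := by positivity
    clear_value C5 C6 X
    rw [abs_le] at T1 T2 ⊢
    constructor <;> linarith
  · have mem3 : ∀ r ∈ Ioo 0 (t - a), σ t + σ (t - r) ∈ Icc δ Y ∧ σ' t + σ' (t - r) ∈ Icc δ Y ∧
        |(σ t + σ (t - r)) - (σ' t + σ' (t - r))| ≤ 2 * (D * h) := by
      intro r hr
      have e1 := hup _ (hsub hr)
      have e2 := le_abs_self (σ (t - r))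
      have e3 := le_abs_self (σ' (t - r))
      have e1' := hup _ htm
      have e2' := le_abs_self (σ t)
      have e3' := le_abs_self (σ' t)
      have e4 := hcur _ (hsub hr)
      have e5 := hcur _ htm
      refine ⟨⟨by linarith, by linarith⟩, ⟨by linarith, by linarith⟩, ?_⟩
      rw [add_sub_add_comm]
      refine (abs_add_le _ _).trans ?_
      linarith [hdif _ (hsub hr), hdif _ htm]
    have om : ∀ {z : ℝ → ℝ}, Adm a (c + 1) M z → ∀ r ∈ Ioo 0 (t - a),
        |G1 (cur a s0 z t - cur a s0 z (t - r)) r| ≤ c0 * M * r ^ (-(1/2) : ℝ) := fun L r hr =>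
      inv_sqrt_eq hr.1 ▸ G1_lip hr.1 ((L.lay L.cur_lip).om t hr.1)
    have T1 : |(∫ r, psi p (w (t - r)) * G1 (σ t) r) - ∫ r, psi p (w' (t - r)) * G1 (σ' t) r| ≤ C2 * X :=
      H2 h D t _ _ _ _ hh hh1 hD ht (W.psi hp) (W'.psi hp) hfe hfd measurable_const measurable_const
        fun r hr => mem1 _ htm
    have T2 : |(∫ r, v (t - r) * G1 (σ t - σ (t - r)) r) -
        ∫ r, v' (t - r) * G1 (σ' t - σ' (t - r)) r| ≤ C6 * X :=
      lay_term G1_ker (fun y r hr => G1_nonpos y hr) V V' hh hh1 hD ht zero_le_one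
        (by positivity) (by positivity) hv hvd1 (measurable_const.sub (hcm V))
        (measurable_const.sub (hcm V')) (om V) (om V') fun r hr => by
          refine G1_close hh hr.1 hD (V.om_diff V' hvd t r hr.1) ?_
          rw [sub_sub_sub_comm]
          refine (abs_sub _ _).trans ?_
          linarith [hdif _ (hsub hr), hdif _ htm]
    have T3 : |(∫ r, v (t - r) * G1 (σ t + σ (t - r)) r) -
        ∫ r, v' (t - r) * G1 (σ' t + σ' (t - r)) r| ≤ C3 * X :=
      H3 h D t v v' _ _ hh hh1 hD ht V V' hv hvd1 (measurable_const.add (hcm V))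
        (measurable_const.add (hcm V')) mem3
    have T4 := (H4 t (σ t) (σ' t) ht.1 (by linarith [(hup t htm).1]) (by linarith [(hup t htm).2])).trans
      (mul_le_mul_of_nonneg_left ((hdif t htm).trans hDX) hC4)
    have hX0 : 0 ≤ X := hDh.trans hDX
    have p1 : 0 ≤ C5 * X := by positivity
    have p2 : 0 ≤ C1 * X := by positivity
    unfold OV UK
    simp only [layer_shift, sub_zero, sub_neg_eq_add]
    clear_value C5 C6 X
    rw [abs_le] at T1 T2 T3 T4 ⊢
    constructor <;> linarith
end
end

noncomputable section

def ex (a c : ℝ) (g e : ℝ → ℝ) (τ : ℝ) : ℝ :=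
  if τ ≤ a then 0 else if τ < c then g τ else if τ < c + 1 then e τ else 0

section
variable {p a c M s0 A : ℝ} {φ g e e' g1 g2 : ℝ → ℝ}

lemma ex_mid {τ : ℝ} (h : τ ∈ Ioo a c) : ex a c g e τ = g τ := by
  unfold ex; rw [if_neg (not_le.2 h.1), if_pos h.2]

lemma ex_hi (hac : a < c) {τ : ℝ} (h : τ ∈ Ico c (c + 1)) : ex a c g e τ = e τ := by
  unfold ex; rw [if_neg (by linarith [h.1] : ¬ τ ≤ a), if_neg (not_lt.2 h.1), if_pos h.2]

lemma ex_lo {τ : ℝ} (h : τ ≤ a) : ex a c g e τ = 0 := by unfold ex; rw [if_pos h]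

lemma ex_top (hac : a < c) {τ : ℝ} (h : c + 1 ≤ τ) : ex a c g e τ = 0 := by
  unfold ex
  rw [if_neg (by linarith : ¬ τ ≤ a), if_neg (by linarith : ¬ τ < c), if_neg (not_lt.2 h)]

lemma ex_agree (a : ℝ) (g e e' : ℝ → ℝ) : ∀ τ < c, ex a c g e τ = ex a c g e' τ := by
  intro τ h; unfold ex; simp only [if_pos h]

lemma ex_diff {D : ℝ} (hD : 0 ≤ D) (h : ∀ τ, |e τ - e' τ| ≤ D) (τ : ℝ) :
    |ex a c g e τ - ex a c g e' τ| ≤ D := by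
  unfold ex; split_ifs <;> simp [hD, h]

lemma ex_adm (hac : a < c) (hg : ContinuousOn g (Ioo a c)) (hgM : ∀ τ ∈ Ioo a c, |g τ| ≤ M)
    (he : Continuous e) (heM : ∀ τ, |e τ| ≤ M) : Adm a (c + 1) M (ex a c g e) where
  fm := by
    have : ex a c g e = (Ioo a c).indicator g + (Ico c (c + 1)).indicator e := by
      funext τ
      simp only [Pi.add_apply, indicator, mem_Ioo, mem_Ico, ex]
      grind
    rw [this]
    refine Measurable.add ?_ (he.measurable.indicator measurableSet_Ico)
    classical
    rw [← piecewise_eq_indicator]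
    exact hg.measurable_piecewise continuousOn_const measurableSet_Ioo
  fb := by
    intro τ
    have hM : 0 ≤ M := (abs_nonneg _).trans (heM 0)
    unfold ex
    split_ifs with h1 h2 h3
    · simpa using hM
    · exact hgM τ ⟨not_le.1 h1, h2⟩
    · exact heM τ
    · simpa using hM
  fa := fun τ h => ex_lo h
  fB := fun τ h => ex_top hac h
  fd := by
    refine ⟨{a, c, c + 1}, (Set.toFinite _).countable, fun τ hτ => ?_⟩
    simp only [mem_insert_iff, mem_singleton_iff, not_or] at hτ
    obtain ⟨h1, h2, h3⟩ := hτ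
    rcases lt_or_gt_of_ne h1 with h1 | h1
    · refine (continuousAt_const (y := (0:ℝ))).congr ?_
      filter_upwards [Iio_mem_nhds h1] with x hx using (ex_lo (le_of_lt hx)).symm
    rcases lt_or_gt_of_ne h2 with h2 | h2
    · refine (hg.continuousAt (Ioo_mem_nhds h1 h2)).congr ?_
      filter_upwards [Ioo_mem_nhds h1 h2] with x hx using (ex_mid hx).symm
    rcases lt_or_gt_of_ne h3 with h3 | h3
    · refine he.continuousAt.congr ?_
      filter_upwards [Ioo_mem_nhds h2 h3] with x hx using (ex_hi hac ⟨hx.1.le, hx.2⟩).symm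
    · refine (continuousAt_const (y := (0:ℝ))).congr ?_
      filter_upwards [Ioi_mem_nhds h3] with x hx using (ex_top hac (le_of_lt hx)).symm

lemma cur_ge (hac : a < c) (V : Adm a (c + 1) M (ex a c g e)) (hg0 : ∀ τ ∈ Ioo a c, 0 ≤ g τ) {h : ℝ}
    {τ : ℝ} (hτ : τ ∈ Icc a (c + h)) (hh : 0 ≤ h) (hM : M * h ≤ s0 / 2) (hs : 0 < s0) :
    s0 / 2 ≤ cur a s0 (ex a c g e) τ := by
  have low : ∀ x ∈ Icc a c, s0 ≤ cur a s0 (ex a c g e) x := by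
    intro x hx
    unfold cur
    have : 0 ≤ ∫ y in a..x, ex a c g e y := by
      refine intervalIntegral.integral_nonneg_of_ae_restrict hx.1 ?_
      rw [EventuallyLE, ae_restrict_iff' measurableSet_Icc]
      filter_upwards [(countable_singleton c).ae_notMem volume] with y hy hy2
      rcases hy2.1.eq_or_lt with h1 | h1
      · rw [ex_lo h1.ge]; simp
      · have : y ∈ Ioo a c := ⟨h1, lt_of_le_of_ne (hy2.2.trans hx.2) hy⟩
        rw [ex_mid this]; exact hg0 y this
    linarith
  rcases le_total τ c with h1 | h1
  · linarith [low τ ⟨hτ.1, h1⟩]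
  · have e1 := low c ⟨hac.le, le_rfl⟩
    have e2 := V.cur_lip (s0 := s0) τ c
    rw [abs_of_nonneg (by linarith : 0 ≤ τ - c)] at e2
    have e3 := neg_abs_le (cur a s0 (ex a c g e) τ - cur a s0 (ex a c g e) c)
    have e4 : M * (τ - c) ≤ M * h := mul_le_mul_of_nonneg_left (by linarith [hτ.2]) V.M0
    linarith

lemma fixpt (hp : 1 < p) (hac : a < c) (I : Ini A φ) (hs : 0 < s0) {M0 : ℝ}
    (hg1 : ContinuousOn g1 (Ioo a c)) (hg2 : ContinuousOn g2 (Ioo a c))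
    (hb1 : ∀ τ ∈ Ioo a c, |g1 τ| ≤ M0) (hb2 : ∀ τ ∈ Ioo a c, |g2 τ| ≤ M0)
    (hg0 : ∀ τ ∈ Ioo a c, 0 ≤ g2 τ) :
    ∃ M b, c < b ∧ b < c + 1 ∧ ∃ w v : ℝ → ℝ, Adm a (c + 1) M w ∧ Adm a (c + 1) M v ∧
      (∀ τ ∈ Ioo a c, w τ = g1 τ ∧ v τ = g2 τ) ∧
      (∀ t ∈ Icc c b, w t = OW p a s0 φ w v t ∧ v t = OV p a s0 φ w v t) ∧
      ∀ t ∈ Icc a b, 0 < cur a s0 v t := by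
  set w0 := OW p a s0 φ (ex a c g1 fun _ => 0) (ex a c g2 fun _ => 0) with hw0
  set v0 := OV p a s0 φ (ex a c g1 fun _ => 0) (ex a c g2 fun _ => 0) with hv0
  set M := |M0| + |w0 c| + |v0 c| + 1 with hM
  have hM1 : 1 ≤ M := by
    have := abs_nonneg M0; have := abs_nonneg (w0 c); have := abs_nonneg (v0 c); linarith
  have hMM : ∀ x, |x| ≤ M0 → |x| ≤ M := fun x hx => by
    have := le_abs_self M0; have := abs_nonneg (w0 c); have := abs_nonneg (v0 c); linarith
  have ad1 : ∀ e : ℝ → ℝ, Continuous e → (∀ τ, |e τ| ≤ M) → Adm a (c + 1) M (ex a c g1 e) :=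
    fun e he hM => ex_adm hac hg1 (fun τ hτ => hMM _ (hb1 τ hτ)) he hM
  have ad2 : ∀ e : ℝ → ℝ, Continuous e → (∀ τ, |e τ| ≤ M) → Adm a (c + 1) M (ex a c g2 e) :=
    fun e he hM => ex_adm hac hg2 (fun τ hτ => hMM _ (hb2 τ hτ)) he hM
  have cW : ∀ w v, Adm a (c + 1) M w → Adm a (c + 1) M v → Continuous (OW p a s0 φ w v) :=
    fun w v W V => (Adm.dat hp I W V).cont.comp (continuous_id.prodMk continuous_const)
  have cV : ∀ w v, Adm a (c + 1) M w → Adm a (c + 1) M v → ∀ t, a < t → 0 < cur a s0 v t →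
      ContinuousAt (OV p a s0 φ w v) t := fun w v W V t ht hs =>
    continuousAt_const.mul ((Adm.dat hp I W V).curve ht hs)
  have z0 : ∀ τ : ℝ, |(fun _ => (0:ℝ)) τ| ≤ M := fun _ => by simp; linarith
  have Z1 := ad1 _ continuous_const z0
  have Z2 := ad2 _ continuous_const z0
  obtain ⟨κ, hκ, H⟩ := contr hp hac I (by linarith : 0 ≤ M) (half_pos hs) s0
  -- choice of the step
  have hh : ∃ h, 0 < h ∧ h < 1 ∧ M * h ≤ s0 / 2 ∧ κ * (M * h ^ (1/4 : ℝ)) ≤ 1 / 2 ∧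
      ∀ t ∈ Icc c (c + h), |w0 t - w0 c| ≤ 1 / 2 ∧ |v0 t - v0 c| ≤ 1 / 2 := by
    have k1 : Tendsto (fun h : ℝ => M * h) (𝓝[>] 0) (𝓝 0) := by
      have : Continuous fun h : ℝ => M * h := by fun_prop
      simpa using this.continuousAt.tendsto.mono_left (nhdsWithin_le_nhds (a := (0:ℝ)) (s := Ioi 0))
    have k2 : Tendsto (fun h : ℝ => κ * (M * h ^ (1/4 : ℝ))) (𝓝[>] 0) (𝓝 0) := by
      have : Continuous fun h : ℝ => κ * (M * h ^ (1/4 : ℝ)) :=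
        continuous_const.mul (continuous_const.mul
          (continuous_id.rpow_const fun _ => Or.inr (by norm_num)))
      have h := this.continuousAt.tendsto.mono_left (nhdsWithin_le_nhds (a := (0:ℝ)) (s := Ioi 0))
      rwa [zero_rpow (by norm_num), mul_zero, mul_zero] at h
    have hpos : 0 < cur a s0 (ex a c g2 fun _ => 0) c := by
      have := cur_ge (h := 0) (s0 := s0) hac Z2 hg0 (τ := c) ⟨hac.le, by simp⟩ le_rfl
        (by simp; linarith) hs
      linarith
    obtain ⟨ε1, he1, q1⟩ := Metric.continuousAt_iff.1 (cW _ _ Z1 Z2).continuousAt (1/2) (by norm_num)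
    obtain ⟨ε2, he2, q2⟩ := Metric.continuousAt_iff.1 (cV _ _ Z1 Z2 c hac hpos) (1/2) (by norm_num)
    have ev : ∀ᶠ h : ℝ in 𝓝[>] 0, h ∈ Ioo 0 (min 1 (min ε1 ε2)) :=
      Ioo_mem_nhdsGT (by positivity)
    obtain ⟨h, ⟨h0, hm⟩, h2, h3⟩ := (ev.and ((k1.eventually (gt_mem_nhds (half_pos hs))).and
      (k2.eventually (gt_mem_nhds (by norm_num : (0:ℝ) < 1/2))))).exists
    rw [lt_min_iff, lt_min_iff] at hm
    refine ⟨h, h0, hm.1, h2.le, h3.le, fun t ht => ?_⟩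
    have hd : dist t c = t - c := by rw [Real.dist_eq, abs_of_nonneg (by linarith [ht.1])]
    exact ⟨(q1 (by rw [hd]; linarith [ht.2, hm.2.1])).le, (q2 (by rw [hd]; linarith [ht.2, hm.2.2])).le⟩
  obtain ⟨h, h0, h1, hMh, hκh, hnear⟩ := hh
  have hκ1 : κ * h ^ (1/4 : ℝ) ≤ 1 / 2 := by
    have : 0 ≤ κ * h ^ (1/4 : ℝ) := mul_nonneg hκ (rpow_nonneg h0.le _)
    nlinarith
  set cl : ℝ → ℝ := fun t => max c (min t (c + h)) with hcl
  have clc : Continuous cl := by fun_prop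
  have clm : ∀ t, cl t ∈ Icc c (c + h) := fun t =>
    ⟨le_max_left _ _, max_le (by linarith) (min_le_right _ _)⟩
  set S : Set (BoundedContinuousFunction ℝ (ℝ × ℝ)) :=
    Metric.closedBall (BoundedContinuousFunction.const ℝ (w0 c, v0 c)) 1 with hS
  have hSc : CompleteSpace S := Metric.isClosed_closedBall.completeSpace_coe
  have hSn : Nonempty S := ⟨⟨_, Metric.mem_closedBall_self zero_le_one⟩⟩
  have hSb : ∀ e : S, (∀ τ, |(e.1 τ).1| ≤ M) ∧ ∀ τ, |(e.1 τ).2| ≤ M := by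
    intro e
    have hd : ∀ τ, |(e.1 τ).1 - w0 c| ≤ 1 ∧ |(e.1 τ).2 - v0 c| ≤ 1 := fun τ => by
      have := (BoundedContinuousFunction.dist_coe_le_dist τ).trans (Metric.mem_closedBall.1 e.2)
      rw [Prod.dist_eq] at this
      exact ⟨(le_max_left _ _).trans this, (le_max_right _ _).trans this⟩
    have a0 := abs_nonneg M0
    have a1 := abs_nonneg (w0 c)
    have a2 := abs_nonneg (v0 c)
    exact ⟨fun τ => by
        have := abs_sub_abs_le_abs_sub (e.1 τ).1 (w0 c); linarith [(hd τ).1], fun τ => by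
        have := abs_sub_abs_le_abs_sub (e.1 τ).2 (v0 c); linarith [(hd τ).2]⟩
  set wf : S → ℝ → ℝ := fun e => ex a c g1 fun τ => (e.1 τ).1 with hwf
  set vf : S → ℝ → ℝ := fun e => ex a c g2 fun τ => (e.1 τ).2 with hvf
  have Wf : ∀ e, Adm a (c + 1) M (wf e) := fun e =>
    ad1 _ (continuous_fst.comp e.1.continuous) (hSb e).1
  have Vf : ∀ e, Adm a (c + 1) M (vf e) := fun e =>
    ad2 _ (continuous_snd.comp e.1.continuous) (hSb e).2
  have hge : ∀ e : ℝ → ℝ, Adm a (c + 1) M (ex a c g2 e) → ∀ τ ∈ Icc a (c + h),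
      s0 / 2 ≤ cur a s0 (ex a c g2 e) τ := fun e V τ hτ => cur_ge hac V hg0 hτ h0.le hMh hs
  have hball : ∀ e t, dist (OW p a s0 φ (wf e) (vf e) (cl t), OV p a s0 φ (wf e) (vf e) (cl t))
      (w0 c, v0 c) ≤ 1 := by
    intro e t
    have h3 := H h M (wf e) (vf e) _ _ h0 h1.le (by linarith) (Wf e) (Vf e) Z1 Z2
      (ex_agree a g1 _ _) (ex_agree a g2 _ _)
      (ex_diff (by linarith) fun τ => by simpa using (hSb e).1 τ)
      (ex_diff (by linarith) fun τ => by simpa using (hSb e).2 τ)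
      (fun τ hτ => ⟨hge _ (Vf e) τ hτ, hge _ Z2 τ hτ⟩) (cl t) (clm t)
    have h4 := hnear _ (clm t)
    rw [Prod.dist_eq, Real.dist_eq, Real.dist_eq]
    exact max_le
      ((abs_sub_le _ (w0 (cl t)) _).trans (by linarith [h3.1.trans hκh, h4.1]))
      ((abs_sub_le _ (v0 (cl t)) _).trans (by linarith [h3.2.trans hκh, h4.2]))
  have hΦ : ∀ e : S, ∃ e' : S, ∀ t, e'.1 t =
      (OW p a s0 φ (wf e) (vf e) (cl t), OV p a s0 φ (wf e) (vf e) (cl t)) := by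
    intro e
    have hc : Continuous fun t =>
        (OW p a s0 φ (wf e) (vf e) (cl t), OV p a s0 φ (wf e) (vf e) (cl t)) := by
      refine ((cW _ _ (Wf e) (Vf e)).comp clc).prodMk (continuous_iff_continuousAt.2 fun t => ?_)
      have hp0 := hge _ (Vf e) (cl t) ⟨hac.le.trans (clm t).1, (clm t).2⟩
      exact ContinuousAt.comp (f := cl) (cV _ _ (Wf e) (Vf e) (cl t) (hac.trans_le (clm t).1)
        (by linarith)) clc.continuousAt
    refine ⟨⟨BoundedContinuousFunction.mkOfBound ⟨_, hc⟩ 2 fun x y => ?_, ?_⟩, fun t => rfl⟩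
    · have := dist_triangle_right (OW p a s0 φ (wf e) (vf e) (cl x), OV p a s0 φ (wf e) (vf e) (cl x))
        (OW p a s0 φ (wf e) (vf e) (cl y), OV p a s0 φ (wf e) (vf e) (cl y)) (w0 c, v0 c)
      exact this.trans (by linarith [hball e x, hball e y])
    · exact (BoundedContinuousFunction.dist_le zero_le_one).2 fun t => hball e t
  choose Φ hΦ using hΦ
  have hcon : ContractingWith (1/2) Φ := by
    refine ⟨by rw [← NNReal.coe_lt_coe]; norm_num, LipschitzWith.of_dist_le_mul fun e e' => ?_⟩
    rw [Subtype.dist_eq, Subtype.dist_eq]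
    refine (BoundedContinuousFunction.dist_le (by positivity)).2 fun t => ?_
    rw [hΦ, hΦ]
    have hd : ∀ τ, |(e.1 τ).1 - (e'.1 τ).1| ≤ dist e.1 e'.1 ∧
        |(e.1 τ).2 - (e'.1 τ).2| ≤ dist e.1 e'.1 := fun τ => by
      have := BoundedContinuousFunction.dist_coe_le_dist (f := e.1) (g := e'.1) τ
      rw [Prod.dist_eq] at this
      exact ⟨(le_max_left _ _).trans this, (le_max_right _ _).trans this⟩
    have h3 := H h (dist e.1 e'.1) (wf e) (vf e) (wf e') (vf e') h0 h1.le dist_nonneg (Wf e) (Vf e)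
      (Wf e') (Vf e') (ex_agree a g1 _ _) (ex_agree a g2 _ _)
      (ex_diff dist_nonneg fun τ => (hd τ).1) (ex_diff dist_nonneg fun τ => (hd τ).2)
      (fun τ hτ => ⟨hge _ (Vf e) τ hτ, hge _ (Vf e') τ hτ⟩) (cl t) (clm t)
    have h5 : κ * (dist e.1 e'.1 * h ^ (1/4 : ℝ)) ≤ (1/2) * dist e.1 e'.1 := by
      calc κ * (dist e.1 e'.1 * h ^ (1/4 : ℝ)) = (κ * h ^ (1/4 : ℝ)) * dist e.1 e'.1 := by ring
        _ ≤ _ := mul_le_mul_of_nonneg_right hκ1 dist_nonneg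
    rw [Prod.dist_eq, Real.dist_eq, Real.dist_eq]
    have h6 : ((1/2 : NNReal) : ℝ) = 1/2 := by norm_num
    rw [h6]
    exact max_le (h3.1.trans h5) (h3.2.trans h5)
  obtain ⟨e, he⟩ : ∃ e, Φ e = e := ⟨_, hcon.fixedPoint_isFixedPt⟩
  refine ⟨M, c + h, by linarith, by linarith, wf e, vf e, Wf e, Vf e,
    fun τ hτ => ⟨ex_mid hτ, ex_mid hτ⟩, fun t ht => ?_, fun t ht => ?_⟩
  · have h7 := hΦ e t
    have h8 : cl t = t := by rw [hcl]; simp only; rw [min_eq_left ht.2, max_eq_right ht.1]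
    rw [he, h8] at h7
    have ht' : t ∈ Ico c (c + 1) := ⟨ht.1, by linarith [ht.2]⟩
    have h9 : wf e t = (e.1 t).1 := ex_hi hac ht'
    have h10 : vf e t = (e.1 t).2 := ex_hi hac ht'
    rw [h9, h10, h7]
    exact ⟨rfl, rfl⟩
  · linarith [hge _ (Vf e) t ht]
end
end

noncomputable section

/-- the equations and regularity over a set of times -/
structure Reg (J : Set ℝ) (p : ℝ) (s : ℝ → ℝ) (u : ℝ → ℝ → ℝ) : Prop where
  sd : ∀ t ∈ J, DifferentiableAt ℝ s t
  sdc : ∀ t ∈ J, ContinuousAt (deriv s) t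
  sp : ∀ t ∈ J, 0 < s t
  utd : ∀ t ∈ J, ∀ x ∈ Ioo 0 (s t), DifferentiableAt ℝ (fun τ => u τ x) t
  uxd : ∀ t ∈ J, ∀ x ∈ Ioo 0 (s t), DifferentiableAt ℝ (u t) x
  uxxd : ∀ t ∈ J, ∀ x ∈ Ioo 0 (s t), DifferentiableAt ℝ (deriv (u t)) x
  utc : ContinuousOn (fun q : ℝ × ℝ => deriv (fun τ => u τ q.2) q.1)
      {q : ℝ × ℝ | q.1 ∈ J ∧ q.2 ∈ Ioo 0 (s q.1)}
  uxxc : ContinuousOn (fun q : ℝ × ℝ => deriv (deriv (u q.1)) q.2)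
      {q : ℝ × ℝ | q.1 ∈ J ∧ q.2 ∈ Ioo 0 (s q.1)}
  uxc : ContinuousOn (fun q : ℝ × ℝ => deriv (u q.1) q.2)
      {q : ℝ × ℝ | q.1 ∈ J ∧ q.2 ∈ Icc 0 (s q.1)}
  uc : ContinuousOn (fun q : ℝ × ℝ => u q.1 q.2) {q : ℝ × ℝ | q.1 ∈ J ∧ q.2 ∈ Icc 0 (s q.1)}
  un : ∀ t ∈ J, ∀ x ∈ Icc 0 (s t), 0 ≤ u t x
  heat : ∀ t ∈ J, ∀ x ∈ Ioo 0 (s t), deriv (fun τ => u τ x) t = deriv (deriv (u t)) x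
  b0 : ∀ t ∈ J, -deriv (u t) 0 = u t 0 ^ p
  bf : ∀ t ∈ J, u t (s t) = 0
  st : ∀ t ∈ J, deriv s t = -deriv (u t) (s t)

section
variable {p c b : ℝ} {s s' : ℝ → ℝ} {u u' : ℝ → ℝ → ℝ} {J J' : Set ℝ}

lemma co_union {f : ℝ × ℝ → ℝ} {P : ℝ × ℝ → Prop} (hJ : IsOpen J) (hJ' : IsOpen J')
    (h1 : ContinuousOn f {q | q.1 ∈ J ∧ P q}) (h2 : ContinuousOn f {q | q.1 ∈ J' ∧ P q}) :
    ContinuousOn f {q | q.1 ∈ J ∪ J' ∧ P q} := by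
  have key : ∀ L : Set ℝ, IsOpen L → ContinuousOn f {q | q.1 ∈ L ∧ P q} →
      ∀ q : ℝ × ℝ, q.1 ∈ L → P q → ContinuousWithinAt f {q | q.1 ∈ J ∪ J' ∧ P q} q := by
    intro L hL h q hq hP
    refine (h q ⟨hq, hP⟩).mono_of_mem_nhdsWithin ?_
    filter_upwards [self_mem_nhdsWithin, mem_nhdsWithin_of_mem_nhds
      (continuousAt_fst.preimage_mem_nhds (hL.mem_nhds hq))] with z hz hz2
    exact ⟨hz2, hz.2⟩
  rintro q ⟨hq | hq, hP⟩
  · exact key J hJ h1 q hq hP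
  · exact key J' hJ' h2 q hq hP

lemma Reg.union (hJ : IsOpen J) (hJ' : IsOpen J') (R : Reg J p s u) (R' : Reg J' p s u) :
    Reg (J ∪ J') p s u where
  sd := fun t ht => ht.elim (R.sd t) (R'.sd t)
  sdc := fun t ht => ht.elim (R.sdc t) (R'.sdc t)
  sp := fun t ht => ht.elim (R.sp t) (R'.sp t)
  utd := fun t ht => ht.elim (R.utd t) (R'.utd t)
  uxd := fun t ht => ht.elim (R.uxd t) (R'.uxd t)
  uxxd := fun t ht => ht.elim (R.uxxd t) (R'.uxxd t)
  utc := co_union hJ hJ' R.utc R'.utc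
  uxxc := co_union hJ hJ' R.uxxc R'.uxxc
  uxc := co_union hJ hJ' R.uxc R'.uxc
  uc := co_union hJ hJ' R.uc R'.uc
  un := fun t ht => ht.elim (R.un t) (R'.un t)
  heat := fun t ht => ht.elim (R.heat t) (R'.heat t)
  b0 := fun t ht => ht.elim (R.b0 t) (R'.b0 t)
  bf := fun t ht => ht.elim (R.bf t) (R'.bf t)
  st := fun t ht => ht.elim (R.st t) (R'.st t)

lemma Reg.congr (hJ : IsOpen J) (R : Reg J p s u) (hs : ∀ t ∈ J, s' t = s t)
    (hu : ∀ t ∈ J, u' t = u t) : Reg J p s' u' := by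
  have es : ∀ t ∈ J, s' =ᶠ[𝓝 t] s := fun t ht => by
    filter_upwards [hJ.mem_nhds ht] with τ hτ using hs τ hτ
  have eu : ∀ t ∈ J, ∀ x, (fun τ => u' τ x) =ᶠ[𝓝 t] fun τ => u τ x := fun t ht x => by
    filter_upwards [hJ.mem_nhds ht] with τ hτ; rw [hu τ hτ]
  have S1 : {q : ℝ × ℝ | q.1 ∈ J ∧ q.2 ∈ Ioo 0 (s' q.1)} = {q | q.1 ∈ J ∧ q.2 ∈ Ioo 0 (s q.1)} := by
    ext q; exact and_congr_right fun h => by rw [hs _ h]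
  have S2 : {q : ℝ × ℝ | q.1 ∈ J ∧ q.2 ∈ Icc 0 (s' q.1)} = {q | q.1 ∈ J ∧ q.2 ∈ Icc 0 (s q.1)} := by
    ext q; exact and_congr_right fun h => by rw [hs _ h]
  have ed : ∀ t ∈ J, deriv s' t = deriv s t := fun t ht => (es t ht).deriv_eq
  refine ⟨?_, ?_, ?_, ?_, ?_, ?_, ?_, ?_, ?_, ?_, ?_, ?_, ?_, ?_, ?_⟩
  · exact fun t ht => (R.sd t ht).congr_of_eventuallyEq (es t ht)
  · exact fun t ht => (R.sdc t ht).congr (es t ht).deriv.symm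
  · exact fun t ht => by rw [hs t ht]; exact R.sp t ht
  · exact fun t ht x hx => (R.utd t ht x (hs t ht ▸ hx)).congr_of_eventuallyEq (eu t ht x)
  · exact fun t ht x hx => by rw [hu t ht]; exact R.uxd t ht x (hs t ht ▸ hx)
  · exact fun t ht x hx => by rw [hu t ht]; exact R.uxxd t ht x (hs t ht ▸ hx)
  · rw [S1]; exact R.utc.congr fun q hq => (eu q.1 hq.1 q.2).deriv_eq
  · rw [S1]; exact R.uxxc.congr fun q hq => by simp only [hu q.1 hq.1]
  · rw [S2]; exact R.uxc.congr fun q hq => by simp only [hu q.1 hq.1]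
  · rw [S2]; exact R.uc.congr fun q hq => by simp only [hu q.1 hq.1]
  · exact fun t ht x hx => by rw [hu t ht]; exact R.un t ht x (hs t ht ▸ hx)
  · exact fun t ht x hx => by
      rw [hu t ht, (eu t ht x).deriv_eq]; exact R.heat t ht x (hs t ht ▸ hx)
  · exact fun t ht => by rw [hu t ht]; exact R.b0 t ht
  · exact fun t ht => by rw [hu t ht, hs t ht]; exact R.bf t ht
  · exact fun t ht => by rw [ed t ht, hu t ht, hs t ht]; exact R.st t ht

lemma Reg.of_sol {s₀ : ℝ} {φ : ℝ → ℝ} (H : ∀ T, 0 < T → T < c → IsSolOn p s₀ φ T s u) :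
    Reg (Ioo 0 c) p s u := by
  have key : ∀ t ∈ Ioo 0 c, IsSolOn p s₀ φ t s u := fun t ht => H t ht.1 ht.2
  have mm : ∀ t ∈ Ioo 0 c, t ∈ Ioc 0 t := fun t ht => ⟨ht.1, le_rfl⟩
  have mm' : ∀ t ∈ Ioo 0 c, t ∈ Icc 0 t := fun t ht => ⟨ht.1.le, le_rfl⟩
  refine ⟨fun t ht => (key t ht).s_diff t (mm t ht),
    fun t ht => (Old.of_sol H).vc.continuousAt (Ioo_mem_nhds ht.1 ht.2),
    fun t ht => (key t ht).s_pos t (mm' t ht), fun t ht => (key t ht).ut_diff t (mm t ht),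
    fun t ht => (key t ht).ux_diff t (mm t ht), fun t ht => (key t ht).uxx_diff t (mm t ht),
    ?_, ?_, (Old.of_sol H).uxc, (Old.of_sol H).uc,
    fun t ht => (key t ht).u_nonneg t (mm' t ht), fun t ht => (key t ht).heat t (mm t ht),
    fun t ht => (key t ht).bc_zero t (mm t ht), fun t ht => (key t ht).bc_free t (mm t ht),
    fun t ht => (key t ht).stefan t (mm t ht)⟩
  · exact contOn_glue (g := fun q : ℝ × ℝ => q.1) (P := fun q : ℝ × ℝ => q.2 ∈ Ioo 0 (s q.1))
      continuous_fst fun T h0 hT => (H T h0 hT).ut_cont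
  · exact contOn_glue (g := fun q : ℝ × ℝ => q.1) (P := fun q : ℝ × ℝ => q.2 ∈ Ioo 0 (s q.1))
      continuous_fst fun T h0 hT => (H T h0 hT).uxx_cont

lemma Reg.sol {s₀ T : ℝ} {φ : ℝ → ℝ} (R : Reg (Ioo 0 b) p s' u') (hT0 : 0 < T) (hTb : T < b)
    (hc : 0 < c) (H : ∀ T, 0 < T → T < c → IsSolOn p s₀ φ T s u) (hs : ∀ t < c, s' t = s t)
    (hu : ∀ t < c, u' t = u t) : IsSolOn p s₀ φ T s' u' := by
  have sub : ∀ t ∈ Ioc 0 T, t ∈ Ioo 0 b := fun t ht => ⟨ht.1, ht.2.trans_lt hTb⟩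
  have K := H (c / 2) (by linarith) (by linarith)
  refine ⟨hT0, ?_, fun t ht => R.sd t (sub t ht),
    fun t ht => (R.sdc t (sub t ht)).continuousWithinAt, ?_, fun t ht => R.utd t (sub t ht),
    fun t ht => R.uxd t (sub t ht), fun t ht => R.uxxd t (sub t ht),
    R.utc.mono fun q hq => ⟨sub _ hq.1, hq.2⟩, R.uxxc.mono fun q hq => ⟨sub _ hq.1, hq.2⟩,
    R.uxc.mono fun q hq => ⟨sub _ hq.1, hq.2⟩, ?_, ?_, fun t ht => R.heat t (sub t ht),
    fun t ht => R.b0 t (sub t ht), fun t ht => R.bf t (sub t ht), fun t ht => R.st t (sub t ht),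
    fun x hx => by rw [hu 0 hc]; exact K.init x hx, by rw [hs 0 hc]; exact K.init_s⟩
  · intro t ht
    rcases ht.1.eq_or_lt with h | h
    · subst h
      have h1 : ContinuousWithinAt s' (Icc 0 (c / 2)) 0 :=
        (K.s_cont 0 ⟨le_rfl, by linarith⟩).congr (fun t ht => hs t (by linarith [ht.2])) (hs 0 hc)
      refine h1.mono_of_mem_nhdsWithin ?_
      filter_upwards [self_mem_nhdsWithin, mem_nhdsWithin_of_mem_nhds
        (Iio_mem_nhds (by linarith : 0 < c / 2))] with z hz hz2
      exact ⟨hz.1, le_of_lt hz2⟩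
    · exact (R.sd t (sub t ⟨h, ht.2⟩)).continuousAt.continuousWithinAt
  · intro t ht
    rcases ht.1.eq_or_lt with h | h
    · subst h; rw [hs 0 hc]; exact K.s_pos 0 ⟨le_rfl, by linarith⟩
    · exact R.sp t (sub t ⟨h, ht.2⟩)
  · rintro ⟨t, x⟩ ⟨ht, hx⟩
    rcases ht.1.eq_or_lt with h | h
    · simp only at h hx
      subst h
      have h1 : ContinuousWithinAt (fun q : ℝ × ℝ => u' q.1 q.2)
          {q : ℝ × ℝ | q.1 ∈ Icc 0 (c / 2) ∧ q.2 ∈ Icc 0 (s q.1)} (0, x) := by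
        refine (K.u_cont (0, x) ⟨⟨le_rfl, by simp; linarith⟩, by rw [← hs 0 hc]; exact hx⟩).congr
          (fun q hq => by rw [hu q.1 (by linarith [hq.1.2])]) (by simp only [hu 0 hc])
      refine h1.mono_of_mem_nhdsWithin ?_
      filter_upwards [self_mem_nhdsWithin, mem_nhdsWithin_of_mem_nhds
        (continuousAt_fst.preimage_mem_nhds (Iio_mem_nhds (by simp; linarith : ((0:ℝ), x).1 < c / 2)))]
        with z hz hz2
      have hz3 : z.1 < c / 2 := hz2
      exact ⟨⟨hz.1.1, hz3.le⟩, by rw [← hs z.1 (by linarith)]; exact hz.2⟩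
    · have hx' : x ∈ Icc 0 (s' t) := hx
      have ht' : t ∈ Ioc 0 T := ⟨h, ht.2⟩
      refine (R.uc (t, x) ⟨sub t ht', hx'⟩).mono_of_mem_nhdsWithin ?_
      filter_upwards [self_mem_nhdsWithin, mem_nhdsWithin_of_mem_nhds
        (continuousAt_fst.preimage_mem_nhds (Ioi_mem_nhds (by exact h : (0:ℝ) < (t, x).1)))]
        with z hz hz2
      exact ⟨sub _ ⟨hz2, hz.1.2⟩, hz.2⟩
  · intro t ht x hx
    rcases ht.1.eq_or_lt with h | h
    · subst h; rw [hu 0 hc]; rw [hs 0 hc] at hx; exact K.u_nonneg 0 ⟨le_rfl, by linarith⟩ x hx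
    · exact R.un t (sub t ⟨h, ht.2⟩) x hx
end
end

noncomputable section

section
variable {a b B M R A p : ℝ} {φ f v σ s : ℝ → ℝ} {u : ℝ → ℝ → ℝ}

lemma Dat.reg (D : Dat a B M R A φ f v σ) (hsp : ∀ t ∈ Ioo a b, 0 < σ t)
    (hσ : ∀ t ∈ Ioo a b, HasDerivAt σ (v t) t) (hv : ∀ t ∈ Ioo a b, ContinuousAt v t)
    (hf : ∀ t ∈ Ioo a b, ContinuousAt f t) (hfU : ∀ t ∈ Ioo a b, f t = U a φ f v σ t 0 ^ p)
    (heq : ∀ t ∈ Ioo a b, v t = -2 * UK G1 a φ f v σ t (σ t))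
    (hn : ∀ t ∈ Ioo a b, ∀ x ∈ Icc 0 (σ t), 0 ≤ U a φ f v σ t x)
    (hb : ∀ t ∈ Ioo a b, U a φ f v σ t (σ t) = 0)
    (hs : ∀ t ∈ Ioo a b, s t = σ t)
    (hu : ∀ t ∈ Ioo a b, ∀ x ∈ Icc 0 (σ t), u t x = U a φ f v σ t x)
    (h0 : ∀ t ∈ Ioo a b, deriv (u t) 0 = -f t)
    (h1 : ∀ t ∈ Ioo a b, deriv (u t) (σ t) = -v t) : Reg (Ioo a b) p s u := by
  have es : ∀ t ∈ Ioo a b, s =ᶠ[𝓝 t] σ := fun t ht => by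
    filter_upwards [Ioo_mem_nhds ht.1 ht.2] with τ hτ using hs τ hτ
  have hsd : ∀ t ∈ Ioo a b, HasDerivAt s (v t) t := fun t ht =>
    (hσ t ht).congr_of_eventuallyEq (es t ht)
  have hoff : ∀ t ∈ Ioo a b, ∀ x ∈ Ioo 0 (σ t), Off a σ t x := fun t ht x hx =>
    ⟨ht.1, hx.1.ne', hx.2.ne, by linarith [hx.1, hx.2] |> fun h : -σ t < x => h.ne'⟩
  have ex : ∀ t ∈ Ioo a b, ∀ x ∈ Ioo 0 (σ t), u t =ᶠ[𝓝 x] U a φ f v σ t := fun t ht x hx => by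
    filter_upwards [Ioo_mem_nhds hx.1 hx.2] with y hy using hu t ht y ⟨hy.1.le, hy.2.le⟩
  have dx : ∀ t ∈ Ioo a b, ∀ x ∈ Ioo 0 (σ t), HasDerivAt (u t) (UK G1 a φ f v σ t x) x :=
    fun t ht x hx => (D.Ux (hoff t ht x hx)).congr_of_eventuallyEq (ex t ht x hx)
  have dxx : ∀ t ∈ Ioo a b, ∀ x ∈ Ioo 0 (σ t),
      HasDerivAt (deriv (u t)) (UK G2 a φ f v σ t x) x := fun t ht x hx => by
    refine (D.Uxx (hoff t ht x hx)).congr_of_eventuallyEq ?_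
    filter_upwards [Ioo_mem_nhds hx.1 hx.2] with y hy using (dx t ht y hy).deriv
  have et : ∀ t ∈ Ioo a b, ∀ x ∈ Ioo 0 (σ t), (fun τ => u τ x) =ᶠ[𝓝 t] fun τ => U a φ f v σ τ x :=
    fun t ht x hx => by
      filter_upwards [Ioo_mem_nhds ht.1 ht.2, D.V.sc.continuousAt.eventually (lt_mem_nhds hx.2)]
        with τ h1 h2 using hu τ h1 x ⟨hx.1.le, h2.le⟩
  have dt : ∀ t ∈ Ioo a b, ∀ x ∈ Ioo 0 (σ t),
      HasDerivAt (fun τ => u τ x) (UK G2 a φ f v σ t x) t := fun t ht x hx =>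
    (D.Ut (hoff t ht x hx)).congr_of_eventuallyEq (et t ht x hx)
  have S1 : {q : ℝ × ℝ | q.1 ∈ Ioo a b ∧ q.2 ∈ Ioo 0 (s q.1)} =
      {q | q.1 ∈ Ioo a b ∧ q.2 ∈ Ioo 0 (σ q.1)} := by
    ext q; exact and_congr_right fun h => by rw [hs _ h]
  have S2 : {q : ℝ × ℝ | q.1 ∈ Ioo a b ∧ q.2 ∈ Icc 0 (s q.1)} =
      {q | q.1 ∈ Ioo a b ∧ q.2 ∈ Icc 0 (σ q.1)} := by
    ext q; exact and_congr_right fun h => by rw [hs _ h]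
  have cK : ContinuousOn (fun q : ℝ × ℝ => UK G2 a φ f v σ q.1 q.2)
      {q | q.1 ∈ Ioo a b ∧ q.2 ∈ Ioo 0 (σ q.1)} := fun q hq =>
    (D.contK G2_ker (hoff q.1 hq.1 q.2 hq.2)).continuousWithinAt
  have hσc := D.V.sc
  have m0 : ∀ t ∈ Ioo a b, (0:ℝ) ∈ Icc 0 (σ t) := fun t ht => ⟨le_rfl, (hsp t ht).le⟩
  have m1 : ∀ t ∈ Ioo a b, σ t ∈ Icc 0 (σ t) := fun t ht => ⟨(hsp t ht).le, le_rfl⟩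
  refine ⟨?_, ?_, ?_, ?_, ?_, ?_, ?_, ?_, ?_, ?_, ?_, ?_, ?_, ?_, ?_⟩
  · exact fun t ht => (hsd t ht).differentiableAt
  · intro t ht
    refine (hv t ht).congr ?_
    filter_upwards [Ioo_mem_nhds ht.1 ht.2] with τ hτ using (hsd τ hτ).deriv.symm
  · exact fun t ht => by rw [hs t ht]; exact hsp t ht
  · exact fun t ht x hx => (dt t ht x (hs t ht ▸ hx)).differentiableAt
  · exact fun t ht x hx => (dx t ht x (hs t ht ▸ hx)).differentiableAt
  · exact fun t ht x hx => (dxx t ht x (hs t ht ▸ hx)).differentiableAt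
  · rw [S1]; exact cK.congr fun q hq => (dt q.1 hq.1 q.2 hq.2).deriv
  · rw [S1]; exact cK.congr fun q hq => (dxx q.1 hq.1 q.2 hq.2).deriv
  · rw [S2]
    rintro ⟨t, x⟩ ⟨ht, hx⟩
    simp only at ht hx
    have nt : ∀ᶠ q : ℝ × ℝ in 𝓝 (t, x), q.1 ∈ Ioo a b :=
      continuousAt_fst.preimage_mem_nhds (Ioo_mem_nhds ht.1 ht.2)
    rcases hx.1.eq_or_lt with rfl | hx0
    · have nl : ∀ᶠ q : ℝ × ℝ in 𝓝 (t, (0:ℝ)), q.2 < σ q.1 :=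
        ContinuousAt.eventually_lt (by fun_prop) (by fun_prop) (hsp t ht)
      have hA : ContinuousWithinAt (fun q : ℝ × ℝ => deriv (u q.1) q.2) {q | 0 < q.2} (t, 0) := by
        unfold ContinuousWithinAt
        simp only [h0 t ht]
        refine (D.lim0 ht.1 (hsp t ht) (hf t ht)).congr' ?_
        filter_upwards [self_mem_nhdsWithin, mem_nhdsWithin_of_mem_nhds nt,
          mem_nhdsWithin_of_mem_nhds nl] with q q1 q2 q3
        exact (dx q.1 q2 q.2 ⟨q1, q3⟩).deriv.symm
      have hB : ContinuousWithinAt (fun q : ℝ × ℝ => deriv (u q.1) q.2) {q | q.2 = 0} (t, 0) := by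
        unfold ContinuousWithinAt
        simp only [h0 t ht]
        have : ContinuousAt (fun q : ℝ × ℝ => - f q.1) (t, 0) :=
          ((hf t ht).comp (f := fun q : ℝ × ℝ => q.1) (x := (t, (0:ℝ))) continuousAt_fst).neg
        refine (this.tendsto.mono_left nhdsWithin_le_nhds).congr' ?_
        filter_upwards [self_mem_nhdsWithin, mem_nhdsWithin_of_mem_nhds nt] with q q1 q2
        rw [show q.2 = 0 from q1, h0 q.1 q2]
      exact (hA.union hB).mono fun q hq => by
        rcases hq.2.1.eq_or_lt with h | h
        · exact Or.inr h.symm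
        · exact Or.inl h
    · rcases hx.2.eq_or_lt with rfl | hx1
      · have nl : ∀ᶠ q : ℝ × ℝ in 𝓝 (t, σ t), 0 < q.2 :=
          ContinuousAt.eventually_lt (by fun_prop) (by fun_prop) (hsp t ht)
        have hA : ContinuousWithinAt (fun q : ℝ × ℝ => deriv (u q.1) q.2) {q | q.2 < σ q.1}
            (t, σ t) := by
          unfold ContinuousWithinAt
          simp only [h1 t ht]
          have h := D.limL ht.1 (hsp t ht) (hv t ht)
          rw [show UK G1 a φ f v σ t (σ t) - v t / 2 = - v t by linarith [heq t ht]] at h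
          refine h.congr' ?_
          filter_upwards [self_mem_nhdsWithin, mem_nhdsWithin_of_mem_nhds nt,
            mem_nhdsWithin_of_mem_nhds nl] with q q1 q2 q3
          exact (dx q.1 q2 q.2 ⟨q3, q1⟩).deriv.symm
        have hB : ContinuousWithinAt (fun q : ℝ × ℝ => deriv (u q.1) q.2) {q | q.2 = σ q.1}
            (t, σ t) := by
          unfold ContinuousWithinAt
          simp only [h1 t ht]
          have : ContinuousAt (fun q : ℝ × ℝ => - v q.1) (t, σ t) :=
            ((hv t ht).comp (f := fun q : ℝ × ℝ => q.1) (x := (t, σ t)) continuousAt_fst).neg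
          refine (this.tendsto.mono_left nhdsWithin_le_nhds).congr' ?_
          filter_upwards [self_mem_nhdsWithin, mem_nhdsWithin_of_mem_nhds nt] with q q1 q2
          rw [show q.2 = σ q.1 from q1, h1 q.1 q2]
        exact (hA.union hB).mono fun q hq => by
          rcases hq.2.2.eq_or_lt with h | h
          · exact Or.inr h
          · exact Or.inl h
      · refine ContinuousAt.continuousWithinAt ?_
        refine (D.contK G1_ker (hoff t ht x ⟨hx0, hx1⟩)).congr ?_
        have n1 : ∀ᶠ q : ℝ × ℝ in 𝓝 (t, x), 0 < q.2 :=
          ContinuousAt.eventually_lt (by fun_prop) (by fun_prop) hx0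
        have n2 : ∀ᶠ q : ℝ × ℝ in 𝓝 (t, x), q.2 < σ q.1 :=
          ContinuousAt.eventually_lt (by fun_prop) (by fun_prop) hx1
        filter_upwards [nt, n1, n2] with q q1 q2 q3 using (dx q.1 q1 q.2 ⟨q2, q3⟩).deriv.symm
  · rw [S2]; exact D.cont.continuousOn.congr fun q hq => hu q.1 hq.1 q.2 hq.2
  · exact fun t ht x hx => by
      rw [hs t ht] at hx; rw [hu t ht x hx]; exact hn t ht x hx
  · exact fun t ht x hx => by
      rw [hs t ht] at hx; rw [(dt t ht x hx).deriv, (dxx t ht x hx).deriv]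
  · exact fun t ht => by rw [h0 t ht, hu t ht 0 (m0 t ht), neg_neg, hfU t ht]
  · exact fun t ht => by rw [hs t ht, hu t ht _ (m1 t ht), hb t ht]
  · exact fun t ht => by rw [(hsd t ht).deriv, hs t ht, h1 t ht, neg_neg]

/-- linear extension of the potential beyond the region -/
def lext (a : ℝ) (φ f v σ : ℝ → ℝ) (t x : ℝ) : ℝ :=
  if x < 0 then U a φ f v σ t 0 - f t * x else if x ≤ σ t then U a φ f v σ t x else -v t * (x - σ t)

lemma lext_in {t x : ℝ} (hx : x ∈ Icc 0 (σ t)) : lext a φ f v σ t x = U a φ f v σ t x := by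
  unfold lext; rw [if_neg (not_lt.2 hx.1), if_pos hx.2]

lemma Dat.ext0 (D : Dat a B M R A φ f v σ) {t : ℝ} (ht : a < t) (hs : 0 < σ t)
    (hf : ContinuousAt f t) : deriv (lext a φ f v σ t) 0 = -f t := by
  have h1 : HasDerivWithinAt (lext a φ f v σ t) (-f t) (Ici 0) 0 := by
    refine (D.der0 ht hs hf).congr_of_eventuallyEq ?_ (lext_in ⟨le_rfl, hs.le⟩)
    filter_upwards [self_mem_nhdsWithin, mem_nhdsWithin_of_mem_nhds (gt_mem_nhds hs)] with x h1 h2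
    exact lext_in ⟨h1, le_of_lt h2⟩
  have h2 : HasDerivWithinAt (lext a φ f v σ t) (-f t) (Iic 0) 0 := by
    have : HasDerivAt (fun x : ℝ => U a φ f v σ t 0 - f t * x) (-f t) 0 :=
      (((hasDerivAt_id (0:ℝ)).const_mul (f t)).const_sub _).congr_deriv (by simp)
    have e0 : lext a φ f v σ t 0 = U a φ f v σ t 0 - f t * 0 := by
      rw [lext_in ⟨le_rfl, hs.le⟩]; ring
    refine this.hasDerivWithinAt.congr (fun x hx => ?_) e0
    rcases (show x ≤ 0 from hx).eq_or_lt with rfl | h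
    · exact e0
    · unfold lext; rw [if_pos h]
  have := h2.union h1
  rw [Iic_union_Ici, hasDerivWithinAt_univ] at this
  exact this.deriv

lemma Dat.ext1 (D : Dat a B M R A φ f v σ) {t : ℝ} (ht : a < t) (hs : 0 < σ t)
    (hv : ContinuousAt v t) (heq : v t = -2 * UK G1 a φ f v σ t (σ t))
    (hb : U a φ f v σ t (σ t) = 0) : deriv (lext a φ f v σ t) (σ t) = -v t := by
  have h1 : HasDerivWithinAt (lext a φ f v σ t) (-v t) (Iic (σ t)) (σ t) := by
    refine ((D.derL ht hs hv).congr_of_eventuallyEq ?_ (lext_in ⟨hs.le, le_rfl⟩)).congr_deriv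
      (by linarith)
    filter_upwards [self_mem_nhdsWithin, mem_nhdsWithin_of_mem_nhds (lt_mem_nhds hs)] with x h1 h2
    exact lext_in ⟨le_of_lt h2, h1⟩
  have h2 : HasDerivWithinAt (lext a φ f v σ t) (-v t) (Ici (σ t)) (σ t) := by
    have : HasDerivAt (fun x : ℝ => -v t * (x - σ t)) (-v t) (σ t) :=
      (((hasDerivAt_id (σ t)).sub_const (σ t)).const_mul (-v t)).congr_deriv (by simp)
    have e0 : lext a φ f v σ t (σ t) = -v t * (σ t - σ t) := by
      rw [lext_in ⟨hs.le, le_rfl⟩, hb]; ring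
    refine this.hasDerivWithinAt.congr (fun x hx => ?_) e0
    rcases (show σ t ≤ x from hx).eq_or_lt with rfl | h
    · exact e0
    · unfold lext; rw [if_neg (by linarith), if_neg (by linarith)]
  have := h1.union h2
  rw [Iic_union_Ici, hasDerivWithinAt_univ] at this
  exact this.deriv

end
end

noncomputable section

section
variable {p a c s₀ : ℝ} {φ s : ℝ → ℝ} {u : ℝ → ℝ → ℝ}

lemma extend (hp : 1 < p) (H : ∀ T, 0 < T → T < c → IsSolOn p s₀ φ T s u) (ha : a ∈ Ioo 0 c)
    {K N : ℝ} (hK : ∀ t ∈ Ico a c, u t 0 ≤ K ∧ deriv s t ≤ N) :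
    ∃ T, c < T ∧ ∃ s' u', IsSolOn p s₀ φ T s' u' := by
  have O := Old.of_sol H
  have R := Reg.of_sol H
  have sub : ∀ t ∈ Ico a c, t ∈ Ioo 0 c := fun t ht => ⟨ha.1.trans_le ht.1, ht.2⟩
  have sub' : Ioo a c ⊆ Ioo 0 c := fun t ht => sub t ⟨ht.1.le, ht.2⟩
  have u0 : ∀ t ∈ Ioo 0 c, 0 ≤ u t 0 := fun t ht => O.un t ht 0 ⟨le_rfl, (O.sp t ht).le⟩
  obtain ⟨M, b, hcb, hb1, w, v, W, V, hwv, hfix, hpos⟩ := fixpt (g1 := fun t => u t 0)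
    (g2 := deriv s) (M0 := |K| + |N|) hp ha.2 (O.ini ha) (O.sp a ha) (O.wc.mono sub')
    (O.vc.mono sub')
    (fun t ht => by
      rw [abs_of_nonneg (u0 t (sub' ht))]
      linarith [(hK t ⟨ht.1.le, ht.2⟩).1, le_abs_self K, abs_nonneg N])
    (fun t ht => by
      rw [abs_of_nonneg (O.vn t (sub' ht))]
      linarith [(hK t ⟨ht.1.le, ht.2⟩).2, le_abs_self N, abs_nonneg K])
    (fun t ht => O.vn t (sub' ht))
  set ψ : ℝ → ℝ := fun x => ub s u a |x| with hψ
  set σ := cur a (s a) v with hσ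
  set f : ℝ → ℝ := fun τ => psi p (w τ) with hf
  have D : Dat a (c + 1) (M + M ^ p) M (s a) ψ f v σ := Adm.dat hp (O.ini ha) W V
  have hab : a < b := ha.2.trans hcb
  have σa : σ a = s a := by simp [hσ, cur]
  have σs : ∀ t ∈ Ico a c, σ t = s t := by
    intro t ht
    have sb : ∀ τ ∈ uIcc a t, τ ∈ Ioo 0 c := fun τ hτ => by
      rw [uIcc_of_le ht.1] at hτ
      exact ⟨ha.1.trans_le hτ.1, hτ.2.trans_lt ht.2⟩
    have e1 : ∫ τ in a..t, v τ = ∫ τ in a..t, deriv s τ := by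
      refine intervalIntegral.integral_congr_ae (Eventually.of_forall fun τ hτ => ?_)
      rw [uIoc_of_le ht.1] at hτ
      exact (hwv τ ⟨hτ.1, hτ.2.trans_lt ht.2⟩).2
    have e2 := intervalIntegral.integral_eq_sub_of_hasDerivAt (fun τ hτ => O.sd τ (sb τ hτ))
      ((O.vc.mono sb).intervalIntegrable)
    rw [hσ, cur, e1, e2]; ring
  have near : ∀ {g h : ℝ → ℝ}, ContinuousOn h (Ioo 0 c) → (∀ τ ∈ Ioo a c, g τ = h τ) →
      ∀ t ∈ Ioo a c, ContinuousAt g t := fun {g h} hh he t ht => by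
    refine (hh.continuousAt (Ioo_mem_nhds (sub' ht).1 ht.2)).congr ?_
    filter_upwards [Ioo_mem_nhds ht.1 ht.2] with τ hτ using (he τ hτ).symm
  have wc0 : ∀ t ∈ Ioo a c, ContinuousAt w t := near O.wc fun τ hτ => (hwv τ hτ).1
  have vc0 : ∀ t ∈ Ioo a c, ContinuousAt v t := near O.vc fun τ hτ => (hwv τ hτ).2
  have fc0 : ∀ t ∈ Ioo a c, ContinuousAt f t := fun t ht =>
    (psi_cont hp).continuousAt.comp (wc0 t ht)
  have fu0 : ∀ t ∈ Ioo a c, f t = u t 0 ^ p := fun t ht => by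
    simp only [hf]; rw [(hwv t ht).1, psi_pos p (u0 t (sub' ht))]
  have hv0 : ∀ t ∈ Ioo a c, v t = deriv s t := fun t ht => (hwv t ht).2
  have rep := O.rep ha D σs fu0 fc0 hv0 vc0
  have eqs := O.eqs ha D σs fu0 fc0 hv0 vc0
  have EQ : ∀ t ∈ Ioc a b, w t = U a ψ f v σ t 0 ∧ v t = -2 * UK G1 a ψ f v σ t (σ t) := by
    intro t ht
    rcases lt_or_ge t c with h | h
    · have := eqs t ⟨ht.1, h⟩
      exact ⟨(hwv t ⟨ht.1, h⟩).1.trans this.1, this.2⟩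
    · exact hfix t ⟨h, ht.2⟩
  have wc : ∀ t ∈ Ioo a b, ContinuousAt w t := fun t ht => by
    have : ContinuousAt (fun t => U a ψ f v σ t 0) t :=
      (D.cont.comp (by fun_prop : Continuous fun t : ℝ => (t, (0:ℝ)))).continuousAt
    refine this.congr ?_
    filter_upwards [Ioo_mem_nhds ht.1 ht.2] with τ hτ using (EQ τ ⟨hτ.1, hτ.2.le⟩).1.symm
  have vc : ∀ t ∈ Ioo a b, ContinuousAt v t := fun t ht => by
    refine ((D.curve ht.1 (hpos t ⟨ht.1.le, ht.2.le⟩)).const_mul (-2)).congr ?_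
    filter_upwards [Ioo_mem_nhds ht.1 ht.2] with τ hτ using (EQ τ ⟨hτ.1, hτ.2.le⟩).2.symm
  have fc : ∀ t ∈ Ioo a b, ContinuousAt f t := fun t ht =>
    (psi_cont hp).continuousAt.comp (wc t ht)
  have dσ : ∀ t ∈ Ioo a b, HasDerivAt σ (v t) t := fun t ht =>
    (intervalIntegral.integral_hasDerivAt_right (V.ii a t)
      V.fm.stronglyMeasurable.stronglyMeasurableAtFilter (vc t ht)).const_add (s a)
  have ψ0 : ∀ x ≥ σ a, ψ x = 0 := fun x hx => by
    rw [σa] at hx; exact O.ub_zero ha (le_trans hx (le_abs_self x))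
  have ψn : ∀ x, 0 ≤ ψ x := fun x => by
    exact O.un a ha _ ⟨le_min (abs_nonneg x) (O.sp a ha).le, min_le_right _ _⟩
  have lt : ∀ T < b, ∀ t ∈ Ioc a T, t ∈ Ioo a b := fun T hT t ht => ⟨ht.1, ht.2.trans_lt hT⟩
  have ext : ∀ T < b, ∀ t ∈ Icc a T, U a ψ f v σ t (σ t) = 0 := fun T hT t ht =>
    D.exterior (T := T) (fun t ht => hpos t ⟨ht.1, ht.2.trans hT.le⟩)
      (fun t ht => vc t (lt T hT t ht)) (fun t ht => (EQ t ⟨ht.1, ht.2.trans hT.le⟩).2)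
      (fun t ht => dσ t (lt T hT t ht)) ψ0 t ht _ le_rfl
  have nn : ∀ t ∈ Ioo a b, ∀ x ∈ Icc 0 (σ t), 0 ≤ U a ψ f v σ t x := fun t ht =>
    D.nonneg (T := t) (fun τ hτ => hpos τ ⟨hτ.1, hτ.2.trans ht.2.le⟩)
      (fun τ hτ => ⟨fc τ (lt t ht.2 τ hτ), psi_nonneg _ _⟩) ψn (ext t ht.2) t ⟨ht.1.le, le_rfl⟩
  have hb0 : ∀ t ∈ Ioo a b, U a ψ f v σ t (σ t) = 0 := fun t ht =>
    ext t ht.2 t ⟨ht.1.le, le_rfl⟩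
  have hsp : ∀ t ∈ Ioo a b, 0 < σ t := fun t ht => hpos t ⟨ht.1.le, ht.2.le⟩
  have hfU : ∀ t ∈ Ioo a b, f t = U a ψ f v σ t 0 ^ p := fun t ht => by
    have h1 := nn t ht 0 ⟨le_rfl, (hsp t ht).le⟩
    rw [← (EQ t ⟨ht.1, ht.2.le⟩).1] at h1 ⊢
    exact psi_pos p h1
  set s' : ℝ → ℝ := fun t => if t < c then s t else σ t with hs'
  set u' : ℝ → ℝ → ℝ := fun t => if t < c then u t else lext a ψ f v σ t with hu'
  have s1 : ∀ t < c, s' t = s t := fun t ht => if_pos ht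
  have u1 : ∀ t < c, u' t = u t := fun t ht => if_pos ht
  have u2 : ∀ t, c ≤ t → u' t = lext a ψ f v σ t := fun t ht => if_neg (not_lt.2 ht)
  have s2 : ∀ t ∈ Ioo a b, s' t = σ t := fun t ht => by
    by_cases h : t < c
    · rw [s1 t h, σs t ⟨ht.1.le, h⟩]
    · exact if_neg h
  have R2 : Reg (Ioo a b) p s' u' := by
    refine D.reg hsp dσ vc fc hfU (fun t ht => (EQ t ⟨ht.1, ht.2.le⟩).2) nn hb0 s2 ?_ ?_ ?_
    · intro t ht x hx
      by_cases h : t < c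
      · rw [u1 t h, rep t ⟨ht.1.le, h⟩ x hx.1, ub_in]
        rw [← σs t ⟨ht.1.le, h⟩]; exact hx.2
      · rw [u2 t (not_lt.1 h), lext_in hx]
    · intro t ht
      by_cases h : t < c
      · rw [u1 t h, fu0 t ⟨ht.1, h⟩, ← R.b0 t (sub' ⟨ht.1, h⟩), neg_neg]
      · rw [u2 t (not_lt.1 h)]; exact D.ext0 ht.1 (hsp t ht) (fc t ht)
    · intro t ht
      by_cases h : t < c
      · rw [u1 t h, hv0 t ⟨ht.1, h⟩, σs t ⟨ht.1.le, h⟩, R.st t (sub' ⟨ht.1, h⟩), neg_neg]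
      · rw [u2 t (not_lt.1 h)]
        exact D.ext1 ht.1 (hsp t ht) (vc t ht) (EQ t ⟨ht.1, ht.2.le⟩).2 (hb0 t ht)
  have R1 : Reg (Ioo 0 c) p s' u' :=
    R.congr isOpen_Ioo (fun t ht => s1 t ht.2) (fun t ht => u1 t ht.2)
  have R3 := R1.union isOpen_Ioo isOpen_Ioo R2
  have eU : Ioo 0 c ∪ Ioo a b = Ioo 0 b := by
    ext t; simp only [mem_union, mem_Ioo]
    constructor
    · rintro (h | h)
      · exact ⟨h.1, h.2.trans hcb⟩
      · exact ⟨ha.1.trans h.1, h.2⟩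
    · intro h
      by_cases h' : t < c
      · exact Or.inl ⟨h.1, h'⟩
      · exact Or.inr ⟨ha.2.trans_le (not_lt.1 h'), h.2⟩
  rw [eU] at R3
  have hc : 0 < c := ha.1.trans ha.2
  exact ⟨(c + b) / 2, by linarith, s', u', R3.sol (by linarith) (by linarith) hc H s1 u1⟩

end

theorem stmt_9 (p : ℝ) (hp : 1 < p) (s₀ : ℝ) (φ g : ℝ → ℝ) (hW : memWtilde s₀ φ g)
    (s : ℝ → ℝ) (u : ℝ → ℝ → ℝ) (Tm : ℝ≥0∞) (hmax : IsMaxSol p s₀ φ Tm s u) (hfin : Tm ≠ ⊤) :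
    Tendsto (fun t => u t 0) (𝓝[<] Tm.toReal) atTop := by
  by_contra hnot
  obtain ⟨h0, hsol, hno⟩ := hmax
  have hc : 0 < Tm.toReal := ENNReal.toReal_pos h0.ne' hfin
  have H : ∀ T, 0 < T → T < Tm.toReal → IsSolOn p s₀ φ T s u := fun T hT hT2 =>
    hsol T hT ((ENNReal.ofReal_lt_iff_lt_toReal hT.le hfin).2 hT2)
  obtain ⟨a, ha, K, N, hK⟩ := (Old.of_sol H).bounds hp hc hnot
  obtain ⟨T, hT, s', u', hs⟩ := extend hp H ha hK
  exact hno T ((ENNReal.lt_ofReal_iff_toReal_lt hfin).2 hT) ⟨s', u', hs⟩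
end
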